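/- For every n ≥ 2 and every tuple d = (d_1,…,d_n) of nonnegative integers with g(d) a nonnegative integer and 2g(d)−2+n > 0, one has C(d) = Σ_{σ∈S_n, σ(n)=n} (−1)^{|S_σ^−|+1} · Σ_{k=(k_1,…,k_n), all k_j ≥ −1, k_1+⋯+k_n = d_1+⋯+d_n} a_{k_1,…,k_n} · ω_{d,σ,k}, where for a permutation σ of {1,…,n} fixing n one sets σ(n+1) := σ(1), S_σ^+ := {1 ≤ r ≤ n : σ(r+1) > σ(r)}, S_σ^− := {1 ≤ r ≤ n : σ(r+1) < σ(r)}, and ω_{d,σ,k} := max{0, min_{r∈S_σ^+} Σ_{q=1}^{r}(d_{σ(q)} − k_q) + min_{r∈S_σ^−} Σ_{q=1}^{r}(k_q − d_{σ(q)})}. -/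

import Mathlib

open scoped BigOperators

noncomputable section

namespace WittenAsym

/-- `g(d)` as a rational number: `g(d) = 1 + (∑ⱼ dⱼ − n)/3`. -/
def gQ (l : List ℕ) : ℚ := 1 + ((l.sum : ℚ) - (l.length : ℚ)) / 3

/-- `X(d)` as a rational number: `X(d) = (∑ⱼ (2dⱼ+1))/3 = 2g(d) − 2 + n`. -/
def XQ (l : List ℕ) : ℚ := (2 * (l.sum : ℚ) + (l.length : ℚ)) / 3

/-- `X(d)` as a natural number (the correct value whenever `X(d)` is an integer). -/
def XN (l : List ℕ) : ℕ := (2 * l.sum + l.length) / 3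

/-- `g(d)` is a nonnegative integer. -/
def IntegralG (l : List ℕ) : Prop := ∃ g : ℕ, (g : ℚ) = gQ l

/-- The subtuple of `r` indexed by the finite index set `I`. -/
def select (r : List ℕ) (I : Finset (Fin r.length)) : List ℕ :=
  ((List.finRange r.length).filter (fun i => i ∈ I)).map r.get

/-- The characterization of the normalized Witten intersection numbers
`C(d) = 2^{2g(d)} ∏ⱼ (2dⱼ+1)!! / (3^{2g(d)-2+n} (2g(d)-3+n)!) ∫ ψ₁^{d₁}⋯ψₙ^{dₙ}`:
they form the unique family of rationals, symmetric in the entries of `d`, vanishing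
when `g(d)` is not a nonnegative integer, with `C(0,0,0) = 1/3`, `C(1) = 1/6`,
and satisfying the DVV recursion whenever `X(d) = 2g(d) - 2 + n ≥ 2`. -/
structure IsNormalizedWitten (C : List ℕ → ℚ) : Prop where
  symm : ∀ {l l' : List ℕ}, l.Perm l' → C l = C l'
  init3 : C [0, 0, 0] = 1/3
  init1 : C [1] = 1/6
  vanish : ∀ l : List ℕ, ¬ IntegralG l → C l = 0
  dvv : ∀ (d₁ : ℕ) (r : List ℕ), IntegralG (d₁ :: r) → 2 ≤ XQ (d₁ :: r) →
    C (d₁ :: r) =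
      (∑ j : Fin r.length,
        if 1 ≤ d₁ + r.get j then
          (2 * (r.get j : ℚ) + 1) / (3 * (XQ (d₁ :: r) - 1)) *
            C (r.set j.val (d₁ + r.get j - 1))
        else 0)
      + ∑ a ∈ Finset.range (d₁ - 1),
          (2 / (3 * (XQ (d₁ :: r) - 1)) * C (a :: (d₁ - 2 - a) :: r)
          + ∑ I : Finset (Fin r.length),
              if 3 ∣ (2 * (a + (select r I).sum) + (1 + (select r I).length)) then
                ((XN (a :: select r I) - 1).factorial : ℚ) *
                  ((XN ((d₁ - 2 - a) :: select r Iᶜ) - 1).factorial : ℚ) /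
                  (6 * ((XN (d₁ :: r) - 1).factorial : ℚ)) *
                  C (a :: select r I) * C ((d₁ - 2 - a) :: select r Iᶜ)
              else 0)

/-- `Amat m` is the matrix `A_k` with `k = m − 1 ≥ −1` (indices shifted by one so
that the domain is `ℕ`): for `k = 3h−2` (`h ≥ 1`), `A_k = ((6h−5)!!/(2·24^{h−1}(h−1)!))·diag(−1,1)`;
for `k = 3h` (`h ≥ 0`), the only nonzero entry is the `(1,2)`-entry `−(6h−1)!!/(24^h h!)`;
for `k = 3h−1` (`h ≥ 0`), the only nonzero entry is the `(2,1)`-entry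
`((6h+1)/(6h−1))·(6h−1)!!/(24^h h!)` (with `(−1)!! = 1`). -/
noncomputable def Amat (m : ℕ) : Matrix (Fin 2) (Fin 2) ℚ :=
  if m % 3 = 2 then
    -- k = m − 1 = 3h − 2 with h = (m+1)/3 ≥ 1
    ((Nat.doubleFactorial (6 * ((m + 1) / 3) - 5) : ℚ) /
        (2 * 24 ^ ((m + 1) / 3 - 1) * (((m + 1) / 3 - 1).factorial : ℚ))) •
      Matrix.of ![![(-1 : ℚ), 0], ![0, 1]]
  else if m % 3 = 1 then
    -- k = m − 1 = 3h with h = (m−1)/3 ≥ 0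
    Matrix.of ![![0, -((Nat.doubleFactorial (6 * ((m - 1) / 3) - 1) : ℚ) /
        (24 ^ ((m - 1) / 3) * (((m - 1) / 3).factorial : ℚ)))], ![0, 0]]
  else
    -- k = m − 1 = 3h − 1 with h = m/3 ≥ 0
    Matrix.of ![![0, 0],
      ![((6 * ((m / 3 : ℕ) : ℚ) + 1) / (6 * ((m / 3 : ℕ) : ℚ) - 1)) *
          ((Nat.doubleFactorial (6 * (m / 3) - 1) : ℚ) /
            (24 ^ (m / 3) * ((m / 3).factorial : ℚ))), 0]]

abbrev PS := PowerSeries ℝ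
abbrev Mt := Matrix (Fin 2) (Fin 2) PS

/-- the coefficient `(6h-1)!!/(24^h h!)` -/
def alf (h : ℕ) : ℚ := (Nat.doubleFactorial (6 * h - 1) : ℚ) / (24 ^ h * (h.factorial : ℚ))

theorem alf_zero : alf 0 = 1 := by simp [alf]

theorem df_step (h : ℕ) : (Nat.doubleFactorial (6 * h + 1) : ℚ)
    = (6 * h + 1) * (Nat.doubleFactorial (6 * h - 1) : ℚ) := by
  rcases h with _ | h
  · simp
  · have : 6 * (h + 1) + 1 = (6 * (h+1) - 1) + 2 := by omega
    rw [this, Nat.doubleFactorial_add_two]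
    have h2 : 6 * (h + 1) - 1 + 2 = 6 * (h+1) + 1 := by omega
    rw [h2]; push_cast; ring

theorem alf_succ (h : ℕ) : alf (h + 1) = alf h * ((6 * h + 1) * (6 * h + 3) * (6 * h + 5) / (24 * (h + 1))) := by
  unfold alf
  have e : 6 * (h + 1) - 1 = (6 * h + 1) + 2 + 2 := by omega
  rw [e, Nat.doubleFactorial_add_two, Nat.doubleFactorial_add_two, Nat.factorial_succ, pow_succ]
  push_cast
  rw [df_step]
  have h1 : (h.factorial : ℚ) ≠ 0 := by positivity
  have h2 : (h : ℚ) + 1 ≠ 0 := by positivity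
  field_simp
  ring

theorem Amat_0 (h : ℕ) : Amat (3 * h) = !![0, 0; (6 * h + 1) / (6 * h - 1) * alf h, 0] := by
  have h1 : (3 * h) % 3 = 0 := by omega
  have h2 : (3 * h) / 3 = h := by omega
  unfold Amat alf
  rw [if_neg (by omega), if_neg (by omega), h2]

theorem Amat_1 (h : ℕ) : Amat (3 * h + 1) = !![0, -alf h; 0, 0] := by
  unfold Amat alf
  have h2 : (3 * h + 1 - 1) / 3 = h := by omega
  rw [if_neg (by omega), if_pos (by omega), h2]

theorem Amat_2 (h : ℕ) : Amat (3 * h + 2) = !![-((6 * h + 1) * alf h / 2), 0; 0, (6 * h + 1) * alf h / 2] := by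
  unfold Amat
  have h2 : (3 * h + 2 + 1) / 3 = h + 1 := by omega
  rw [if_pos (by omega), h2]
  have h3 : 6 * (h + 1) - 5 = 6 * h + 1 := by omega
  rw [h3, df_step]
  unfold alf
  have h1 : (h.factorial : ℚ) ≠ 0 := by positivity
  ext i j
  fin_cases i <;> fin_cases j <;> simp <;> field_simp

def E12 : Matrix (Fin 2) (Fin 2) ℚ := !![0, 1; 0, 0]
def E21 : Matrix (Fin 2) (Fin 2) ℚ := !![0, 0; 1, 0]

theorem mod3_cases (j : ℕ) : ∃ h, j = 3 * h ∨ j = 3 * h + 1 ∨ j = 3 * h + 2 := ⟨j / 3, by omega⟩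

theorem Amat_rec (j : ℕ) : (1 - 2 * (j : ℚ)) • Amat j =
    (E12 * Amat (j + 1) - Amat (j + 1) * E12) + (E21 * Amat (j + 2) - Amat (j + 2) * E21) := by
  obtain ⟨h, rfl | rfl | rfl⟩ := mod3_cases j
  · rw [Amat_0, Amat_1, Amat_2]
    have : (6 * (h : ℚ) - 1) ≠ 0 := by
      intro hh
      have : (6 * (h : ℤ) - 1) = 0 := by exact_mod_cast hh
      omega
    ext i k
    fin_cases i <;> fin_cases k <;> simp [E12, E21, Matrix.mul_apply, Fin.sum_univ_two]
    have h4 : 1 - 2 * (3 * (h : ℚ)) = - (6 * h - 1) := by ring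
    rw [h4]; field_simp; ring
  · have e : 3 * h + 1 + 2 = 3 * (h + 1) := by ring
    rw [e, Amat_1, Amat_2, Amat_0, alf_succ]
    have : (6 * ((h : ℚ) + 1) - 1) ≠ 0 := by
      have : (6 * ((h : ℚ) + 1) - 1) = 6 * h + 5 := by ring
      rw [this]; positivity
    have h3 : (h : ℚ) + 1 ≠ 0 := by positivity
    ext i k
    fin_cases i <;> fin_cases k <;> simp [E12, E21, Matrix.mul_apply, Fin.sum_univ_two]
    ring
  · have e : 3 * h + 2 + 1 = 3 * (h + 1) := by ring
    have e2 : 3 * h + 2 + 2 = 3 * (h + 1) + 1 := by ring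
    rw [e, e2, Amat_2, Amat_0, Amat_1, alf_succ]
    have : (6 * ((h : ℚ) + 1) - 1) = 6 * h + 5 := by ring
    have h5 : (6 * (h : ℚ) + 5) ≠ 0 := by positivity
    have h3 : (h : ℚ) + 1 ≠ 0 := by positivity
    ext i k
    fin_cases i <;> fin_cases k <;> simp [E12, E21, Matrix.mul_apply, Fin.sum_univ_two] <;>
     · rw [this]; field_simp; ring

theorem Amat_rec0 : E21 * Amat 0 - Amat 0 * E21 = 0 := by
  have := Amat_0 0
  simp only [mul_zero] at this
  rw [this]
  ext i k
  fin_cases i <;> fin_cases k <;> simp [E21, Matrix.mul_apply, Fin.sum_univ_two]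

theorem Amat_rec1 : (E12 * Amat 0 - Amat 0 * E12) + (E21 * Amat 1 - Amat 1 * E21) = 0 := by
  have h0 := Amat_0 0
  have h1 := Amat_1 0
  simp only [mul_zero, zero_add] at h0 h1
  rw [h0, h1]
  ext i k
  fin_cases i <;> fin_cases k <;> simp [E12, E21, Matrix.mul_apply, Fin.sum_univ_two, alf_zero]

theorem Amat_tr (j : ℕ) : Amat j 0 0 + Amat j 1 1 = 0 := by
  obtain ⟨h, rfl | rfl | rfl⟩ := mod3_cases j
  · rw [Amat_0]; simp
  · rw [Amat_1]; simp
  · rw [Amat_2]; simp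

/-- formal variable -/
def v : PS := PowerSeries.X

def Mx (x : ℝ) : Mt := Matrix.of fun i j => PowerSeries.mk fun k => (Amat k i j : ℝ) * x ^ (1 - (k : ℤ))
def dMx (x : ℝ) : Mt :=
  Matrix.of fun i j => PowerSeries.mk fun k => (1 - (k : ℝ)) * (Amat k i j : ℝ) * x ^ (-(k : ℤ))

def F12 : Mt := !![0, 1; 0, 0]
def F21 : Mt := !![0, 0; 1, 0]
def Dm (x : ℝ) : Mt := v • F12 + x • F21

theorem v_ne : v ≠ 0 := PowerSeries.X_ne_zero

theorem coeff_Mx (x : ℝ) (i j : Fin 2) (k : ℕ) :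
    PowerSeries.coeff k (Mx x i j) = (Amat k i j : ℝ) * x ^ (1 - (k : ℤ)) := by
  simp [Mx]

theorem coeff_dMx (x : ℝ) (i j : Fin 2) (k : ℕ) :
    PowerSeries.coeff k (dMx x i j) = (1 - (k : ℝ)) * (Amat k i j : ℝ) * x ^ (-(k : ℤ)) := by
  simp [dMx]

theorem coeff_v_mul_zero (f : PS) : PowerSeries.coeff 0 (v * f) = 0 := PowerSeries.coeff_zero_X_mul f
theorem coeff_v_mul_succ (n : ℕ) (f : PS) : PowerSeries.coeff (n + 1) (v * f) = PowerSeries.coeff n f :=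
  PowerSeries.coeff_succ_X_mul n f

theorem Mx_11 (x : ℝ) : Mx x 1 1 = - Mx x 0 0 := by
  ext k
  have h : (Amat k 1 1 : ℝ) = - (Amat k 0 0 : ℝ) := by
    have := Amat_tr k
    have h2 : Amat k 1 1 = - Amat k 0 0 := by linarith
    rw [h2]; push_cast; rfl
  rw [map_neg, coeff_Mx, coeff_Mx, h]; ring

theorem dMx_11 (x : ℝ) : dMx x 1 1 = - dMx x 0 0 := by
  ext k
  have h : (Amat k 1 1 : ℝ) = - (Amat k 0 0 : ℝ) := by
    have := Amat_tr k
    have h2 : Amat k 1 1 = - Amat k 0 0 := by linarith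
    rw [h2]; push_cast; rfl
  rw [map_neg, coeff_dMx, coeff_dMx, h]; ring

theorem zp1 (x : ℝ) (hx : x ≠ 0) (n : ℕ) : x ^ (1 - (n : ℤ)) = x * x ^ (-(n : ℤ)) := by
  rw [sub_eq_add_neg, zpow_add₀ hx, zpow_one]

theorem coeff_smul' (a : ℝ) (f : PS) (n : ℕ) : PowerSeries.coeff n (a • f) = a * PowerSeries.coeff n f := by
  simp

theorem Amat_rec_ent (j : ℕ) (i k : Fin 2) : (1 - 2 * (j : ℝ)) * (Amat j i k : ℝ) =
    (((E12 * Amat (j + 1) - Amat (j + 1) * E12) + (E21 * Amat (j + 2) - Amat (j + 2) * E21)) i k : ℚ) := by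
  rw [← Amat_rec]; simp

theorem ODE_00 (x : ℝ) (hx : x ≠ 0) : 2 * (v * (v * dMx x 0 0)) =
    x⁻¹ • (v * (v * Mx x 0 0)) + (v * Mx x 1 0 - x • Mx x 0 1) := by
  ext n
  have h0 := congrFun (congrFun Amat_rec0 0) 0
  have h1 := congrFun (congrFun Amat_rec1 0) 0
  simp [E12, E21, Matrix.mul_apply, Fin.sum_univ_two, Matrix.vecMul, dotProduct] at h0 h1
  rw [two_mul]
  simp only [map_add, map_sub, coeff_smul']
  rcases n with _ | _ | n
  · simp only [coeff_v_mul_zero, coeff_Mx, h0]; simp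
  · simp only [coeff_v_mul_zero, coeff_v_mul_succ, coeff_Mx]
    have h2 : (Amat 0 1 0 : ℝ) = (Amat 1 0 1 : ℝ) := by
      have : Amat 0 1 0 = Amat 1 0 1 := by linarith
      rw [this]
    simp [h2]; ring
  · simp only [coeff_v_mul_succ, coeff_Mx, coeff_dMx]
    have h := Amat_rec_ent n 0 0
    simp [E12, E21, Matrix.mul_apply, Fin.sum_univ_two, Matrix.vecMul, dotProduct] at h
    have e1 : x ^ (1 - ((n + 1 : ℕ) : ℤ)) = x ^ (-(n : ℤ)) := by congr 1; push_cast; ring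
    have e2 : x ^ (1 - ((n + 1 + 1 : ℕ) : ℤ)) = x⁻¹ * x ^ (-(n : ℤ)) := by
      rw [← zpow_neg_one, ← zpow_add₀ hx]; congr 1; push_cast; ring
    rw [e1, e2, zp1 x hx]
    field_simp
    linear_combination h

theorem ODE_01 (x : ℝ) (hx : x ≠ 0) : 2 * (v * (v * dMx x 0 1)) =
    x⁻¹ • (v * (v * Mx x 0 1)) + (v * (- 2 * Mx x 0 0)) := by
  have e3 : (-2 * Mx x 0 0) = Mx x 1 1 - Mx x 0 0 := by rw [Mx_11]; ring
  rw [e3]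
  ext n
  have h1 := congrFun (congrFun Amat_rec1 0) 1
  simp [E12, E21, Matrix.mul_apply, Fin.sum_univ_two, Matrix.vecMul, dotProduct] at h1
  rw [two_mul]
  rcases n with _ | _ | n
  · simp only [map_add, coeff_smul', coeff_v_mul_zero]; simp
  · simp only [map_add, map_sub, coeff_smul', coeff_v_mul_zero, coeff_v_mul_succ, coeff_Mx]
    have h2 : (Amat 0 1 1 : ℝ) = (Amat 0 0 0 : ℝ) := by
      have : Amat 0 1 1 = Amat 0 0 0 := by linarith
      rw [this]
    simp [h2]
  · simp only [map_add, map_sub, coeff_smul', coeff_v_mul_succ, coeff_Mx, coeff_dMx]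
    have h := Amat_rec_ent n 0 1
    simp [E12, E21, Matrix.mul_apply, Fin.sum_univ_two, Matrix.vecMul, dotProduct] at h
    have e1 : x ^ (1 - ((n + 1 : ℕ) : ℤ)) = x ^ (-(n : ℤ)) := by congr 1; push_cast; ring
    rw [e1, zp1 x hx]
    field_simp
    linear_combination h

theorem ODE_10 (x : ℝ) (hx : x ≠ 0) : 2 * (v * (v * dMx x 1 0)) =
    x⁻¹ • (v * (v * Mx x 1 0)) + (x • (2 * Mx x 0 0)) := by
  have e3 : (2 * Mx x 0 0) = Mx x 0 0 - Mx x 1 1 := by rw [Mx_11]; ring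
  rw [e3]
  ext n
  have h0 := congrFun (congrFun Amat_rec0 1) 0
  have h1 := congrFun (congrFun Amat_rec1 1) 0
  simp [E12, E21, Matrix.mul_apply, Fin.sum_univ_two, Matrix.vecMul, dotProduct] at h0 h1
  rw [two_mul]
  simp only [map_add, map_sub, coeff_smul']
  have aux : ∀ k, Amat k 0 0 - Amat k 1 1 = 0 → (Amat k 0 0 : ℝ) = Amat k 1 1 := by
    intro k hk
    have : Amat k 0 0 = Amat k 1 1 := by linarith
    rw [this]
  rcases n with _ | _ | n
  · simp only [coeff_v_mul_zero, coeff_Mx, aux 0 h0]; simp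
  · simp only [coeff_v_mul_zero, coeff_v_mul_succ, coeff_Mx, aux 1 h1]
    simp
  · simp only [coeff_v_mul_succ, coeff_Mx, coeff_dMx]
    have h := Amat_rec_ent n 1 0
    simp [E12, E21, Matrix.mul_apply, Fin.sum_univ_two, Matrix.vecMul, dotProduct] at h
    have e2 : x ^ (1 - ((n + 1 + 1 : ℕ) : ℤ)) = x⁻¹ * x ^ (-(n : ℤ)) := by
      rw [← zpow_neg_one, ← zpow_add₀ hx]; congr 1; push_cast; ring
    rw [e2, zp1 x hx]
    field_simp
    linear_combination h

theorem coeff_euler (x : ℝ) (hx : x ≠ 0) (i j i' j' : Fin 2) (w : ℕ) :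
    PowerSeries.coeff w (x • (dMx x i j * Mx x i' j' + Mx x i j * dMx x i' j')) =
      (2 - (w : ℝ)) * PowerSeries.coeff w (Mx x i j * Mx x i' j') := by
  rw [coeff_smul', map_add, PowerSeries.coeff_mul, PowerSeries.coeff_mul, PowerSeries.coeff_mul,
    ← Finset.sum_add_distrib, Finset.mul_sum, Finset.mul_sum]
  apply Finset.sum_congr rfl
  rintro ⟨a, b⟩ hab
  have hab := Finset.HasAntidiagonal.mem_antidiagonal.mp hab
  simp only at hab ⊢
  have : (w : ℝ) = a + b := by rw [← hab]; push_cast; ring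
  rw [coeff_Mx, coeff_Mx, coeff_dMx, coeff_dMx, zp1 x hx, zp1 x hx, this]
  ring

theorem vv_cancel {f g : PS} (h : v * (v * f) = v * (v * g)) : f = g :=
  mul_left_cancel₀ v_ne (mul_left_cancel₀ v_ne h)

theorem Msq_ent (x : ℝ) (hx : x ≠ 0) : Mx x 0 0 * Mx x 0 0 + Mx x 0 1 * Mx x 1 0 = x • v := by
  set p := Mx x 0 0 * Mx x 0 0 + Mx x 0 1 * Mx x 1 0 with hp
  set q := (dMx x 0 0 * Mx x 0 0 + Mx x 0 0 * dMx x 0 0) + (dMx x 0 1 * Mx x 1 0 + Mx x 0 1 * dMx x 1 0) with hq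
  have key : x • q = p := by
    have : (2:PS) * q = x⁻¹ • (2 * p) := by
      apply vv_cancel
      have h1 := ODE_00 x hx
      have h2 := ODE_01 x hx
      have h3 := ODE_10 x hx
      simp only [PowerSeries.smul_eq_C_mul] at *
      rw [hp, hq]
      linear_combination (2 * Mx x 0 0) * h1 + Mx x 1 0 * h2 + Mx x 0 1 * h3
    have h2 : (2:PS) * (x • q) = 2 * p := by
      rw [mul_smul_comm, this, smul_smul, mul_inv_cancel₀ hx, one_smul]
    have t : (2:PS) ≠ 0 := by
      intro h
      have := congrArg (PowerSeries.coeff 0) h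
      have e : (2:PS) = PowerSeries.C (2:ℝ) := (map_ofNat _ 2).symm
      rw [e] at this
      simp at this
    exact mul_left_cancel₀ t h2
  have hc : ∀ w : ℕ, (1 - (w:ℝ)) * PowerSeries.coeff w p = 0 := by
    intro w
    have h1 : PowerSeries.coeff w (x • q) = (2 - (w : ℝ)) * PowerSeries.coeff w p := by
      rw [hp, hq, smul_add, map_add, coeff_euler x hx, coeff_euler x hx, map_add]; ring
    rw [key] at h1
    linear_combination -h1
  ext w
  by_cases hw : w = 1
  · subst hw
    have h0 := Amat_0 0
    have h1 := Amat_1 0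
    simp only [mul_zero, zero_add] at h0 h1
    rw [hp, map_add, PowerSeries.coeff_mul, PowerSeries.coeff_mul]
    simp [Finset.Nat.antidiagonal_succ, coeff_Mx, h0, h1, alf_zero, v]
  · have h1 : (1 - (w:ℝ)) ≠ 0 := by
      intro h; apply hw
      have : (w:ℝ) = 1 := by linarith
      exact_mod_cast this
    have := (mul_eq_zero.mp (hc w)).resolve_left h1
    rw [this, coeff_smul', v, PowerSeries.coeff_X, if_neg hw]; simp

theorem Msq (x : ℝ) (hx : x ≠ 0) : Mx x * Mx x = (x • v) • (1 : Mt) := by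
  have h := Msq_ent x hx
  have h1 := Mx_11 x
  refine Matrix.ext fun i j => ?_
  fin_cases i <;> fin_cases j <;> simp only [Matrix.mul_apply, Fin.sum_univ_two, h1, Matrix.smul_apply, Fin.zero_eta, Fin.mk_one] <;> simp
  · rw [h]
  · ring
  · ring
  · rw [← h]; ring

theorem Mx_tr (x : ℝ) : (Mx x).trace = 0 := by
  rw [Matrix.trace_fin_two, Mx_11]; ring
theorem dMx_tr (x : ℝ) : (dMx x).trace = 0 := by
  rw [Matrix.trace_fin_two, dMx_11]; ring

theorem ODE (x : ℝ) (hx : x ≠ 0) : (2:ℝ) • (v * v) • dMx x =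
    x⁻¹ • (v * v) • Mx x + (Dm x * Mx x - Mx x * Dm x) := by
  have h1 := ODE_00 x hx
  have h2 := ODE_01 x hx
  have h3 := ODE_10 x hx
  have h4 := Mx_11 x
  have h5 := dMx_11 x
  have t : PowerSeries.C (2:ℝ) = (2:PS) := map_ofNat _ 2
  refine Matrix.ext fun i j => ?_
  fin_cases i <;> fin_cases j <;> simp [Dm, F12, F21, Matrix.mul_apply, Fin.sum_univ_two, Matrix.vecMul, dotProduct, h4, h5]
  all_goals simp only [PowerSeries.smul_eq_C_mul, map_ofNat] at h1 h2 h3 ⊢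
  · linear_combination h1
  · linear_combination h2
  · linear_combination h3
  · linear_combination -h1

theorem hasDerivAt_Mx (x : ℝ) (hx : x ≠ 0) (i j : Fin 2) (k : ℕ) :
    HasDerivAt (fun y => PowerSeries.coeff k (Mx y i j)) (PowerSeries.coeff k (dMx x i j)) x := by
  simp only [coeff_Mx, coeff_dMx]
  have h := (hasDerivAt_zpow (1 - (k:ℤ)) x (Or.inl hx)).const_mul (Amat k i j : ℝ)
  have e : (1 - (k:ℤ) - 1) = -(k:ℤ) := by ring
  rw [e] at h
  have e2 : (Amat k i j : ℝ) * (((1 - (k:ℤ) : ℤ) : ℝ) * x ^ (-(k:ℤ))) = (1 - (k : ℝ)) * (Amat k i j : ℝ) * x ^ (-(k : ℤ)) := by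
    push_cast; ring
  rw [e2] at h
  exact h

section Ords
variable {A : Type*} [DecidableEq A] {B : Type*} [AddCommMonoid B]

/-- all orderings of a finite set -/
def ords (L : Finset A) : Finset (List A) := ⟨L.val.lists, Multiset.lists_nodup_finset L⟩

theorem mem_ords {L : Finset A} {l : List A} : l ∈ ords L ↔ l.Nodup ∧ l.toFinset = L := by
  unfold ords
  rw [Finset.mem_mk, Multiset.mem_lists_iff]
  constructor
  · intro h
    have hn : l.Nodup := by
      have := L.nodup
      rw [h] at this
      exact Multiset.coe_nodup.mp this
    refine ⟨hn, ?_⟩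
    ext a
    rw [List.mem_toFinset, ← Finset.mem_val, h]; simp
  · rintro ⟨hn, rfl⟩
    rw [List.toFinset_val, hn.dedup]; rfl

theorem ords_empty : ords (∅ : Finset A) = {[]} := by
  ext l; rw [mem_ords, Finset.mem_singleton, List.toFinset_eq_empty_iff]
  constructor
  · exact fun h => h.2
  · rintro rfl; simp

theorem ords_singleton (a : A) : ords ({a} : Finset A) = {[a]} := by
  ext l; rw [mem_ords, Finset.mem_singleton]
  constructor
  · rintro ⟨hn, h⟩
    have hl : l.length = 1 := by
      rw [← List.toFinset_card_of_nodup hn, h]; simp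
    obtain ⟨b, rfl⟩ := List.length_eq_one_iff.mp hl
    simpa using h
  · rintro rfl; simp

theorem ords_length {L : Finset A} {l : List A} (h : l ∈ ords L) : l.length = L.card := by
  obtain ⟨hn, rfl⟩ := mem_ords.mp h
  rw [List.toFinset_card_of_nodup hn]

theorem ords_mem {L : Finset A} {l : List A} (h : l ∈ ords L) {a : A} : a ∈ l ↔ a ∈ L := by
  obtain ⟨hn, rfl⟩ := mem_ords.mp h
  simp

theorem ords_ne_nil {L : Finset A} {l : List A} (h : l ∈ ords L) (hL : L.Nonempty) : l ≠ [] := by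
  rintro rfl
  have := ords_length h
  simp at this
  exact hL.ne_empty (Finset.card_eq_zero.mp this.symm)

theorem cons_mem_ords {L : Finset A} {a : A} {l : List A} :
    a :: l ∈ ords L ↔ a ∈ L ∧ l ∈ ords (L.erase a) := by
  rw [mem_ords, mem_ords, List.nodup_cons, List.toFinset_cons]
  constructor
  · rintro ⟨⟨h1, h2⟩, rfl⟩
    refine ⟨by simp, h2, ?_⟩
    rw [Finset.erase_insert]; simpa using h1
  · rintro ⟨h1, h2, h3⟩
    refine ⟨⟨?_, h2⟩, ?_⟩
    · intro h
      have : a ∈ l.toFinset := by simpa using h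
      rw [h3] at this; simp at this
    · rw [h3, Finset.insert_erase h1]

/-- sum over orderings by the first element -/
theorem sum_ords_cons {L : Finset A} (hL : L.Nonempty) (f : List A → B) :
    ∑ l ∈ ords L, f l = ∑ a ∈ L, ∑ l ∈ ords (L.erase a), f (a :: l) := by
  rw [Finset.sum_sigma']
  symm
  refine Finset.sum_bij (fun p _ => p.1 :: p.2) ?_ ?_ ?_ ?_
  · rintro ⟨a, l⟩ h
    rw [Finset.mem_sigma] at h
    exact cons_mem_ords.mpr h
  · rintro ⟨a, l⟩ h ⟨b, l'⟩ h' e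
    simp only [List.cons.injEq] at e
    obtain ⟨rfl, rfl⟩ := e; rfl
  · intro l hl
    rcases l with _ | ⟨a, l⟩
    · exact absurd rfl (ords_ne_nil hl hL)
    · exact ⟨⟨a, l⟩, Finset.mem_sigma.mpr (cons_mem_ords.mp hl), rfl⟩
  · intros; rfl

theorem append_mem_ords {I L : Finset A} (hI : I ⊆ L) {l1 l2 : List A} (h1 : l1 ∈ ords I)
    (h2 : l2 ∈ ords (L \ I)) : l1 ++ l2 ∈ ords L := by
  rw [mem_ords] at *
  refine ⟨List.Nodup.append h1.1 h2.1 ?_, ?_⟩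
  · intro a ha hb
    have ha : a ∈ l1.toFinset := by simpa using ha
    have hb : a ∈ l2.toFinset := by simpa using hb
    rw [h1.2] at ha; rw [h2.2] at hb
    exact (Finset.mem_sdiff.mp hb).2 ha
  · rw [List.toFinset_append, h1.2, h2.2, Finset.union_sdiff_of_subset hI]

theorem append_mem_ords' {L : Finset A} {l1 l2 : List A} (h : l1 ++ l2 ∈ ords L) :
    l1.toFinset ⊆ L ∧ l1 ∈ ords l1.toFinset ∧ l2 ∈ ords (L \ l1.toFinset) := by
  rw [mem_ords] at h
  have hd := List.nodup_append.mp h.1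
  refine ⟨?_, mem_ords.mpr ⟨hd.1, rfl⟩, mem_ords.mpr ⟨hd.2.1, ?_⟩⟩
  · rw [← h.2, List.toFinset_append]; exact Finset.subset_union_left
  · rw [← h.2, List.toFinset_append]
    ext a
    simp only [Finset.mem_sdiff, Finset.mem_union, List.mem_toFinset]
    constructor
    · intro ha
      exact ⟨Or.inr ha, fun hb => hd.2.2 a hb a ha rfl⟩
    · rintro ⟨h1 | h1, h2⟩
      · exact absurd h1 h2
      · exact h1

/-- sums over ordered pairs of orderings of complementary subsets -/
theorem sum_ords_split (L : Finset A) (f : List A → List A → B) :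
    ∑ I ∈ L.powerset, ∑ l1 ∈ ords I, ∑ l2 ∈ ords (L \ I), f l1 l2 =
      ∑ l ∈ ords L, ∑ i ∈ Finset.range (l.length + 1), f (l.take i) (l.drop i) := by
  have e1 : ∀ I ∈ L.powerset, ∑ l1 ∈ ords I, ∑ l2 ∈ ords (L \ I), f l1 l2 =
      ∑ p ∈ ords I ×ˢ ords (L \ I), f p.1 p.2 := fun I _ => by rw [Finset.sum_product]
  rw [Finset.sum_congr rfl e1, Finset.sum_sigma', Finset.sum_sigma']
  refine Finset.sum_bij (fun p _ => ⟨p.2.1 ++ p.2.2, p.2.1.length⟩) ?_ ?_ ?_ ?_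
  · rintro ⟨I, l1, l2⟩ h
    simp only [Finset.mem_sigma, Finset.mem_powerset, Finset.mem_product] at h
    simp only [Finset.mem_sigma, Finset.mem_range, List.length_append]
    exact ⟨append_mem_ords h.1 h.2.1 h.2.2, by omega⟩
  · rintro ⟨I, l1, l2⟩ h ⟨I', l1', l2'⟩ h' e
    simp only [Finset.mem_sigma, Finset.mem_powerset, Finset.mem_product] at h h'
    simp only [Sigma.mk.injEq, heq_eq_eq] at e
    obtain ⟨rfl, rfl⟩ := List.append_inj e.1 e.2
    have : I = I' := by rw [← (mem_ords.mp h.2.1).2, ← (mem_ords.mp h'.2.1).2]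
    subst this; rfl
  · rintro ⟨l, i⟩ h
    simp only [Finset.mem_sigma, Finset.mem_range] at h
    have h1 : l.take i ++ l.drop i ∈ ords L := by rw [List.take_append_drop]; exact h.1
    obtain ⟨a, b, c⟩ := append_mem_ords' h1
    refine ⟨⟨(l.take i).toFinset, l.take i, l.drop i⟩, ?_, ?_⟩
    · simp only [Finset.mem_sigma, Finset.mem_powerset, Finset.mem_product]
      exact ⟨a, b, c⟩
    · simp only [List.take_append_drop, List.length_take]
      rw [min_eq_left (by omega)]
  · rintro ⟨I, l1, l2⟩ h
    simp

/-- sums over orderings of `insert y L` -/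
theorem sum_ords_insert {L : Finset A} {y : A} (hy : y ∉ L) (f : List A → B) :
    ∑ l ∈ ords (insert y L), f l =
      ∑ I ∈ L.powerset, ∑ l1 ∈ ords I, ∑ l2 ∈ ords (L \ I), f (l1 ++ y :: l2) := by
  have e1 : ∀ I ∈ L.powerset, ∑ l1 ∈ ords I, ∑ l2 ∈ ords (L \ I), f (l1 ++ y :: l2) =
      ∑ p ∈ ords I ×ˢ ords (L \ I), f (p.1 ++ y :: p.2) := fun I _ => by rw [Finset.sum_product]
  rw [Finset.sum_congr rfl e1, Finset.sum_sigma']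
  symm
  have key : ∀ I l1, I ⊆ L → l1 ∈ ords I → y ∉ l1 := by
    intro I l1 hI h hh
    exact hy (hI ((ords_mem h).mp hh))
  refine Finset.sum_bij (fun p _ => p.2.1 ++ y :: p.2.2) ?_ ?_ ?_ ?_
  · rintro ⟨I, l1, l2⟩ h
    simp only [Finset.mem_sigma, Finset.mem_powerset, Finset.mem_product] at h
    refine append_mem_ords (I := I) (h.1.trans (Finset.subset_insert _ _)) h.2.1 ?_
    rw [cons_mem_ords]
    have hyI : y ∉ I := fun hh => hy (h.1 hh)
    refine ⟨by simp [hyI], ?_⟩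
    have : (insert y L \ I).erase y = L \ I := by
      ext a; simp only [Finset.mem_erase, Finset.mem_sdiff, Finset.mem_insert]
      constructor
      · rintro ⟨h1, h2 | h2, h3⟩
        · exact absurd h2 h1
        · exact ⟨h2, h3⟩
      · rintro ⟨h1, h2⟩
        exact ⟨fun hh => hy (hh ▸ h1), Or.inr h1, h2⟩
    rw [this]; exact h.2.2
  · rintro ⟨I, l1, l2⟩ h ⟨I', l1', l2'⟩ h' e
    simp only [Finset.mem_sigma, Finset.mem_powerset, Finset.mem_product] at h h'
    simp only at e
    have k1 := key I l1 h.1 h.2.1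
    have k2 := key I' l1' h'.1 h'.2.1
    have hlen : l1.length = l1'.length := by
      have := congrArg (List.idxOf y) e
      rw [List.idxOf_append_of_notMem k1, List.idxOf_append_of_notMem k2] at this
      simpa using this
    obtain ⟨rfl, e2⟩ := List.append_inj e hlen
    simp only [List.cons.injEq, true_and] at e2
    subst e2
    have : I = I' := by rw [← (mem_ords.mp h.2.1).2, ← (mem_ords.mp h'.2.1).2]
    subst this; rfl
  · intro l hl
    have hyl : y ∈ l := (ords_mem hl).mpr (by simp)
    obtain ⟨l1, l2, rfl⟩ := List.append_of_mem hyl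
    obtain ⟨a, b, c⟩ := append_mem_ords' hl
    have hn := List.nodup_append.mp (mem_ords.mp hl).1
    have hy1 : y ∉ l1 := fun h => hn.2.2 y h y (by simp) rfl
    rw [cons_mem_ords] at c
    have hsub : l1.toFinset ⊆ L := by
      intro u hu
      rcases Finset.mem_insert.mp (a hu) with h | h
      · subst h; exact absurd (by simpa using hu) hy1
      · exact h
    refine ⟨⟨l1.toFinset, l1, l2⟩, ?_, rfl⟩
    simp only [Finset.mem_sigma, Finset.mem_powerset, Finset.mem_product]
    refine ⟨hsub, b, ?_⟩
    have : (insert y L \ l1.toFinset).erase y = L \ l1.toFinset := by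
      ext a; simp only [Finset.mem_erase, Finset.mem_sdiff, Finset.mem_insert]
      constructor
      · rintro ⟨h1, h2 | h2, h3⟩
        · exact absurd h2 h1
        · exact ⟨h2, h3⟩
      · rintro ⟨h1, h2⟩
        exact ⟨fun hh => hy (hh ▸ h1), Or.inr h1, h2⟩
    rw [← this]; exact c.2
  · intros; rfl

/-- rotation invariance of sums over orderings -/
theorem sum_ords_rot {L : Finset A} (hL : 2 ≤ L.card) (f g : List A → B)
    (h : ∀ a t, t ≠ [] → a :: t ∈ ords L → f (a :: t) = g (t ++ [a])) :
    ∑ l ∈ ords L, f l = ∑ l ∈ ords L, g l := by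
  refine Finset.sum_bij (fun l _ => l.rotate 1) ?_ ?_ ?_ ?_
  · intro l hl
    rw [mem_ords] at *
    refine ⟨List.nodup_rotate.mpr hl.1, ?_⟩
    rw [← hl.2]; exact List.toFinset_eq_of_perm _ _ (List.rotate_perm l 1)
  · intro l _ l' _ e
    exact List.rotate_injective 1 e
  · intro l hl
    refine ⟨l.rotate (l.length - 1), ?_, ?_⟩
    · rw [mem_ords] at *
      refine ⟨List.nodup_rotate.mpr hl.1, ?_⟩
      rw [← hl.2]; exact List.toFinset_eq_of_perm _ _ (List.rotate_perm l _)
    · have := ords_length hl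
      rw [List.rotate_rotate, Nat.sub_add_cancel (by omega), List.rotate_length]
  · intro l hl
    rcases l with _ | ⟨a, t⟩
    · have := ords_length hl
      simp at this; omega
    · have := ords_length hl
      rw [h a t ?_ hl]
      · simp
      · rintro rfl; simp at this; omega

end Ords

/-- coefficientwise derivative of a power series depending on a real parameter -/
def HD (f : ℝ → PS) (f' : PS) (x : ℝ) : Prop :=
  ∀ n, HasDerivAt (fun y => PowerSeries.coeff n (f y)) (PowerSeries.coeff n f') x

theorem HD.congr {f g : ℝ → PS} {f' : PS} {x : ℝ} (h : HD f f' x)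
    (e : ∀ᶠ y in nhds x, g y = f y) : HD g f' x := fun n =>
  (h n).congr_of_eventuallyEq (e.mono fun y hy => by simp only [hy])

theorem HD.unique {f : ℝ → PS} {f' f'' : PS} {x : ℝ} (h : HD f f' x) (h' : HD f f'' x) : f' = f'' := by
  ext n; exact (h n).unique (h' n)

theorem HD.const (c : PS) (x : ℝ) : HD (fun _ => c) 0 x := fun n => by
  simpa using hasDerivAt_const x (PowerSeries.coeff n c)

theorem HD.add {f g : ℝ → PS} {f' g' : PS} {x : ℝ} (h : HD f f' x) (h' : HD g g' x) :
    HD (fun y => f y + g y) (f' + g') x := fun n => by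
  simp only [map_add]; exact (h n).add (h' n)

theorem HD.neg {f : ℝ → PS} {f' : PS} {x : ℝ} (h : HD f f' x) :
    HD (fun y => - f y) (- f') x := fun n => by
  simp only [map_neg]; exact (h n).neg

theorem HD.sub {f g : ℝ → PS} {f' g' : PS} {x : ℝ} (h : HD f f' x) (h' : HD g g' x) :
    HD (fun y => f y - g y) (f' - g') x := fun n => by
  simp only [map_sub]; exact (h n).sub (h' n)

theorem HD.sum {ι : Type*} {s : Finset ι} {f : ι → ℝ → PS} {f' : ι → PS} {x : ℝ}
    (h : ∀ i ∈ s, HD (f i) (f' i) x) : HD (fun y => ∑ i ∈ s, f i y) (∑ i ∈ s, f' i) x := fun n => by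
  simp only [map_sum]
  exact HasDerivAt.fun_sum fun i hi => h i hi n

theorem HD.mul {f g : ℝ → PS} {f' g' : PS} {x : ℝ} (h : HD f f' x) (h' : HD g g' x) :
    HD (fun y => f y * g y) (f' * g x + f x * g') x := fun n => by
  simp only [map_add, PowerSeries.coeff_mul, ← Finset.sum_add_distrib]
  exact HasDerivAt.fun_sum fun i _ => (h i.1).mul (h' i.2)

theorem HD.smul {r : ℝ → ℝ} {r' : ℝ} {f : ℝ → PS} {f' : PS} {x : ℝ} (h : HasDerivAt r r' x)
    (h' : HD f f' x) : HD (fun y => r y • f y) (r' • f x + r x • f') x := fun n => by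
  simp only [map_add, coeff_smul']
  exact h.mul (h' n)

theorem HD.const_mul (c : PS) {f : ℝ → PS} {f' : PS} {x : ℝ} (h : HD f f' x) :
    HD (fun y => c * f y) (c * f') x := by
  simpa using (HD.const c x).mul h

def HDM (f : ℝ → Mt) (f' : Mt) (x : ℝ) : Prop := ∀ i j, HD (fun y => f y i j) (f' i j) x

theorem HDM.const (c : Mt) (x : ℝ) : HDM (fun _ => c) 0 x := fun i j => HD.const _ _

theorem HDM.add {f g : ℝ → Mt} {f' g' : Mt} {x : ℝ} (h : HDM f f' x) (h' : HDM g g' x) :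
    HDM (fun y => f y + g y) (f' + g') x := fun i j => (h i j).add (h' i j)
theorem HDM.neg {f : ℝ → Mt} {f' : Mt} {x : ℝ} (h : HDM f f' x) :
    HDM (fun y => - f y) (- f') x := fun i j => (h i j).neg
theorem HDM.sub {f g : ℝ → Mt} {f' g' : Mt} {x : ℝ} (h : HDM f f' x) (h' : HDM g g' x) :
    HDM (fun y => f y - g y) (f' - g') x := fun i j => (h i j).sub (h' i j)
theorem HDM.sum {ι : Type*} {s : Finset ι} {f : ι → ℝ → Mt} {f' : ι → Mt} {x : ℝ}
    (h : ∀ i ∈ s, HDM (f i) (f' i) x) : HDM (fun y => ∑ i ∈ s, f i y) (∑ i ∈ s, f' i) x := fun i j => by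
  simp only [Matrix.sum_apply]
  exact HD.sum fun k hk => h k hk i j
theorem HDM.mul {f g : ℝ → Mt} {f' g' : Mt} {x : ℝ} (h : HDM f f' x) (h' : HDM g g' x) :
    HDM (fun y => f y * g y) (f' * g x + f x * g') x := fun i j => by
  simp only [Matrix.add_apply, Matrix.mul_apply, ← Finset.sum_add_distrib]
  exact HD.sum fun k _ => (h i k).mul (h' k j)
theorem HDM.smul {r : ℝ → ℝ} {r' : ℝ} {f : ℝ → Mt} {f' : Mt} {x : ℝ} (h : HasDerivAt r r' x)
    (h' : HDM f f' x) : HDM (fun y => r y • f y) (r' • f x + r x • f') x := fun i j =>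
  HD.smul h (h' i j)
theorem HDM.smul_const {r : ℝ → ℝ} {r' : ℝ} (c : Mt) {x : ℝ} (h : HasDerivAt r r' x) :
    HDM (fun y => r y • c) (r' • c) x := by
  simpa using HDM.smul h (HDM.const c x)
theorem HDM.const_mul (c : Mt) {f : ℝ → Mt} {f' : Mt} {x : ℝ} (h : HDM f f' x) :
    HDM (fun y => c * f y) (c * f') x := by
  simpa using (HDM.const c x).mul h
theorem HDM.mul_const (c : Mt) {f : ℝ → Mt} {f' : Mt} {x : ℝ} (h : HDM f f' x) :
    HDM (fun y => f y * c) (f' * c) x := by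
  simpa using h.mul (HDM.const c x)
theorem HDM.trace {f : ℝ → Mt} {f' : Mt} {x : ℝ} (h : HDM f f' x) :
    HD (fun y => (f y).trace) f'.trace x := by
  simp only [Matrix.trace_fin_two]
  exact (h 0 0).add (h 1 1)

theorem HDM_Mx {x : ℝ} (hx : x ≠ 0) : HDM Mx (dMx x) x := fun i j n => hasDerivAt_Mx x hx i j n

/-! ### chain weights -/

def fs (l : List ℝ) : ℝ := l.headD 0
def la (l : List ℝ) : ℝ := l.getLastD 0

def ch : List ℝ → ℝ
  | [] => 1
  | a :: t => (match t with
    | [] => 1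
    | b :: _ => a - b) * ch t

theorem fs_cons (a : ℝ) (t : List ℝ) : fs (a :: t) = a := rfl
theorem la_single (a : ℝ) : la [a] = a := rfl
theorem la_append_single (a : ℝ) (t : List ℝ) : la (t ++ [a]) = a := by simp [la]
theorem la_append {t : List ℝ} (h : t ≠ []) (s : List ℝ) : la (s ++ t) = la t := by
  simp [la, List.getLastD_eq_getLast?, List.getLast?_append, h]
  rw [List.getLast?_eq_some_getLast h]; simp
theorem la_cons (a : ℝ) {t : List ℝ} (h : t ≠ []) : la (a :: t) = la t := la_append h [a]
theorem fs_append {t : List ℝ} (h : t ≠ []) (s : List ℝ) : fs (t ++ s) = fs t := by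
  rcases t with _ | ⟨a, t⟩
  · exact absurd rfl h
  · rfl
theorem fs_mem {t : List ℝ} (h : t ≠ []) : fs t ∈ t := by
  rcases t with _ | ⟨a, t⟩
  · exact absurd rfl h
  · simp [fs]
theorem la_mem {t : List ℝ} (h : t ≠ []) : la t ∈ t := by
  have : la t = t.getLast h := by
    simp [la, List.getLastD_eq_getLast?, List.getLast?_eq_some_getLast h]
  rw [this]; exact List.getLast_mem h

theorem ch_single (a : ℝ) : ch [a] = 1 := by simp [ch]
theorem ch_cons (a : ℝ) {t : List ℝ} (h : t ≠ []) : ch (a :: t) = (a - fs t) * ch t := by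
  rcases t with _ | ⟨b, t⟩
  · exact absurd rfl h
  · rfl

theorem ch_append {s t : List ℝ} (hs : s ≠ []) (ht : t ≠ []) :
    ch (s ++ t) = ch s * (la s - fs t) * ch t := by
  induction s with
  | nil => exact absurd rfl hs
  | cons a s ih =>
    by_cases h : s = []
    · subst h
      rw [List.singleton_append, ch_cons a ht, ch_single, la_single]; ring
    · rw [List.cons_append, ch_cons a (by simp [h]), ih h, ch_cons a h, la_cons a h, fs_append h]; ring

theorem ch_ne {l : List ℝ} (h : l.Nodup) : ch l ≠ 0 := by
  induction l with
  | nil => simp [ch]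
  | cons a s ih =>
    by_cases h1 : s = []
    · subst h1; simp [ch]
    · rw [ch_cons a h1]
      rw [List.nodup_cons] at h
      refine mul_ne_zero ?_ (ih h.2)
      rw [sub_ne_zero]; intro e
      exact h.1 (e ▸ fs_mem h1)

def Mp (l : List ℝ) : Mt := (l.map Mx).prod
theorem Mp_nil : Mp [] = 1 := by simp [Mp]
theorem Mp_cons (a : ℝ) (l : List ℝ) : Mp (a :: l) = Mx a * Mp l := by simp [Mp]
theorem Mp_append (l s : List ℝ) : Mp (l ++ s) = Mp l * Mp s := by simp [Mp]
theorem Mp_single (a : ℝ) : Mp [a] = Mx a := by simp [Mp]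

/-- weights of a chain between `x` and `y` -/
def cw2 (x y : ℝ) (l : List ℝ) : ℝ := if l = [] then 0 else ((x - fs l) * ch l * (la l - y))⁻¹

def G2 (x y : ℝ) (L : Finset ℝ) : Mt := ∑ l ∈ ords L, cw2 x y l • Mp l
def G (x : ℝ) (L : Finset ℝ) : Mt := G2 x x L
/-- weighted by `1/(x-first)` -/
def Ga (x : ℝ) (L : Finset ℝ) : Mt := ∑ l ∈ ords L, (cw2 x x l * (x - fs l)⁻¹) • Mp l
def Gb (x : ℝ) (L : Finset ℝ) : Mt := ∑ l ∈ ords L, (cw2 x x l * (x - la l)⁻¹) • Mp l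

def W (x : ℝ) (L : Finset ℝ) : PS := - (Mx x * G x L).trace

theorem G2_empty (x y : ℝ) : G2 x y ∅ = 0 := by simp [G2, ords_empty, cw2]
theorem G_empty (x : ℝ) : G x ∅ = 0 := G2_empty x x
theorem W_empty (x : ℝ) : W x ∅ = 0 := by simp [W, G_empty]

section
variable {L : Finset ℝ} {x : ℝ}

theorem ords_facts (hx : x ∉ L) {l : List ℝ} (hl : l ∈ ords L) (hn : l ≠ []) :
    x - fs l ≠ 0 ∧ la l - x ≠ 0 ∧ x - la l ≠ 0 ∧ ch l ≠ 0 := by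
  have h1 : fs l ∈ L := (ords_mem hl).mp (fs_mem hn)
  have h2 : la l ∈ L := (ords_mem hl).mp (la_mem hn)
  refine ⟨?_, ?_, ?_, ch_ne (mem_ords.mp hl).1⟩
  · rw [sub_ne_zero]; rintro rfl; exact hx h1
  · rw [sub_ne_zero]; intro e; rw [e] at h2; exact hx h2
  · rw [sub_ne_zero]; intro e; rw [← e] at h2; exact hx h2

theorem hasDerivAt_cw2_fst (hx : x ∉ L) {l : List ℝ} (hl : l ∈ ords L) :
    HasDerivAt (fun y => cw2 y x l) (-(cw2 x x l * (x - fs l)⁻¹)) x := by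
  by_cases hn : l = []
  · subst hn; simp [cw2]; exact hasDerivAt_const x 0
  · obtain ⟨h1, h2, h3, h4⟩ := ords_facts hx hl hn
    have h : HasDerivAt (fun y => (y - fs l) * ch l * (la l - x)) (1 * ch l * (la l - x)) x :=
      (((hasDerivAt_id x).sub_const (fs l)).mul_const (ch l)).mul_const (la l - x)
    have h5 := h.fun_inv (by simp [h1, h2, h4])
    simp only [cw2, if_neg hn]
    refine h5.congr_deriv ?_
    field_simp

theorem hasDerivAt_cw2_snd (hx : x ∉ L) {l : List ℝ} (hl : l ∈ ords L) :
    HasDerivAt (fun y => cw2 x y l) (-(cw2 x x l * (x - la l)⁻¹)) x := by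
  by_cases hn : l = []
  · subst hn; simp [cw2]; exact hasDerivAt_const x 0
  · obtain ⟨h1, h2, h3, h4⟩ := ords_facts hx hl hn
    have h : HasDerivAt (fun y => (x - fs l) * ch l * (la l - y)) ((x - fs l) * ch l * (-1)) x :=
      ((hasDerivAt_id x).const_sub (la l)).const_mul _
    have h5 := h.fun_inv (by simp [h1, h2, h4])
    simp only [cw2, if_neg hn]
    refine h5.congr_deriv ?_
    have : la l - x = -(x - la l) := by ring
    rw [this]
    field_simp

theorem HDM_G2_fst (hx : x ∉ L) : HDM (fun y => G2 y x L) (- Ga x L) x := by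
  have := HDM.sum (s := ords L) (fun l hl => HDM.smul_const (Mp l) (hasDerivAt_cw2_fst hx hl))
  simpa only [G2, Ga, neg_smul, Finset.sum_neg_distrib] using this

theorem HDM_G2_snd (hx : x ∉ L) : HDM (fun y => G2 x y L) (- Gb x L) x := by
  have := HDM.sum (s := ords L) (fun l hl => HDM.smul_const (Mp l) (hasDerivAt_cw2_snd hx hl))
  simpa only [G2, Gb, neg_smul, Finset.sum_neg_distrib] using this

theorem hasDerivAt_cw (hx : x ∉ L) {l : List ℝ} (hl : l ∈ ords L) :
    HasDerivAt (fun y => cw2 y y l) (-(cw2 x x l * (x - fs l)⁻¹) - (cw2 x x l * (x - la l)⁻¹)) x := by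
  by_cases hn : l = []
  · subst hn; simp [cw2]; exact hasDerivAt_const x 0
  · obtain ⟨h1, h2, h3, h4⟩ := ords_facts hx hl hn
    have h : HasDerivAt (fun y => (y - fs l) * ch l * (la l - y))
        ((1 * ch l) * (la l - x) + (x - fs l) * ch l * (-1)) x :=
      (((hasDerivAt_id x).sub_const (fs l)).mul_const (ch l)).mul ((hasDerivAt_id x).const_sub (la l))
    have h5 := h.fun_inv (by simp [h1, h2, h4])
    simp only [cw2, if_neg hn]
    refine h5.congr_deriv ?_
    have : la l - x = -(x - la l) := by ring
    rw [this]
    field_simp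
    ring

/-- derivative of `W` in its base point -/
def dW (x : ℝ) (L : Finset ℝ) : PS := - (dMx x * G x L + Mx x * (- Ga x L - Gb x L)).trace

theorem HD_W (hx0 : x ≠ 0) (hx : x ∉ L) : HD (fun y => W y L) (dW x L) x := by
  refine HD.neg (HDM.trace (HDM.mul (HDM_Mx hx0) ?_))
  have := HDM.sum (s := ords L) (fun l hl => HDM.smul_const (Mp l) (hasDerivAt_cw hx hl))
  simpa only [G, G2, Ga, Gb, neg_smul, sub_smul, Finset.sum_sub_distrib, Finset.sum_neg_distrib] using this

/-! ### inserting a point -/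
theorem cw2_insert {y : ℝ} (hy : y ≠ x) {l1 l2 : List ℝ} (h1 : l1 ≠ []) (h2 : l2 ≠ []) :
    cw2 x x (l1 ++ y :: l2) = cw2 x y l1 * cw2 y x l2 := by
  simp only [cw2, if_neg h1, if_neg h2]
  rw [if_neg (by simp), ch_append h1 (by simp), ch_cons y h2, fs_append h1, la_append (by simp),
    la_cons y h2, fs_cons, ← mul_inv]
  congr 1; ring

theorem cw2_insert_first {y : ℝ} {l2 : List ℝ} (h2 : l2 ≠ []) :
    cw2 x x (y :: l2) = (x - y)⁻¹ * cw2 y x l2 := by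
  simp only [cw2, if_neg h2]
  rw [if_neg (by simp), ch_cons y h2, la_cons y h2, fs_cons, ← mul_inv]
  congr 1; ring

theorem cw2_insert_last {y : ℝ} {l : List ℝ} (h : l ≠ []) :
    cw2 x x (l ++ [y]) = (y - x)⁻¹ * cw2 x y l := by
  simp only [cw2, if_neg h]
  rw [if_neg (by simp), ch_append h (by simp), ch_single, la_append (by simp), la_single, fs_cons,
    fs_append h, ← mul_inv]
  congr 1; ring

theorem G_insert {y : ℝ} (hy : y ≠ x) (hyL : y ∉ L) (hL : L.Nonempty) :
    G x (insert y L) = (x - y)⁻¹ • (Mx y * G2 y x L) + (y - x)⁻¹ • (G2 x y L * Mx y)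
      + ∑ I ∈ L.powerset, G2 x y I * Mx y * G2 y x (L \ I) := by
  have hLne := hL.ne_empty
  have key : ∀ I ∈ L.powerset, ∑ l1 ∈ ords I, ∑ l2 ∈ ords (L \ I), cw2 x x (l1 ++ y :: l2) • Mp (l1 ++ y :: l2)
     = (if I = ∅ then (x - y)⁻¹ • (Mx y * G2 y x L) else 0) + (if I = L then (y - x)⁻¹ • (G2 x y L * Mx y) else 0)
       + G2 x y I * Mx y * G2 y x (L \ I) := by
    intro I hI
    rw [Finset.mem_powerset] at hI
    by_cases h1 : I = ∅
    · subst h1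
      rw [if_pos rfl, if_neg (fun h => hLne h.symm), G2_empty, ords_empty, Finset.sum_singleton, Finset.sdiff_empty]
      simp only [zero_mul, Finset.sum_const_zero, add_zero, List.nil_append, G2, Finset.mul_sum, Finset.smul_sum]
      refine Finset.sum_congr rfl fun l hl => ?_
      rw [cw2_insert_first (ords_ne_nil hl hL), Mp_cons, Matrix.mul_smul, smul_smul]
    · by_cases h2 : I = L
      · subst h2
        rw [if_neg h1, if_pos rfl, Finset.sdiff_self, G2_empty, ords_empty]
        simp only [Finset.sum_singleton, mul_zero, add_zero, zero_add, G2, Finset.sum_mul, Finset.smul_sum]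
        refine Finset.sum_congr rfl fun l hl => ?_
        rw [cw2_insert_last (ords_ne_nil hl hL), Mp_append, Mp_single, Matrix.smul_mul, smul_smul]
      · rw [if_neg h1, if_neg h2, zero_add, zero_add]
        have hI' : I.Nonempty := Finset.nonempty_iff_ne_empty.mpr h1
        have hJ' : (L \ I).Nonempty := by
          rw [Finset.sdiff_nonempty]; intro h; exact h2 (Finset.Subset.antisymm hI h)
        rw [G2, G2, Finset.sum_mul, Finset.sum_mul]
        refine Finset.sum_congr rfl fun l hl => ?_
        rw [Finset.mul_sum]
        refine Finset.sum_congr rfl fun l' hl' => ?_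
        rw [cw2_insert hy (ords_ne_nil hl hI') (ords_ne_nil hl' hJ'), Mp_append, Mp_cons,
          Matrix.smul_mul, Matrix.smul_mul, Matrix.mul_smul, smul_smul, mul_assoc]
  rw [G, G2, sum_ords_insert hyL, Finset.sum_congr rfl key, Finset.sum_add_distrib, Finset.sum_add_distrib]
  congr 1
  congr 1
  · rw [Finset.sum_ite_eq' L.powerset ∅, if_pos (by simp)]
  · rw [Finset.sum_ite_eq' L.powerset L, if_pos (by simp)]

/-- regularization of `(y-x) W(x; insert y L)` -/
def Rg (x : ℝ) (L : Finset ℝ) (y : ℝ) : PS :=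
  - (Mx x * (- (Mx y * G2 y x L) + G2 x y L * Mx y
      + (y - x) • ∑ I ∈ L.powerset, G2 x y I * Mx y * G2 y x (L \ I))).trace

theorem Rg_eq {y : ℝ} (hy : y ≠ x) (hyL : y ∉ L) (hL : L.Nonempty) :
    (y - x) • W x (insert y L) = Rg x L y := by
  rw [W, G_insert hy hyL hL, Rg, smul_neg, ← Matrix.trace_smul, ← Matrix.mul_smul, smul_add, smul_add, smul_smul,
    smul_smul, mul_inv_cancel₀ (sub_ne_zero.mpr hy)]
  have : (y - x) * (x - y)⁻¹ = -1 := by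
    have h1 : x - y ≠ 0 := sub_ne_zero.mpr hy.symm
    field_simp
    ring
  rw [this, neg_one_smul, one_smul]

def W2 (x : ℝ) (L : Finset ℝ) : PS :=
  - (Mx x * (- (dMx x * G x L + Mx x * (- Ga x L)) + ((- Gb x L) * Mx x + G x L * dMx x)
      + ∑ I ∈ L.powerset, G x I * Mx x * G x (L \ I))).trace

theorem Rg_self : Rg x L x = 0 := by
  rw [Rg, sub_self, zero_smul, add_zero, Matrix.mul_add, Matrix.mul_neg, Matrix.trace_add, Matrix.trace_neg,
    ← Matrix.mul_assoc, ← Matrix.mul_assoc, Matrix.trace_mul_comm (Mx x * G2 x x L) (Mx x), Matrix.mul_assoc]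
  simp

theorem HD_Rg (hx0 : x ≠ 0) (hx : x ∉ L) : HD (Rg x L) (W2 x L) x := by
  refine HD.neg (HDM.trace (HDM.const_mul _ ?_))
  refine HDM.add (HDM.add (HDM.neg (HDM.mul (HDM_Mx hx0) (HDM_G2_fst hx)))
    (HDM.mul (HDM_G2_snd hx) (HDM_Mx hx0))) ?_
  have h1 : HasDerivAt (fun y => y - x) 1 x := (hasDerivAt_id x).sub_const x
  have h2 : ∀ I ∈ L.powerset, HDM (fun y => G2 x y I * Mx y * G2 y x (L \ I))
     ((- Gb x I * Mx x + G2 x x I * dMx x) * G2 x x (L \ I) + G2 x x I * Mx x * (- Ga x (L \ I))) x := by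
    intro I hI
    have hI' : x ∉ I := fun h => hx (Finset.mem_powerset.mp hI h)
    have hJ' : x ∉ L \ I := fun h => hx (Finset.sdiff_subset h)
    exact ((HDM_G2_snd hI').mul (HDM_Mx hx0)).mul (HDM_G2_fst hJ')
  have := HDM.smul h1 (HDM.sum h2)
  simpa only [sub_self, zero_smul, add_zero, one_smul, G] using this

end

section
variable {L : Finset ℝ} {x : ℝ}

theorem cw2_cons (x a : ℝ) {s : List ℝ} (h : s ≠ []) (hf : x - fs s ≠ 0) :
    cw2 x x (a :: s) = (x - fs s) * (x - a)⁻¹ * (a - fs s)⁻¹ * cw2 x x s := by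
  simp only [cw2, if_neg h]
  rw [if_neg (by simp), ch_cons a h, la_cons a h, fs_cons]
  simp only [mul_inv]
  field_simp

theorem cut_sum (x : ℝ) (l : List ℝ) (hn : l.Nodup) (hx : x ∉ l) :
    ∑ i ∈ Finset.range (l.length + 1), cw2 x x (l.take i) * cw2 x x (l.drop i) =
      cw2 x x l * (x - la l)⁻¹ - cw2 x x l * (x - fs l)⁻¹ := by
  induction l with
  | nil => simp [cw2]
  | cons a t ih =>
    by_cases ht : t = []
    · subst ht
      simp [Finset.sum_range_succ, cw2, la, fs]
    · rw [List.nodup_cons] at hn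
      simp only [List.mem_cons, not_or] at hx
      have ih := ih hn.2 hx.2
      have hf : x - fs t ≠ 0 := by
        rw [sub_ne_zero]; intro e; exact hx.2 (e ▸ fs_mem ht)
      have hxa : x - a ≠ 0 := sub_ne_zero.mpr hx.1
      have haf : a - fs t ≠ 0 := by
        rw [sub_ne_zero]; intro e; exact hn.1 (e ▸ fs_mem ht)
      rw [List.length_cons, Finset.sum_range_succ']
      simp only [List.take_zero, List.drop_zero, List.take_succ_cons, List.drop_succ_cons]
      have e0 : cw2 x x [] = 0 := by simp [cw2]
      rw [e0, zero_mul, add_zero]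
      rw [Finset.sum_range_succ'] at ih ⊢
      simp only [List.take_zero, List.drop_zero] at ih ⊢
      rw [e0, zero_mul, add_zero] at ih
      have e1 : ∀ i ∈ Finset.range t.length, cw2 x x (a :: t.take (i + 1)) * cw2 x x (t.drop (i + 1)) =
          ((x - fs t) * (x - a)⁻¹ * (a - fs t)⁻¹) * (cw2 x x (t.take (i + 1)) * cw2 x x (t.drop (i + 1))) := by
        intro i _
        obtain ⟨b, t', rfl⟩ := List.exists_cons_of_ne_nil ht
        rw [List.take_succ_cons, cw2_cons x a (by simp) (by simpa [fs] using hf)]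
        simp only [fs_cons]; ring
      rw [Finset.sum_congr rfl e1, ← Finset.mul_sum, ih, cw2_cons x a ht hf, la_cons a ht]
      have e2 : cw2 x x [a] = - ((x - a)⁻¹ * (x - a)⁻¹) := by
        rw [cw2, if_neg (by simp), ch_single, la_single, fs_cons, mul_one]
        have : a - x = - (x - a) := by ring
        rw [this]
        field_simp
      rw [e2, fs_cons]
      field_simp
      ring

theorem GG_sum (hx : x ∉ L) : ∑ I ∈ L.powerset, G x I * G x (L \ I) = Gb x L - Ga x L := by
  have e1 : ∀ I ∈ L.powerset, G x I * G x (L \ I) =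
      ∑ l1 ∈ ords I, ∑ l2 ∈ ords (L \ I), (cw2 x x l1 * cw2 x x l2) • Mp (l1 ++ l2) := by
    intro I _
    rw [G, G, G2, G2, Finset.sum_mul]
    refine Finset.sum_congr rfl fun l _ => ?_
    rw [Finset.mul_sum]
    refine Finset.sum_congr rfl fun l' _ => ?_
    rw [Matrix.smul_mul, Matrix.mul_smul, smul_smul, Mp_append]
  rw [Finset.sum_congr rfl e1, sum_ords_split L (fun l1 l2 => (cw2 x x l1 * cw2 x x l2) • Mp (l1 ++ l2)),
    Gb, Ga, ← Finset.sum_sub_distrib]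
  refine Finset.sum_congr rfl fun l hl => ?_
  simp only [List.take_append_drop]
  rw [← Finset.sum_smul, cut_sum x l (mem_ords.mp hl).1 (fun h => hx ((ords_mem hl).mp h)), sub_smul]

def den (l : List ℝ) : ℝ := ch l * (la l - fs l)

theorem den_rot (a : ℝ) {t : List ℝ} (ht : t ≠ []) : den (t ++ [a]) = den (a :: t) := by
  rw [den, den, ch_append ht (by simp), ch_single, la_append_single, fs_append ht, ch_cons a ht, fs_cons,
    la_cons a ht, fs_cons]; ring

theorem tr_rot (a : ℝ) (t : List ℝ) : (Mp (t ++ [a])).trace = (Mp (a :: t)).trace := by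
  rw [Mp_append, Mp_single, Mp_cons, Matrix.trace_mul_comm]

theorem ords_ne2 (hL : 2 ≤ L.card) {l : List ℝ} (hl : l ∈ ords L) : l ≠ [] ∧ la l - fs l ≠ 0 := by
  have h := ords_length hl
  rcases l with _ | ⟨a, t⟩
  · simp at h; omega
  · have ht : t ≠ [] := by rintro rfl; simp at h; omega
    refine ⟨by simp, ?_⟩
    rw [la_cons a ht, fs_cons, sub_ne_zero]
    intro e
    have := (mem_ords.mp hl).1
    rw [List.nodup_cons] at this
    exact this.1 (e ▸ la_mem ht)

theorem cw2_den (hL : 2 ≤ L.card) (hx : x ∉ L) {l : List ℝ} (hl : l ∈ ords L) :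
    cw2 x x l = ((x - fs l)⁻¹ - (x - la l)⁻¹) * (den l)⁻¹ := by
  obtain ⟨hn, hd⟩ := ords_ne2 hL hl
  obtain ⟨h1, h2, h3, h4⟩ := ords_facts hx hl hn
  rw [cw2, if_neg hn, den]
  have : la l - x = -(x - la l) := by ring
  rw [this]
  field_simp
  ring

theorem rot_pow (hL : 2 ≤ L.card) (p : ℝ → ℝ) :
    ∑ l ∈ ords L, (p (fs l) * (den l)⁻¹) • (Mp l).trace = ∑ l ∈ ords L, (p (la l) * (den l)⁻¹) • (Mp l).trace := by
  refine sum_ords_rot hL _ _ ?_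
  intro a t ht _
  rw [den_rot a ht, tr_rot, la_append_single, fs_cons]

theorem trace_mul_G2 (A : Mt) (x y : ℝ) (L : Finset ℝ) :
    (A * G2 x y L).trace = ∑ l ∈ ords L, cw2 x y l • (A * Mp l).trace := by
  rw [G2, Finset.mul_sum, Matrix.trace_sum]
  refine Finset.sum_congr rfl fun l _ => ?_
  rw [Matrix.mul_smul, Matrix.trace_smul]

theorem tr_G (hx : x ∉ L) : (G x L).trace = 0 := by
  rw [← one_mul (G x L), G, trace_mul_G2]
  simp only [one_mul]
  by_cases h0 : L = ∅
  · subst h0; simp [ords_empty, cw2]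
  by_cases h1 : L.card = 1
  · obtain ⟨a, rfl⟩ := Finset.card_eq_one.mp h1
    rw [ords_singleton, Finset.sum_singleton, Mp_single, Mx_tr, smul_zero]
  have hL : 2 ≤ L.card := by
    have : L.card ≠ 0 := fun h => h0 (Finset.card_eq_zero.mp h)
    omega
  have e : ∀ l ∈ ords L, cw2 x x l • (Mp l).trace =
      ((x - fs l)⁻¹ * (den l)⁻¹) • (Mp l).trace - ((x - la l)⁻¹ * (den l)⁻¹) • (Mp l).trace := by
    intro l hl
    rw [cw2_den hL hx hl, sub_mul, sub_smul]
  rw [Finset.sum_congr rfl e, Finset.sum_sub_distrib, rot_pow hL (fun z => (x - z)⁻¹), sub_self]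

theorem two_by_two {R : Type*} [CommRing R] (M A B : Matrix (Fin 2) (Fin 2) R) :
    (M * A).trace * (M * B).trace - (M * (A * M * B)).trace = M.det * (A.trace * B.trace - (A * B).trace) := by
  simp only [Matrix.trace_fin_two, Matrix.det_fin_two, Matrix.mul_apply, Fin.sum_univ_two]
  ring

theorem det_Mx (hx0 : x ≠ 0) : (Mx x).det = - (x • v) := by
  rw [Matrix.det_fin_two, Mx_11, ← Msq_ent x hx0]; ring

theorem QW (hx0 : x ≠ 0) (hx : x ∉ L) :
    W2 x L + ∑ I ∈ L.powerset, W x I * W x (L \ I) =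
      - ((dMx x * Mx x - Mx x * dMx x) * G x L).trace - 2 * (x • v) * ((Ga x L).trace - (Gb x L).trace) := by
  have e1 : ∑ I ∈ L.powerset, W x I * W x (L \ I) - ∑ I ∈ L.powerset, (Mx x * (G x I * Mx x * G x (L \ I))).trace
      = (x • v) * ((Gb x L).trace - (Ga x L).trace) := by
    rw [← Finset.sum_sub_distrib, ← Matrix.trace_sub, ← GG_sum hx, Matrix.trace_sum, Finset.mul_sum]
    refine Finset.sum_congr rfl fun I hI => ?_
    have hI' : x ∉ I := fun h => hx (Finset.mem_powerset.mp hI h)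
    have hJ' : x ∉ L \ I := fun h => hx (Finset.sdiff_subset h)
    rw [W, W, neg_mul_neg, two_by_two, det_Mx hx0, tr_G hI', tr_G hJ']; ring
  have e2 : (Mx x * (Mx x * Ga x L)).trace = (x • v) * (Ga x L).trace := by
    rw [← Matrix.mul_assoc, Msq x hx0, Matrix.smul_mul, one_mul, Matrix.trace_smul, smul_eq_mul]
  have e3 : (Mx x * (Gb x L * Mx x)).trace = (x • v) * (Gb x L).trace := by
    rw [← Matrix.mul_assoc, Matrix.trace_mul_comm, ← Matrix.mul_assoc, Msq x hx0, Matrix.smul_mul, one_mul,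
      Matrix.trace_smul, smul_eq_mul]
  have e4 : (Mx x * (G x L * dMx x)).trace = (dMx x * Mx x * G x L).trace := by
    rw [← Matrix.mul_assoc, Matrix.trace_mul_comm, ← Matrix.mul_assoc]
  rw [W2]
  simp only [Matrix.mul_add, Matrix.mul_neg, Matrix.neg_mul, Matrix.sub_mul, Matrix.trace_add, Matrix.trace_neg,
    Matrix.trace_sub, Finset.mul_sum, Matrix.trace_sum, e2, e3, e4, ← Matrix.mul_assoc (Mx x) (dMx x)]
  linear_combination e1

def Tm (x u : ℝ) (F dF : PS) : PS :=
  (x * (x - u)⁻¹) • ((-2 : ℝ) • dF + u⁻¹ • F) - (2 * x * ((x - u)⁻¹ * (x - u)⁻¹)) • F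

theorem cw2_den_cons (u : ℝ) {t : List ℝ} (ht : t ≠ []) : cw2 u u t = (den (u :: t))⁻¹ := by
  rw [cw2, if_neg ht, den, ch_cons u ht, la_cons u ht, fs_cons]

theorem Dm_sub (x u : ℝ) (A : Mt) : (Dm u * A).trace = (Dm x * A).trace - (x - u) • (F21 * A).trace := by
  rw [Dm, Dm]
  simp only [Matrix.add_mul, Matrix.trace_add, Matrix.smul_mul, Matrix.trace_smul, smul_eq_mul]
  module

theorem W_term (u : ℝ) (hu : u ≠ 0) (t : List ℝ) :
    (2 : ℝ) • (v * v * (dMx u * Mp t).trace) - u⁻¹ • (v * v * (Mp (u :: t)).trace) =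
    (Dm u * Mp (u :: t)).trace - (Dm u * Mp (t ++ [u])).trace := by
  have h : ((2:ℝ) • (v * v) • dMx u * Mp t).trace = ((u⁻¹ • (v * v) • Mx u + (Dm u * Mx u - Mx u * Dm u)) * Mp t).trace := by
    rw [ODE u hu]
  simp only [Matrix.add_mul, Matrix.sub_mul, Matrix.smul_mul, Matrix.trace_add, Matrix.trace_sub, Matrix.trace_smul,
    smul_eq_mul] at h
  rw [h, Mp_cons, Mp_append, Mp_single, ← Matrix.mul_assoc (Dm u) (Mx u), ← Matrix.mul_assoc (Dm u) (Mp t),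
    Matrix.trace_mul_comm (Dm u * Mp t), ← Matrix.mul_assoc (Mx u)]
  abel

theorem dW_expand (u : ℝ) (hu : u ≠ 0) (L' : Finset ℝ) (hL' : L'.Nonempty) :
    v * v * ((-2 : ℝ) • dW u L' + u⁻¹ • W u L') = ∑ t ∈ ords L',
      ((den (u :: t))⁻¹ • ((Dm u * Mp (u :: t)).trace - (Dm u * Mp (t ++ [u])).trace)
       - (2 * (den (u :: t))⁻¹ * ((u - fs t)⁻¹ + (u - la t)⁻¹)) • (v * v * (Mp (u :: t)).trace)) := by
  have ea : (Mx u * Ga u L').trace = ∑ t ∈ ords L', (cw2 u u t * (u - fs t)⁻¹) • (Mp (u :: t)).trace := by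
    rw [Ga, Finset.mul_sum, Matrix.trace_sum]
    refine Finset.sum_congr rfl fun l _ => ?_
    rw [Matrix.mul_smul, Matrix.trace_smul, Mp_cons]
  have eb : (Mx u * Gb u L').trace = ∑ t ∈ ords L', (cw2 u u t * (u - la t)⁻¹) • (Mp (u :: t)).trace := by
    rw [Gb, Finset.mul_sum, Matrix.trace_sum]
    refine Finset.sum_congr rfl fun l _ => ?_
    rw [Matrix.mul_smul, Matrix.trace_smul, Mp_cons]
  rw [dW, W, Matrix.trace_add, Matrix.mul_sub, Matrix.mul_neg, Matrix.trace_sub, Matrix.trace_neg, ea, eb, G,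
    trace_mul_G2, trace_mul_G2]
  simp only [← Finset.sum_neg_distrib, ← Finset.sum_sub_distrib, ← Finset.sum_add_distrib, Finset.smul_sum,
    Finset.mul_sum]
  refine Finset.sum_congr rfl fun t ht => ?_
  rw [← W_term u hu, ← cw2_den_cons u (ords_ne_nil ht hL'), Mp_cons]
  simp only [mul_add, mul_sub, mul_neg, mul_smul_comm, smul_add, smul_sub, smul_neg]
  module

theorem TW (hx0 : x ≠ 0) (hx : x ∉ L) (h0 : (0:ℝ) ∉ L) (hL : 2 ≤ L.card) :
    v * v * ∑ u ∈ L, Tm x u (W u (L.erase u)) (dW u (L.erase u)) =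
      x • (Dm x * G x L).trace + x • (v * v * ((Ga x L).trace - (Gb x L).trace)) := by
  have hLn : L.Nonempty := by rw [← Finset.card_pos]; omega
  let φ1 : List ℝ → PS := fun l => (x * (x - fs l)⁻¹ * (den l)⁻¹) • (Dm (fs l) * Mp l).trace
  let φ2 : List ℝ → PS := fun l => (x * (x - fs l)⁻¹ * (den l)⁻¹) • (Dm (fs l) * Mp (l.tail ++ [fs l])).trace
  let ψ2 : List ℝ → PS := fun l => (x * (x - la l)⁻¹ * (den l)⁻¹) • (Dm (la l) * Mp l).trace
  let φ3 : List ℝ → PS := fun l => (2 * x * (x - fs l)⁻¹ * (den l)⁻¹ * (fs l - fs l.tail)⁻¹) • (v * v * (Mp l).trace)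
  let ψ3 : List ℝ → PS := fun l => (2 * x * (x - la l)⁻¹ * (den l)⁻¹ * (la l - fs l)⁻¹) • (v * v * (Mp l).trace)
  let φ4 : List ℝ → PS := fun l => (2 * x * (x - fs l)⁻¹ * (den l)⁻¹ * ((x - fs l)⁻¹ - (fs l - la l)⁻¹)) • (v * v * (Mp l).trace)
  have e1 : v * v * ∑ u ∈ L, Tm x u (W u (L.erase u)) (dW u (L.erase u)) = ∑ l ∈ ords L, (φ1 l - φ2 l - φ3 l + φ4 l) := by
    rw [sum_ords_cons hLn, Finset.mul_sum]
    refine Finset.sum_congr rfl fun u hu => ?_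
    have hu0 : u ≠ 0 := by rintro rfl; exact h0 hu
    have hL' : (L.erase u).Nonempty := by
      rw [← Finset.card_pos, Finset.card_erase_of_mem hu]; omega
    rw [Tm, mul_sub, mul_smul_comm, dW_expand u hu0 _ hL', W, G, trace_mul_G2]
    simp only [← Finset.sum_neg_distrib, ← Finset.sum_sub_distrib, Finset.smul_sum, Finset.mul_sum]
    refine Finset.sum_congr rfl fun t ht => ?_
    have htn := ords_ne_nil ht hL'
    simp only [φ1, φ2, φ3, φ4, fs_cons, la_cons u htn, List.tail_cons, cw2_den_cons u htn, ← Mp_cons]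
    simp only [mul_smul_comm, mul_neg, smul_neg]
    module
  have e2 : ∑ l ∈ ords L, φ2 l = ∑ l ∈ ords L, ψ2 l := by
    refine sum_ords_rot hL _ _ ?_
    intro a t ht _
    simp only [φ2, ψ2, fs_cons, List.tail_cons, den_rot a ht, la_append_single]
  have e3 : ∑ l ∈ ords L, φ3 l = ∑ l ∈ ords L, ψ3 l := by
    refine sum_ords_rot hL _ _ ?_
    intro a t ht _
    simp only [φ3, ψ3, fs_cons, List.tail_cons, den_rot a ht, la_append_single, tr_rot, fs_append ht]
  have e4 : ∑ l ∈ ords L, ((x * ((x - fs l)⁻¹ * (x - fs l)⁻¹ - (x - la l)⁻¹ * (x - la l)⁻¹) * (den l)⁻¹)) • (v * v * (Mp l).trace) = 0 := by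
    have h := rot_pow hL (fun z => x * (x - z)⁻¹ * (x - z)⁻¹)
    have h2 : ∀ l ∈ ords L, ((x * ((x - fs l)⁻¹ * (x - fs l)⁻¹ - (x - la l)⁻¹ * (x - la l)⁻¹) * (den l)⁻¹)) • (v * v * (Mp l).trace)
        = v * v * ((x * (x - fs l)⁻¹ * (x - fs l)⁻¹ * (den l)⁻¹) • (Mp l).trace) -
          v * v * ((x * (x - la l)⁻¹ * (x - la l)⁻¹ * (den l)⁻¹) • (Mp l).trace) := by
      intro l _
      simp only [mul_smul_comm]
      module
    rw [Finset.sum_congr rfl h2, Finset.sum_sub_distrib, ← Finset.mul_sum, ← Finset.mul_sum, h, sub_self]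
  have ea : (Ga x L).trace = ∑ t ∈ ords L, (cw2 x x t * (x - fs t)⁻¹) • (Mp t).trace := by
    rw [Ga, Matrix.trace_sum]
    simp only [Matrix.trace_smul]
  have eb : (Gb x L).trace = ∑ t ∈ ords L, (cw2 x x t * (x - la t)⁻¹) • (Mp t).trace := by
    rw [Gb, Matrix.trace_sum]
    simp only [Matrix.trace_smul]
  rw [e1, Finset.sum_add_distrib, Finset.sum_sub_distrib, Finset.sum_sub_distrib, e2, e3]
  rw [ea, eb, G, trace_mul_G2, ← add_zero (_ + x • _), ← e4]
  simp only [← Finset.sum_sub_distrib, ← Finset.sum_add_distrib, Finset.smul_sum, Finset.mul_sum]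
  refine Finset.sum_congr rfl fun l hl => ?_
  obtain ⟨hn, hd⟩ := ords_ne2 hL hl
  obtain ⟨h1, h2, h3, h4⟩ := ords_facts hx hl hn
  have hden : den l ≠ 0 := mul_ne_zero h4 hd
  have hd' : fs l - la l ≠ 0 := by rw [← neg_sub]; exact neg_ne_zero.mpr hd
  simp only [φ1, ψ2, ψ3, φ4]
  rw [Dm_sub x (fs l), Dm_sub x (la l), cw2_den hL hx hl]
  simp only [mul_sub, mul_smul_comm, smul_sub]
  match_scalars <;> field_simp <;> ring

end

section
variable {L : Finset ℝ} {x : ℝ}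

def tau (x : ℝ) : PS := (Mx x * Dm x).trace
def dtau (x : ℝ) : PS := (dMx x * Dm x).trace + (Mx x * F21).trace

theorem tau_ent (x : ℝ) : tau x = v * Mx x 1 0 + x • Mx x 0 1 := by
  rw [tau, Matrix.trace_fin_two]
  simp [Dm, F12, F21, Matrix.mul_apply, Fin.sum_univ_two]
  ring

theorem tau_c0 (x : ℝ) : PowerSeries.coeff 0 (tau x) = 0 := by
  have h0 := Amat_0 0
  simp only [mul_zero] at h0
  rw [tau_ent, map_add, coeff_v_mul_zero, coeff_smul', coeff_Mx, h0]; simp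
theorem tau_c1 (x : ℝ) : PowerSeries.coeff 1 (tau x) = - 2 * x := by
  have h0 := Amat_0 0
  have h1 := Amat_1 0
  simp only [mul_zero, zero_add] at h0 h1
  have hv := coeff_v_mul_succ 0 (Mx x 1 0)
  rw [zero_add] at hv
  rw [tau_ent, map_add, hv, coeff_smul', coeff_Mx, coeff_Mx, h0, h1]
  simp [alf_zero]; ring

def PP (x : ℝ) : PS := PowerSeries.mk fun n => (1/2) * PowerSeries.coeff (n + 2) (tau x)
def dPP (x : ℝ) : PS := PowerSeries.mk fun n => (1/2) * PowerSeries.coeff (n + 2) (dtau x)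

theorem vvPP (x : ℝ) : v * v * PP x = (1/2 : ℝ) • tau x + x • v := by
  ext n
  rw [mul_assoc, map_add, coeff_smul', coeff_smul']
  rcases n with _ | _ | n
  · rw [coeff_v_mul_zero, tau_c0, v, PowerSeries.coeff_zero_X]; simp
  · rw [coeff_v_mul_succ, coeff_v_mul_zero, zero_add, tau_c1, v, PowerSeries.coeff_one_X]; ring
  · rw [coeff_v_mul_succ, coeff_v_mul_succ, v, PowerSeries.coeff_X, if_neg (by omega), PP, PowerSeries.coeff_mk]; ring

theorem HDM_Dm (x : ℝ) : HDM Dm F21 x := by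
  have h := (HDM.const (v • F12) x).add (HDM.smul_const F21 (hasDerivAt_id x))
  have h' : HDM (fun y => v • F12 + y • F21) F21 x := by simpa using h
  exact h'

theorem HD_tau (hx0 : x ≠ 0) : HD tau (dtau x) x := by
  have := HDM.trace ((HDM_Mx hx0).mul (HDM_Dm x))
  rw [Matrix.trace_add] at this
  exact this

theorem HD_PP (hx0 : x ≠ 0) : HD PP (dPP x) x := fun n => by
  simp only [PP, dPP, PowerSeries.coeff_mk]
  exact (HD_tau hx0 (n + 2)).const_mul _

theorem vvdPP (hx0 : x ≠ 0) : v * v * dPP x = (1/2 : ℝ) • dtau x + v := by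
  have h1 := HD.const_mul (v * v) (HD_PP hx0)
  have h2 : HD (fun y => (1/2 : ℝ) • tau y + y • v) ((1/2 : ℝ) • dtau x + v) x := by
    have := ((HD.smul (hasDerivAt_const x (1/2:ℝ)) (HD_tau hx0))).add (HD.smul (hasDerivAt_id x) (HD.const v x))
    simpa using this
  simp only [vvPP] at h1
  exact h1.unique h2

theorem dtau_eq (hx0 : x ≠ 0) : dtau x = (2 * x)⁻¹ • tau x + (Mx x * F21).trace := by
  rw [dtau]; congr 1
  apply vv_cancel
  have h : ((2:ℝ) • (v * v) • dMx x * Dm x).trace = ((x⁻¹ • (v * v) • Mx x + (Dm x * Mx x - Mx x * Dm x)) * Dm x).trace := by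
    rw [ODE x hx0]
  simp only [Matrix.add_mul, Matrix.sub_mul, Matrix.smul_mul, Matrix.trace_add, Matrix.trace_sub, Matrix.trace_smul,
    smul_eq_mul] at h
  rw [Matrix.mul_assoc (Dm x), Matrix.trace_mul_comm (Dm x), sub_self, add_zero] at h
  have h2 : (1/2 : ℝ) • ((2:ℝ) • (v * v * (dMx x * Dm x).trace)) = (1/2 : ℝ) • (x⁻¹ • (v * v * (Mx x * Dm x).trace)) := by rw [h]
  rw [smul_smul, smul_smul] at h2
  norm_num at h2
  rw [← mul_assoc, ← mul_assoc, h2, mul_smul_comm, tau]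
  congr 1
  rw [mul_inv]; norm_num

theorem MDM (hx0 : x ≠ 0) : Mx x * Dm x * Mx x = tau x • Mx x - (x • v) • Dm x := by
  have h := Msq_ent x hx0
  have h1 := Mx_11 x
  rw [tau_ent]
  refine Matrix.ext fun i j => ?_
  fin_cases i <;> fin_cases j <;> simp [Dm, F12, F21, Matrix.mul_apply, Fin.sum_univ_two, h1]
  all_goals simp only [PowerSeries.smul_eq_C_mul] at *
  · ring
  · linear_combination -v * h
  · linear_combination -(PowerSeries.C x) * h
  · ring

theorem comm_tr (hx0 : x ≠ 0) (A : Mt) :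
    v * v * ((dMx x * Mx x - Mx x * dMx x) * A).trace = 2 * (x • v) * (Dm x * A).trace - tau x * (Mx x * A).trace := by
  have e : (2:ℝ) • (v * v) • (dMx x * Mx x - Mx x * dMx x) =
      (2:ℝ) • ((2:ℝ) • (x • v) • Dm x - tau x • Mx x) := by
    have h := ODE x hx0
    have h1 : (2:ℝ) • (v * v) • (dMx x * Mx x - Mx x * dMx x) =
       ((2:ℝ) • (v * v) • dMx x) * Mx x - Mx x * ((2:ℝ) • (v * v) • dMx x) := by
      simp only [Matrix.smul_mul, Matrix.mul_smul, smul_sub]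
    rw [h1, h]
    have h2 : (x⁻¹ • (v * v) • Mx x + (Dm x * Mx x - Mx x * Dm x)) * Mx x -
        Mx x * (x⁻¹ • (v * v) • Mx x + (Dm x * Mx x - Mx x * Dm x)) =
        Dm x * (Mx x * Mx x) + (Mx x * Mx x) * Dm x - (2:ℝ) • (Mx x * Dm x * Mx x) := by
      simp only [Matrix.add_mul, Matrix.sub_mul, Matrix.mul_add, Matrix.mul_sub, Matrix.smul_mul, Matrix.mul_smul, two_smul,
        Matrix.mul_assoc]
      abel
    rw [h2, Msq x hx0, MDM hx0, Matrix.mul_smul, Matrix.smul_mul, mul_one, one_mul]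
    simp only [smul_sub, two_smul]; abel
  have e2 := congrArg (fun B => (B * A).trace) e
  simp only [Matrix.sub_mul, Matrix.smul_mul, Matrix.trace_sub, Matrix.trace_smul, smul_eq_mul] at e2 ⊢
  have e3 := congrArg (fun z => (1/2:ℝ) • z) e2
  simp only [smul_smul] at e3
  norm_num at e3
  rw [e3]
  simp only [PowerSeries.smul_eq_C_mul, map_ofNat]; ring

/-! ### corrections -/
def dl (x u : ℝ) : ℝ := (x + u) * ((x - u)⁻¹ * (x - u)⁻¹)
def ddl (x u : ℝ) : ℝ := (x - u)⁻¹ * (x - u)⁻¹ - 2 * (x + u) * ((x - u)⁻¹ * (x - u)⁻¹ * (x - u)⁻¹)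

def Ec (x : ℝ) (L : Finset ℝ) : PS :=
  if L = ∅ then PP x else if L.card = 1 then - (dl x (∑ u ∈ L, u) • v) else 0
def dEc (x : ℝ) (L : Finset ℝ) : PS :=
  if L = ∅ then dPP x else if L.card = 1 then - (ddl x (∑ u ∈ L, u) • v) else 0

theorem Ec_empty (x : ℝ) : Ec x ∅ = PP x := by simp [Ec]
theorem Ec_single (x u : ℝ) : Ec x {u} = -(dl x u • v) := by simp [Ec]
theorem dEc_empty (x : ℝ) : dEc x ∅ = dPP x := by simp [dEc]
theorem dEc_single (x u : ℝ) : dEc x {u} = -(ddl x u • v) := by simp [dEc]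
theorem Ec_big (h : 2 ≤ L.card) : Ec x L = 0 := by
  rw [Ec, if_neg, if_neg]
  · omega
  · rintro rfl; simp at h
theorem dEc_big (h : 2 ≤ L.card) : dEc x L = 0 := by
  rw [dEc, if_neg, if_neg]
  · omega
  · rintro rfl; simp at h

theorem card_cases (L : Finset ℝ) : L = ∅ ∨ (∃ u, L = {u}) ∨ 2 ≤ L.card := by
  rcases h : L.card with _ | _ | n
  · left; exact Finset.card_eq_zero.mp h
  · right; left; exact Finset.card_eq_one.mp h
  · right; right; omega

theorem hasDerivAt_dl {x u : ℝ} (h : x ≠ u) : HasDerivAt (fun y => dl y u) (ddl x u) x := by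
  have h1 : x - u ≠ 0 := sub_ne_zero.mpr h
  have hi : HasDerivAt (fun y => (y - u)⁻¹) (-1 / (x - u)^2) x := ((hasDerivAt_id x).sub_const u).fun_inv h1
  have := ((hasDerivAt_id x).add_const u).fun_mul (hi.fun_mul hi)
  refine this.congr_deriv ?_
  simp only [ddl, id]
  field_simp
  ring

theorem HD_Ec (hx0 : x ≠ 0) (hx : x ∉ L) : HD (fun y => Ec y L) (dEc x L) x := by
  rcases card_cases L with rfl | ⟨u, rfl⟩ | h
  · simp only [Ec_empty, dEc_empty]; exact HD_PP hx0
  · simp only [Ec_single, dEc_single]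
    have hxu : x ≠ u := by simpa using hx
    have := HD.neg (HD.smul (hasDerivAt_dl hxu) (HD.const v x))
    simpa using this
  · simp only [Ec_big h, dEc_big h]; exact HD.const 0 x

def Wf (x : ℝ) (L : Finset ℝ) : PS := W x L + Ec x L
def dWf (x : ℝ) (L : Finset ℝ) : PS := dW x L + dEc x L
theorem HD_Wf (hx0 : x ≠ 0) (hx : x ∉ L) : HD (fun y => Wf y L) (dWf x L) x :=
  (HD_W hx0 hx).add (HD_Ec hx0 hx)

def W2f (x : ℝ) (L : Finset ℝ) : PS := if L = ∅ then -((1/2:ℝ) • (dMx x * dMx x).trace) else W2 x L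

theorem Ec_decomp {I : Finset ℝ} (hI : I ⊆ L) : Ec x I = (if I = ∅ then PP x else 0) +
    ∑ u ∈ L, if I = {u} then -(dl x u • v) else 0 := by
  rcases card_cases I with rfl | ⟨u, rfl⟩ | h
  · rw [if_pos rfl, Ec_empty, Finset.sum_eq_zero, add_zero]
    intro u _
    rw [if_neg]; exact (Finset.singleton_ne_empty u).symm
  · rw [if_neg (Finset.singleton_ne_empty u), zero_add, Ec_single]
    simp only [Finset.singleton_inj]
    rw [Finset.sum_ite_eq, if_pos (by simpa using hI)]
  · rw [if_neg, Ec_big h, zero_add, Finset.sum_eq_zero]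
    · intro u _; rw [if_neg]; rintro rfl; simp at h
    · rintro rfl; simp at h

theorem Ec_sum (Y : Finset ℝ → PS) : ∑ I ∈ L.powerset, Ec x I * Y (L \ I) =
    PP x * Y L - ∑ u ∈ L, dl x u • (v * Y (L.erase u)) := by
  have e : ∀ I ∈ L.powerset, Ec x I * Y (L \ I) = (if I = ∅ then PP x * Y L else 0) +
      ∑ u ∈ L, if I = {u} then -(dl x u • (v * Y (L.erase u))) else 0 := by
    intro I hI
    rw [Ec_decomp (Finset.mem_powerset.mp hI), add_mul, Finset.sum_mul]
    congr 1
    · by_cases h : I = ∅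
      · subst h; simp
      · simp [h]
    · refine Finset.sum_congr rfl fun u _ => ?_
      by_cases h : I = {u}
      · subst h; simp [Finset.sdiff_singleton_eq_erase]
      · simp [h]
  rw [Finset.sum_congr rfl e, Finset.sum_add_distrib, Finset.sum_comm, Finset.sum_ite_eq', if_pos (by simp), sub_eq_add_neg,
    ← Finset.sum_neg_distrib]
  congr 1
  refine Finset.sum_congr rfl fun u hu => ?_
  rw [Finset.sum_ite_eq', if_pos (by simpa using hu)]

theorem powerset_symm (f : Finset ℝ → Finset ℝ → PS) :
    ∑ I ∈ L.powerset, f I (L \ I) = ∑ I ∈ L.powerset, f (L \ I) I := by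
  refine Finset.sum_nbij' (fun I => L \ I) (fun I => L \ I) ?_ ?_ ?_ ?_ ?_
  · intro I _; simp
  · intro I _; simp
  · intro I hI; exact Finset.sdiff_sdiff_eq_self (Finset.mem_powerset.mp hI)
  · intro I hI; exact Finset.sdiff_sdiff_eq_self (Finset.mem_powerset.mp hI)
  · intro I hI
    simp only [Finset.sdiff_sdiff_eq_self (Finset.mem_powerset.mp hI)]

theorem quad_expand : v * v * ∑ u ∈ L, dl x u • Wf x (L.erase u) +
      (1/2:ℝ) • (v * ∑ I ∈ L.powerset, Wf x I * Wf x (L \ I)) =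
    (1/2:ℝ) • (v * ∑ I ∈ L.powerset, W x I * W x (L \ I)) + v * PP x * W x L + (1/2:ℝ) • (v * (PP x * Ec x L))
     + (1/2 : ℝ) • (v * v * ∑ u ∈ L, dl x u • Ec x (L.erase u)) := by
  have h1 : ∑ I ∈ L.powerset, Wf x I * Wf x (L \ I) = ∑ I ∈ L.powerset, W x I * W x (L \ I) +
      ∑ I ∈ L.powerset, Ec x I * W x (L \ I) + ∑ I ∈ L.powerset, Ec x I * W x (L \ I) +
      ∑ I ∈ L.powerset, Ec x I * Ec x (L \ I) := by
    have h2 : ∑ I ∈ L.powerset, Ec x I * W x (L \ I) = ∑ I ∈ L.powerset, W x I * Ec x (L \ I) := by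
      rw [powerset_symm (fun I J => Ec x I * W x J)]
      exact Finset.sum_congr rfl fun _ _ => mul_comm _ _
    nth_rewrite 2 [h2]
    simp only [← Finset.sum_add_distrib]
    refine Finset.sum_congr rfl fun _ _ => ?_
    rw [Wf, Wf]; ring
  rw [h1, Ec_sum, Ec_sum]
  have h3 : ∀ Y : Finset ℝ → PS, ∑ u ∈ L, dl x u • (v * Y (L.erase u)) = v * ∑ u ∈ L, dl x u • Y (L.erase u) := by
    intro Y; rw [Finset.mul_sum]; simp only [mul_smul_comm]
  rw [h3, h3]
  have h4 : ∑ u ∈ L, dl x u • Wf x (L.erase u) = ∑ u ∈ L, dl x u • W x (L.erase u) + ∑ u ∈ L, dl x u • Ec x (L.erase u) := by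
    rw [← Finset.sum_add_distrib]; simp only [Wf, smul_add]
  rw [h4]
  have h5 : PowerSeries.C (1/2:ℝ) * 2 = 1 := by
    rw [← map_ofNat PowerSeries.C 2, ← map_mul]; norm_num
  generalize ∑ u ∈ L, dl x u • W x (L.erase u) = S1
  generalize ∑ u ∈ L, dl x u • Ec x (L.erase u) = S2
  simp only [PowerSeries.smul_eq_C_mul]
  linear_combination (v * (PP x * W x L - v * S1) - v * v * S2) * h5

def ini (x : ℝ) (L : Finset ℝ) : PS :=
  if L = ∅ then (8 * x)⁻¹ • (v * v) else if L.card = 2 then (∏ u ∈ L, u)⁻¹ • (v * v * v) else 0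

theorem half_two (f : PS) : (1/2:ℝ) • (2 * f) = f := by
  rw [two_mul, ← two_smul ℝ, smul_smul]; norm_num

theorem LE_W (hx0 : x ≠ 0) (hx : x ∉ L) (h0 : (0:ℝ) ∉ L) (hL : 2 ≤ L.card) :
   v * v * ∑ u ∈ L, Tm x u (W u (L.erase u)) (dW u (L.erase u)) + (1/2:ℝ) • (v * (W2 x L + ∑ I ∈ L.powerset, W x I * W x (L \ I)))
     + v * PP x * W x L = x • W x L := by
  apply mul_left_cancel₀ v_ne
  rw [TW hx0 hx h0 hL, QW hx0 hx]
  have h1 := comm_tr hx0 (G x L)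
  have h2 := vvPP x
  have h5 : PowerSeries.C (1/2:ℝ) * 2 = 1 := by
    rw [← map_ofNat PowerSeries.C 2, ← map_mul]; norm_num
  have h3 : W x L = - (Mx x * G x L).trace := rfl
  rw [h3]
  simp only [PowerSeries.smul_eq_C_mul] at *
  set c := PowerSeries.C (1/2:ℝ)
  linear_combination (-c) * h1 + (-(Mx x * G x L).trace) * h2 + (-(v*v*v * PowerSeries.C x * ((Ga x L).trace - (Gb x L).trace))
    - PowerSeries.C x * v * (Dm x * G x L).trace) * h5

theorem Tm_add (x u : ℝ) (F dF F' dF' : PS) : Tm x u (F + F') (dF + dF') = Tm x u F dF + Tm x u F' dF' := by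
  simp only [Tm]; module

theorem Tm_zero (x u : ℝ) : Tm x u 0 0 = 0 := by simp [Tm]

theorem Tm_mul (c : PS) (x u : ℝ) (F dF : PS) : c * Tm x u F dF = Tm x u (c * F) (c * dF) := by
  simp only [Tm, mul_sub, mul_add, mul_smul_comm]

/-- the right-hand side of the loop equation -/
def loopR (x : ℝ) (L : Finset ℝ) (F : ℝ → Finset ℝ → PS) (dF : ℝ → Finset ℝ → PS) (F2 : PS) : PS :=
  ini x L + v * v * ∑ u ∈ L, (Tm x u (F u (L.erase u)) (dF u (L.erase u)) + dl x u • F x (L.erase u)) +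
    (1/2:ℝ) • (v * (F2 + ∑ I ∈ L.powerset, F x I * F x (L \ I)))

theorem loopR_W (hL : L ≠ ∅) : loopR x L Wf dWf (W2f x L) =
    (v * v * ∑ u ∈ L, Tm x u (W u (L.erase u)) (dW u (L.erase u)) + (1/2:ℝ) • (v * (W2 x L + ∑ I ∈ L.powerset, W x I * W x (L \ I)))
     + v * PP x * W x L) + (ini x L + v * v * ∑ u ∈ L, Tm x u (Ec u (L.erase u)) (dEc u (L.erase u)) +
      (1/2:ℝ) • (v * (PP x * Ec x L)) + (1/2 : ℝ) • (v * v * ∑ u ∈ L, dl x u • Ec x (L.erase u))) := by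
  have h := quad_expand (L := L) (x := x)
  rw [loopR, W2f, if_neg hL, Finset.sum_add_distrib, mul_add, mul_add v (W2 x L), smul_add]
  have e : ∑ u ∈ L, Tm x u (Wf u (L.erase u)) (dWf u (L.erase u)) = ∑ u ∈ L, Tm x u (W u (L.erase u)) (dW u (L.erase u))
     + ∑ u ∈ L, Tm x u (Ec u (L.erase u)) (dEc u (L.erase u)) := by
    rw [← Finset.sum_add_distrib]; simp only [Wf, dWf, Tm_add]
  rw [e, mul_add v (W2 x L), smul_add]
  linear_combination h

theorem loop_W_big (hx0 : x ≠ 0) (hx : x ∉ L) (h0 : (0:ℝ) ∉ L) (hL : 3 ≤ L.card) :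
    x • Wf x L = loopR x L Wf dWf (W2f x L) := by
  have hne : L ≠ ∅ := by rintro rfl; simp at hL
  rw [loopR_W hne, LE_W hx0 hx h0 (by omega), Wf, Ec_big (by omega), ini, if_neg hne, if_neg (by omega)]
  have hc : ∀ u ∈ L, 2 ≤ (L.erase u).card := by
    intro u hu; rw [Finset.card_erase_of_mem hu]; omega
  rw [Finset.sum_eq_zero, Finset.sum_eq_zero]
  · simp
  · intro u hu; rw [Ec_big (hc u hu), smul_zero]
  · intro u hu; rw [Ec_big (hc u hu), dEc_big (hc u hu), Tm_zero]

theorem loop_W_two (hx0 : x ≠ 0) (hx : x ∉ L) (h0 : (0:ℝ) ∉ L) (hL : L.card = 2) :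
    x • Wf x L = loopR x L Wf dWf (W2f x L) := by
  have hne : L ≠ ∅ := by rintro rfl; simp at hL
  rw [loopR_W hne, LE_W hx0 hx h0 (by omega), Wf, Ec_big (by omega), ini, if_neg hne, if_pos hL]
  obtain ⟨i, j, hij, rfl⟩ := Finset.card_eq_two.mp hL
  have e1 : ({i, j} : Finset ℝ).erase i = {j} := by
    rw [Finset.erase_insert]; simpa using hij
  have e2 : ({i, j} : Finset ℝ).erase j = {i} := by
    rw [Finset.pair_comm, Finset.erase_insert]; simpa using hij.symm
  rw [Finset.sum_pair hij, Finset.sum_pair hij, Finset.prod_pair hij, e1, e2]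
  simp only [Ec_single, dEc_single, Tm]
  simp only [Finset.mem_insert, Finset.mem_singleton, not_or] at hx h0
  have hi : i ≠ 0 := fun h => h0.1 h.symm
  have hj : j ≠ 0 := fun h => h0.2 h.symm
  have h1 : x - i ≠ 0 := sub_ne_zero.mpr hx.1
  have h2 : x - j ≠ 0 := sub_ne_zero.mpr hx.2
  have h3 : i - j ≠ 0 := sub_ne_zero.mpr hij
  have h4 : j - i = - (i - j) := by ring
  simp only [mul_add, mul_sub, mul_neg, mul_smul_comm, smul_add, smul_sub, smul_neg, mul_zero, smul_zero, add_zero, dl, ddl, h4]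
  match_scalars
  · simp
  · field_simp
    ring

theorem loop_W_one {u : ℝ} (hx0 : x ≠ 0) (hx : x ≠ u) (h0 : u ≠ 0) :
    x • Wf x {u} = loopR x {u} Wf dWf (W2f x {u}) := by
  have hne : ({u} : Finset ℝ) ≠ ∅ := Finset.singleton_ne_empty u
  have hxL : x ∉ ({u} : Finset ℝ) := by simpa using hx
  have h1 : x - u ≠ 0 := sub_ne_zero.mpr hx
  rw [loopR_W hne, ini, if_neg hne, if_neg (by simp)]
  simp only [Finset.sum_singleton, Finset.erase_singleton, Ec_empty, dEc_empty, Ec_single, W_empty]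
  have hdW : dW u ∅ = 0 := by simp [dW, G_empty, Ga, Gb, ords_empty, cw2]
  have hG : G x {u} = (-((x - u)⁻¹ * (x - u)⁻¹)) • Mx u := by
    rw [G, G2, ords_singleton, Finset.sum_singleton, Mp_single, cw2, if_neg (by simp), ch_single, la_single, fs_cons]
    congr 1
    have : u - x = -(x - u) := by ring
    rw [this]
    field_simp
  have hab : Ga x {u} = Gb x {u} := by
    rw [Ga, Gb, ords_singleton, Finset.sum_singleton, Finset.sum_singleton, la_single, fs_cons]
  rw [hdW, Tm_zero, mul_zero, zero_add, QW hx0 hxL, hab, sub_self, mul_zero, sub_zero, Tm_mul, vvPP, vvdPP h0, dtau_eq h0]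
  have hc := comm_tr hx0 (G x {u})
  have hD : (Dm x * G x {u}).trace = (-((x - u)⁻¹ * (x - u)⁻¹)) • (tau u + (x - u) • (Mx u * F21).trace) := by
    rw [hG, Matrix.mul_smul, Matrix.trace_smul, tau, Matrix.trace_mul_comm (Mx u), Dm_sub x u, Matrix.trace_mul_comm (Mx u)]
    congr 1; abel
  have h2 := vvPP x
  have hW : W x {u} = - (Mx x * G x {u}).trace := rfl
  -- the combination of `v * (v/2) W2` and `v * v P W`
  have key : (1/2:ℝ) • (v * (-((dMx x * Mx x - Mx x * dMx x) * G x {u}).trace)) + v * PP x * W x {u} =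
      x • W x {u} - x • (Dm x * G x {u}).trace := by
    apply mul_left_cancel₀ v_ne
    have h5 : PowerSeries.C (1/2:ℝ) * 2 = 1 := by
      rw [← map_ofNat PowerSeries.C 2, ← map_mul]; norm_num
    rw [hW]
    simp only [PowerSeries.smul_eq_C_mul] at hc h2 ⊢
    set c := PowerSeries.C (1/2:ℝ)
    linear_combination (-c) * hc + (-(Mx x * G x {u}).trace) * h2 - PowerSeries.C x * v * (Dm x * G x {u}).trace * h5
  rw [Wf, Ec_single, key, hD]
  simp only [Tm, dl, mul_neg, mul_smul_comm, smul_add, smul_sub, smul_neg]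
  have : PP x * v = v * PP x := mul_comm _ _
  rw [this, ← mul_assoc v v]
  match_scalars <;> field_simp <;> ring

theorem loop_W_zero (hx0 : x ≠ 0) : x • Wf x ∅ = loopR x ∅ Wf dWf (W2f x ∅) := by
  rw [loopR, W2f, if_pos rfl, ini, if_pos rfl]
  simp only [Finset.sum_empty, mul_zero, add_zero, Finset.powerset_empty, Finset.sum_singleton, Finset.sdiff_self,
    Wf, W_empty, zero_add, Ec_empty, smul_zero]
  have hd : v * v * (v * v) * (dMx x * dMx x).trace =  (1/2:ℝ) • (x⁻¹ • (v * v * v * v * v) + tau x * tau x) - (2 * x * x) • (v * v)  := by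
    have h1 := ODE_00 x hx0
    have h2 := ODE_01 x hx0
    have h3 := ODE_10 x hx0
    have h4 := Msq_ent x hx0
    have ht := tau_ent x
    have e : (dMx x * dMx x).trace = 2 * (dMx x 0 0 * dMx x 0 0 + dMx x 0 1 * dMx x 1 0) := by
      rw [Matrix.trace_fin_two]; simp only [Matrix.mul_apply, Fin.sum_univ_two, dMx_11]; ring
    have h5 : PowerSeries.C (1/2:ℝ) * 2 = 1 := by
      rw [← map_ofNat PowerSeries.C 2, ← map_mul]; norm_num
    have h6 : PowerSeries.C x * PowerSeries.C x⁻¹ = 1 := by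
      rw [← map_mul, mul_inv_cancel₀ hx0, map_one]
    rw [e, ht]
    have t4 : (4:PS) ≠ 0 := by
      have e : (4:PS) = PowerSeries.C (4:ℝ) := (map_ofNat _ 4).symm
      rw [e]
      intro h
      have := congrArg (PowerSeries.coeff 0) h
      simp at this
    apply mul_left_cancel₀ t4
    simp only [PowerSeries.smul_eq_C_mul, map_mul, map_ofNat] at h1 h2 h3 h4 ⊢
    set a := Mx x 0 0
    set b := Mx x 0 1
    set c := Mx x 1 0
    set X := PowerSeries.C x
    set Y := PowerSeries.C x⁻¹
    set H := PowerSeries.C (1/2:ℝ)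
    set A := dMx x 0 0
    set B := dMx x 0 1
    set Cc := dMx x 1 0
    linear_combination (2 * (2 * (v * v) * A + (Y * (v * v) * a + (v * c - X * b)))) * h1 +
      2 * (2 * (v * v) * Cc) * h2 + 2 * (Y * (v * v) * b - 2 * v * a) * h3 +
      (2 * Y * Y * v^4 - 8 * X * v) * h4 + 2 * Y * v^5 * h6 - 2 * (Y * v^5 + (v * c + X * b)^2) * h5
  have h5 : PowerSeries.C (1/2:ℝ) * 2 = 1 := by
    rw [← map_ofNat PowerSeries.C 2, ← map_mul]; norm_num
  have h7 : PowerSeries.C (8 * x)⁻¹ = PowerSeries.C (1/2:ℝ) * PowerSeries.C (1/2:ℝ) * PowerSeries.C (1/2:ℝ) * PowerSeries.C x⁻¹ := by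
    rw [← map_mul, ← map_mul, ← map_mul]; congr 1; rw [mul_inv]; norm_num
  have hp := vvPP x
  apply mul_left_cancel₀ v_ne
  apply mul_left_cancel₀ v_ne
  apply mul_left_cancel₀ v_ne
  simp only [PowerSeries.smul_eq_C_mul, map_mul, map_ofNat] at hd hp h7 ⊢
  rw [h7]
  set X := PowerSeries.C x
  set Y := PowerSeries.C x⁻¹
  set H := PowerSeries.C (1/2:ℝ)
  linear_combination H * H * hd + (v * X - H * (v * v * PP x + H * tau x + X * v)) * hp - (X * v * (X * v) * (1 + H) + H * tau x * X * v) * h5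

theorem loop_W (hx0 : x ≠ 0) (hx : x ∉ L) (h0 : (0:ℝ) ∉ L) :
    x • Wf x L = loopR x L Wf dWf (W2f x L) := by
  rcases card_cases L with rfl | ⟨u, rfl⟩ | h
  · exact loop_W_zero hx0
  · exact loop_W_one hx0 (by simpa using hx) (by simpa using fun h => h0 (by simp [h]))
  · rcases h.eq_or_lt with h | h
    · exact loop_W_two hx0 hx h0 h.symm
    · exact loop_W_big hx0 hx h0 h

end

section
open Filter Topology
/-- coefficientwise limits -/
def TD (f : ℝ → PS) (p : PS) (l : Filter ℝ) : Prop :=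
  ∀ n : ℕ, Tendsto (fun y => PowerSeries.coeff n (f y)) l (𝓝 (PowerSeries.coeff n p))

theorem TD.mul {f g : ℝ → PS} {p q : PS} {l : Filter ℝ} (hf : TD f p l) (hg : TD g q l) :
    TD (fun y => f y * g y) (p * q) l := fun n => by
  simp only [PowerSeries.coeff_mul]
  exact tendsto_finset_sum _ fun i _ => (hf _).mul (hg _)

theorem TD.add {f g : ℝ → PS} {p q : PS} {l : Filter ℝ} (hf : TD f p l) (hg : TD g q l) :
    TD (fun y => f y + g y) (p + q) l := fun n => by
  simp only [map_add]
  exact (hf n).add (hg n)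

theorem TD.const_smul {f : ℝ → PS} {p : PS} {l : Filter ℝ} (c : ℝ) (hf : TD f p l) :
    TD (fun y => c • f y) (c • p) l := fun n => by
  simp only [coeff_smul']
  exact (hf n).const_mul c

theorem HD.slope {f : ℝ → PS} {f' : PS} {x : ℝ} (h : HD f f' x) :
    TD (fun y => (y - x)⁻¹ • (f y - f x)) f' (𝓝[≠] x) := fun n => by
  have := hasDerivAt_iff_tendsto_slope.mp (h n)
  refine this.congr fun y => ?_
  rw [coeff_smul', map_sub, slope_def_field]
  field_simp

/-- equality below a weight -/
def EqB (w : ℕ) (f g : PS) : Prop := ∀ i : ℕ, i < w → PowerSeries.coeff i f = PowerSeries.coeff i g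

theorem EqB.refl (w : ℕ) (f : PS) : EqB w f f := fun _ _ => rfl
theorem EqB.add {w : ℕ} {f g f' g' : PS} (h : EqB w f g) (h' : EqB w f' g') : EqB w (f + f') (g + g') := fun i hi => by
  rw [map_add, map_add, h i hi, h' i hi]
theorem EqB.sub {w : ℕ} {f g f' g' : PS} (h : EqB w f g) (h' : EqB w f' g') : EqB w (f - f') (g - g') := fun i hi => by
  rw [map_sub, map_sub, h i hi, h' i hi]
theorem EqB.smul {w : ℕ} {f g : PS} (c : ℝ) (h : EqB w f g) : EqB w (c • f) (c • g) := fun i hi => by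
  rw [coeff_smul', coeff_smul', h i hi]
theorem EqB.mul {w : ℕ} {f g f' g' : PS} (h : EqB w f g) (h' : EqB w f' g') : EqB w (f * f') (g * g') := fun i hi => by
  rw [PowerSeries.coeff_mul, PowerSeries.coeff_mul]
  refine Finset.sum_congr rfl fun p hp => ?_
  have := Finset.HasAntidiagonal.mem_antidiagonal.mp hp
  rw [h _ (by omega), h' _ (by omega)]
theorem EqB.sum {ι : Type*} {s : Finset ι} {w : ℕ} {f g : ι → PS} (h : ∀ i ∈ s, EqB w (f i) (g i)) :
    EqB w (∑ i ∈ s, f i) (∑ i ∈ s, g i) := fun i hi => by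
  rw [map_sum, map_sum]
  exact Finset.sum_congr rfl fun j hj => h j hj i hi
theorem EqB.v_mul {w : ℕ} {f g : PS} (h : EqB w f g) : EqB (w + 1) (v * f) (v * g) := fun i hi => by
  rcases i with _ | i
  · rw [coeff_v_mul_zero, coeff_v_mul_zero]
  · rw [coeff_v_mul_succ, coeff_v_mul_succ, h i (by omega)]
theorem EqB.mono {w w' : ℕ} {f g : PS} (h : EqB w f g) (hw : w' ≤ w) : EqB w' f g := fun i hi => h i (by omega)

theorem loopR_congr {w : ℕ} {x : ℝ} {L : Finset ℝ} {F F' dF dF' : ℝ → Finset ℝ → PS} {Q Q' : PS}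
    (h1 : ∀ u ∈ L, EqB w (F u (L.erase u)) (F' u (L.erase u)))
    (h2 : ∀ u ∈ L, EqB w (dF u (L.erase u)) (dF' u (L.erase u)))
    (h3 : ∀ I, I ⊆ L → EqB w (F x I) (F' x I)) (h4 : EqB w Q Q') :
    EqB (w + 1) (loopR x L F dF Q) (loopR x L F' dF' Q') := by
  refine (EqB.add (EqB.add (EqB.refl _ _) ?_) ?_)
  · rw [mul_assoc, mul_assoc]
    refine EqB.v_mul (EqB.mono (EqB.v_mul (w := w) (EqB.sum fun u hu => ?_)) (by omega))
    refine EqB.add ?_ (EqB.smul _ (h3 _ (Finset.erase_subset _ _)))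
    exact EqB.sub (EqB.smul _ (EqB.add (EqB.smul _ (h2 u hu)) (EqB.smul _ (h1 u hu)))) (EqB.smul _ (h1 u hu))
  · refine EqB.smul _ (EqB.v_mul (EqB.add h4 (EqB.sum fun I hI => ?_)))
    exact EqB.mul (h3 _ (Finset.mem_powerset.mp hI)) (h3 _ Finset.sdiff_subset)

theorem Wf_pair {x y : ℝ} (h : y ≠ x) (hx0 : x ≠ 0) (hy0 : y ≠ 0) :
    Wf x {y} = -((1/2:ℝ) • (((y - x)⁻¹ • (Mx y - Mx x)) * ((y - x)⁻¹ • (Mx y - Mx x))).trace) := by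
  have h1 : y - x ≠ 0 := sub_ne_zero.mpr h
  have e : x - y = -(y - x) := by ring
  have hG : G x {y} = (-((y - x)⁻¹ * (y - x)⁻¹)) • Mx y := by
    rw [G, G2, ords_singleton, Finset.sum_singleton, Mp_single, cw2, if_neg (by simp), ch_single, la_single, fs_cons]
    congr 1
    rw [e]
    field_simp
  have t1 : ((x • v) • (1 : Mt)).trace = (2 * x) • v := by
    rw [Matrix.trace_fin_two]; simp; module
  have t2 : ((y • v) • (1 : Mt)).trace = (2 * y) • v := by
    rw [Matrix.trace_fin_two]; simp; module
  rw [Wf, Ec_single, W, hG, dl, e]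
  simp only [Matrix.mul_smul, Matrix.smul_mul, Matrix.trace_smul, Matrix.mul_sub, Matrix.sub_mul, Matrix.trace_sub,
    Msq x hx0, Msq y hy0, Matrix.trace_mul_comm (Mx y) (Mx x), t1, t2]
  match_scalars <;> field_simp <;> ring

theorem HDM.slope_tr {f : ℝ → Mt} {f' : Mt} {x : ℝ} (h : HDM f f' x) :
    TD (fun y => (((y - x)⁻¹ • (f y - f x)) * ((y - x)⁻¹ • (f y - f x))).trace) (f' * f').trace (𝓝[≠] x) := by
  simp only [Matrix.trace_fin_two, Matrix.mul_apply, Fin.sum_univ_two]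
  have s : ∀ i j, TD (fun y => ((y - x)⁻¹ • (f y - f x)) i j) (f' i j) (𝓝[≠] x) := fun i j => (h i j).slope
  exact (((s 0 0).mul (s 0 0)).add ((s 0 1).mul (s 1 0))).add (((s 1 0).mul (s 0 1)).add ((s 1 1).mul (s 1 1)))

theorem Wf_lim {x : ℝ} {L : Finset ℝ} (hx0 : x ≠ 0) (hx : x ∉ L) :
    TD (fun y => Wf x (insert y L)) (W2f x L) (𝓝[≠] x) := by
  have hne : ∀ᶠ y in 𝓝[≠] x, y ≠ x := eventually_mem_nhdsWithin
  by_cases hL : L = ∅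
  · subst hL
    have h := ((HDM_Mx hx0).slope_tr).const_smul (-(1/2))
    intro n
    have h0 : ∀ᶠ y in 𝓝[≠] x, y ≠ 0 := nhdsWithin_le_nhds (isOpen_ne.mem_nhds hx0)
    have e : W2f x ∅ = (-(1/2:ℝ)) • (dMx x * dMx x).trace := by rw [W2f, if_pos rfl, neg_smul]
    rw [e]
    refine (h n).congr' ?_
    filter_upwards [hne, h0] with y h1 h2
    have e : insert y (∅ : Finset ℝ) = {y} := rfl
    rw [e, Wf_pair h1 hx0 h2, neg_smul]
  · intro n
    have h := (HD_Rg hx0 hx).slope n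
    rw [W2f, if_neg hL]
    refine h.congr' ?_
    have hyL : ∀ᶠ y in 𝓝[≠] x, y ∉ L := nhdsWithin_le_nhds (L.finite_toSet.isClosed.isOpen_compl.mem_nhds hx)
    filter_upwards [hne, hyL] with y h1 h2
    have hLn := Finset.nonempty_iff_ne_empty.mpr hL
    rw [Rg_self, sub_zero, ← Rg_eq h1 h2 hLn, smul_smul, inv_mul_cancel₀ (sub_ne_zero.mpr h1), one_smul, Wf, Ec_big, add_zero]
    rw [Finset.card_insert_of_notMem h2]
    have := hLn.card_pos
    omega

theorem uniq {F dF : ℝ → Finset ℝ → PS} {F2 : ℝ → ℝ → Finset ℝ → PS}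
    (hd : ∀ x L, x ≠ 0 → HD (fun y => F y L) (dF x L) x)
    (h2 : ∀ x y L, y ∉ L → F2 x y L = F x (insert y L))
    (h2c : ∀ x L (n : ℕ), x ≠ 0 → Tendsto (fun y => PowerSeries.coeff n (F2 x y L)) (𝓝[≠] x) (𝓝 (PowerSeries.coeff n (F2 x x L))))
    (hl : ∀ x L, x ≠ 0 → x ∉ L → (0:ℝ) ∉ L → x • F x L = loopR x L F dF (F2 x x L)) :
    ∀ x L, x ≠ 0 → x ∉ L → (0:ℝ) ∉ L → F x L = Wf x L := by
  have main : ∀ w : ℕ, ∀ x L, x ≠ 0 → x ∉ L → (0:ℝ) ∉ L → EqB w (F x L) (Wf x L) := by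
    intro w
    induction w with
    | zero => intro x L _ _ _ i hi; omega
    | succ w ih =>
      intro x L hx0 hx h0
      have key : EqB (w + 1) (x • F x L) (x • Wf x L) := by
        rw [hl x L hx0 hx h0, loop_W hx0 hx h0]
        have hu0 : ∀ u ∈ L, u ≠ 0 := fun u hu h => h0 (h ▸ hu)
        have he0 : ∀ u, (0:ℝ) ∉ L.erase u := fun u h => h0 (Finset.mem_of_mem_erase h)
        refine loopR_congr ?_ ?_ ?_ ?_
        · intro u hu
          exact ih u _ (hu0 u hu) (Finset.notMem_erase u L) (he0 u)
        · intro u hu i hi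
          have a1 := hd u (L.erase u) (hu0 u hu) i
          have a2 := HD_Wf (hu0 u hu) (Finset.notMem_erase u L) i
          refine a1.unique (a2.congr_of_eventuallyEq ?_)
          have e1 : ∀ᶠ y in 𝓝 u, y ≠ 0 := isOpen_ne.mem_nhds (hu0 u hu)
          have e2 : ∀ᶠ y in 𝓝 u, y ∉ L.erase u :=
            (L.erase u).finite_toSet.isClosed.isOpen_compl.mem_nhds (Finset.notMem_erase u L)
          filter_upwards [e1, e2] with y y1 y2
          exact ih y _ y1 y2 (he0 u) i hi
        · intro I hI
          exact ih x I hx0 (fun h => hx (hI h)) (fun h => h0 (hI h))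
        · intro i hi
          refine tendsto_nhds_unique (h2c x L i hx0) ((Wf_lim hx0 hx i).congr' ?_)
          have e1 : ∀ᶠ y in 𝓝[≠] x, y ≠ 0 := nhdsWithin_le_nhds (isOpen_ne.mem_nhds hx0)
          have e2 : ∀ᶠ y in 𝓝[≠] x, y ∉ L := nhdsWithin_le_nhds (L.finite_toSet.isClosed.isOpen_compl.mem_nhds hx)
          have e3 : ∀ᶠ y in 𝓝[≠] x, y ≠ x := eventually_mem_nhdsWithin
          filter_upwards [e1, e2, e3] with y y1 y2 y3
          rw [h2 x y L y2]
          refine (ih x _ hx0 ?_ ?_ i hi).symm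
          · simp [hx, y3.symm]
          · simp [h0, y1.symm]
      have := key.smul x⁻¹
      simpa [smul_smul, hx0] using this
  intro x L hx0 hx h0
  ext n
  exact main (n + 1) x L hx0 hx h0 n (by omega)

end

theorem gQ_cons_iff (l : List ℕ) : IntegralG l ↔ (∃ g : ℕ, 3 * g + l.length = 3 + l.sum) := by
  constructor
  · rintro ⟨g, hg⟩
    refine ⟨g, ?_⟩
    rw [gQ] at hg
    have : (3 * g + l.length : ℚ) = 3 + l.sum := by rw [hg]; ring
    exact_mod_cast this
  · rintro ⟨g, hg⟩
    refine ⟨g, ?_⟩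
    have : (3 * g + l.length : ℚ) = 3 + l.sum := by exact_mod_cast hg
    rw [gQ]; linarith

def Fl (C : List ℕ → ℚ) (l : List ℕ) : ℚ := (3/2)^(XN l) * 2^(l.length) / 4 * ((XN l - 1).factorial : ℚ) * C l

def ini0 (l : List ℕ) : ℚ := if l = [1] then 1/8 else if l = [0,0,0] then 1 else 0

theorem select_len (r : List ℕ) (I : Finset (Fin r.length)) :
    ((select r I : List ℕ) : Multiset ℕ) = I.val.map r.get := by
  rw [select, ← Multiset.map_coe, ← Multiset.filter_coe]
  congr 1
  have : ((List.finRange r.length : List _) : Multiset (Fin r.length)) = (Finset.univ : Finset (Fin r.length)).val := rfl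
  rw [this, ← Finset.filter_val]
  congr 1
  simp

theorem select_sum (r : List ℕ) (I : Finset (Fin r.length)) :
    (select r I).sum + (select r Iᶜ).sum = r.sum := by
  have h : ∀ J : Finset (Fin r.length), (select r J).sum = ∑ i ∈ J, r.get i := by
    intro J
    rw [← Multiset.sum_coe, select_len]; rfl
  rw [h, h, Finset.sum_add_sum_compl]
  simp
theorem select_length (r : List ℕ) (I : Finset (Fin r.length)) :
    (select r I).length + (select r Iᶜ).length = r.length := by
  have h : ∀ J : Finset (Fin r.length), (select r J).length = J.card := by
    intro J
    rw [← Multiset.coe_card, select_len]; simp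
  rw [h, h, Finset.card_add_card_compl]
  simp

theorem Fl_vanish {C : List ℕ → ℚ} (hC : IsNormalizedWitten C) {l : List ℕ} (h : ¬ IntegralG l) : Fl C l = 0 := by
  rw [Fl, hC.vanish l h, mul_zero]

theorem set_sum (r : List ℕ) (j : Fin r.length) (b : ℕ) : (r.set j.val b).sum + r.get j = b + r.sum := by
  have h1 := (List.set_perm_cons_eraseIdx j.2 b).sum_eq
  have h2 := (List.getElem_cons_eraseIdx_perm j.2).sum_eq
  simp only [List.sum_cons, List.get_eq_getElem] at *
  omega

theorem Fl_dvv {C : List ℕ → ℚ} (hC : IsNormalizedWitten C) (d : ℕ) (r : List ℕ) :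
    Fl C (d :: r) = ini0 (d :: r) +
      (∑ j : Fin r.length, if 1 ≤ d + r.get j then (2 * (r.get j : ℚ) + 1) * Fl C (r.set j.val (d + r.get j - 1)) else 0) +
      1/2 * ∑ a ∈ Finset.range (d - 1), (Fl C (a :: (d - 2 - a) :: r) +
        ∑ I : Finset (Fin r.length), Fl C (a :: select r I) * Fl C ((d - 2 - a) :: select r Iᶜ)) := by
  by_cases hI : IntegralG (d :: r)
  · have hI' := (gQ_cons_iff _).mp hI
    obtain ⟨g, hg⟩ := hI'
    simp only [List.length_cons, List.sum_cons] at hg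
    -- X as a natural number
    obtain ⟨X, hX⟩ : ∃ X, 3 * X = 2 * (d + r.sum) + (r.length + 1) := ⟨(2 * (d + r.sum) + (r.length + 1)) / 3, by omega⟩
    have hXN : XN (d :: r) = X := by
      simp only [XN, List.length_cons, List.sum_cons]; omega
    have hXQ : XQ (d :: r) = X := by
      have : (3 * X : ℚ) = 2 * (d + r.sum) + (r.length + 1) := by exact_mod_cast hX
      simp only [XQ, List.length_cons, List.sum_cons]; rw [Nat.cast_add, Nat.cast_add, Nat.cast_one]; linarith
    by_cases hX2 : 2 ≤ X
    · have hdv := hC.dvv d r hI (by rw [hXQ]; exact_mod_cast hX2)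
      obtain ⟨Y, rfl⟩ : ∃ Y, X = Y + 2 := ⟨X - 2, by omega⟩
      have hini : ini0 (d :: r) = 0 := by
        rw [ini0, if_neg, if_neg]
        · intro h; injection h with h1 h2; subst h1; subst h2; simp at hX
        · intro h; injection h with h1 h2; subst h1; subst h2; simp at hX
      rw [hini, zero_add, Fl, hdv, hXN, hXQ, mul_add, Finset.mul_sum, Finset.mul_sum, Finset.mul_sum]
      have hY : ((Y:ℚ) + 1) ≠ 0 := by positivity
      have hc : ((Y + 2 : ℕ) : ℚ) - 1 = Y + 1 := by push_cast; ring
      rw [hc]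
      have hf : (((Y + 1).factorial : ℕ) : ℚ) = (Y + 1) * (Y.factorial : ℚ) := by
        rw [Nat.factorial_succ]; push_cast; ring
      have hf0 : (Y.factorial : ℚ) ≠ 0 := by exact_mod_cast Nat.factorial_ne_zero Y
      congr 1
      · refine Finset.sum_congr rfl fun j _ => ?_
        split_ifs with h1
        · have hs := set_sum r j (d + r.get j - 1)
          have hXj : XN (r.set j.val (d + r.get j - 1)) = Y + 1 := by
            simp only [XN, List.length_set]; omega
          simp only [Fl, hXj, List.length_set, List.length_cons, Nat.add_sub_cancel]
          have : Y + 2 - 1 = Y + 1 := by omega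
          rw [this, hf]
          field_simp
          ring
        · simp
      · refine Finset.sum_congr rfl fun a ha => ?_
        have ha := Finset.mem_range.mp ha
        rw [mul_add, mul_add (1/2 : ℚ)]
        congr 1
        · have hXj : XN (a :: (d - 2 - a) :: r) = Y + 1 := by
            simp only [XN, List.length_cons, List.sum_cons]; omega
          simp only [Fl, hXj, List.length_cons, Nat.add_sub_cancel]
          have : Y + 2 - 1 = Y + 1 := by omega
          rw [this, hf]
          field_simp
          ring
        · rw [Finset.mul_sum, Finset.mul_sum]
          refine Finset.sum_congr rfl fun I _ => ?_
          have hs := select_sum r I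
          have hl := select_length r I
          split_ifs with h3
          · obtain ⟨X1, hX1⟩ := h3
            have e1 : XN (a :: select r I) = X1 := by
              simp only [XN, List.length_cons, List.sum_cons]; omega
            have e2 : XN ((d - 2 - a) :: select r Iᶜ) = Y + 1 - X1 := by
              simp only [XN, List.length_cons, List.sum_cons]; omega
            obtain ⟨X2, hX2⟩ : ∃ X2, Y + 1 = X1 + X2 := ⟨Y + 1 - X1, by omega⟩
            simp only [Fl, e1, e2, List.length_cons]
            have e3 : Y + 1 - X1 = X2 := by omega
            have e4 : Y + 2 = X1 + X2 + 1 := by omega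
            have e5 : Y + 2 - 1 = Y + 1 := by omega
            have e6 : (2:ℚ) ^ (r.length + 1) = 2 ^ ((select r I).length + (select r Iᶜ).length + 1) := by
              congr 1; omega
            rw [e3, e5, e4, e6]
            have hf1 : (((Y + 1).factorial : ℕ) : ℚ) ≠ 0 := by exact_mod_cast Nat.factorial_ne_zero _
            field_simp
            ring
          · have : ¬ IntegralG (a :: select r I) := by
              rw [gQ_cons_iff]; rintro ⟨g', hg'⟩
              simp only [List.length_cons, List.sum_cons] at hg'
              omega
            rw [Fl_vanish hC this]; simp
    · have hX1 : X = 1 := by omega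
      subst hX1
      have : (d = 1 ∧ r = []) ∨ (d = 0 ∧ r = [0, 0]) := by
        rcases r with _ | ⟨b, _ | ⟨c, _ | ⟨e, r⟩⟩⟩
        · simp only [List.sum_nil, List.length_nil] at hX; left; exact ⟨by omega, rfl⟩
        · simp only [List.sum_cons, List.length_cons, List.sum_nil, List.length_nil] at hX; omega
        · simp only [List.sum_cons, List.length_cons, List.sum_nil, List.length_nil] at hX; right
          have : d = 0 ∧ b = 0 ∧ c = 0 := by omega
          obtain ⟨rfl, rfl, rfl⟩ := this
          exact ⟨rfl, rfl⟩
        · simp only [List.sum_cons, List.length_cons] at hX; omega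
      rcases this with ⟨rfl, rfl⟩ | ⟨rfl, rfl⟩
      · simp [Fl, XN, hC.init1, ini0]; norm_num
      · simp [Fl, XN, hC.init3, ini0, Fin.forall_fin_two]; norm_num
  · have hI' : ∀ g : ℕ, 3 * g + (r.length + 1) ≠ 3 + (d + r.sum) := by
      intro g hg; exact hI ((gQ_cons_iff _).mpr ⟨g, by simpa using hg⟩)
    rw [Fl_vanish hC hI, ini0, if_neg, if_neg, Finset.sum_eq_zero, Finset.sum_eq_zero]
    · simp
    · intro a ha
      have ha := Finset.mem_range.mp ha
      rw [Fl_vanish hC, Finset.sum_eq_zero, add_zero]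
      · intro I _
        by_cases h1 : IntegralG (a :: select r I)
        · by_cases h2 : IntegralG ((d - 2 - a) :: select r Iᶜ)
          · exfalso
            rw [gQ_cons_iff] at h1 h2
            obtain ⟨g1, h1⟩ := h1
            obtain ⟨g2, h2⟩ := h2
            have hs := select_sum r I
            have hl := select_length r I
            simp only [List.length_cons, List.sum_cons] at h1 h2
            exact hI' (g1 + g2) (by omega)
          · rw [Fl_vanish hC h2, mul_zero]
        · rw [Fl_vanish hC h1, zero_mul]
      · rw [gQ_cons_iff]; rintro ⟨g, hg⟩
        simp only [List.length_cons, List.sum_cons] at hg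
        exact hI' (g + 1) (by omega)
    · intro j _
      split_ifs with h1
      · have hs := set_sum r j (d + r.get j - 1)
        rw [Fl_vanish hC, mul_zero]
        rw [gQ_cons_iff]; rintro ⟨g, hg⟩
        simp only [List.length_set] at hg
        exact hI' g (by omega)
      · rfl
    · intro h; injection h with h1 h2; subst h1; subst h2; exact hI' 0 (by simp)
    · intro h; injection h with h1 h2; subst h1; subst h2; exact hI' 1 (by simp)

section
variable {C : List ℕ → ℚ} (hC : IsNormalizedWitten C)

theorem Fl_perm (hC : IsNormalizedWitten C) {l l' : List ℕ} (h : l.Perm l') : Fl C l = Fl C l' := by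
  rw [Fl, Fl, hC.symm h, XN, XN, h.length_eq, h.sum_eq]

def Hs (C : List ℕ → ℚ) (s : Multiset ℕ) : ℝ := if 0 ∈ s then 0 else ((Fl C (s.map (· - 1)).toList : ℚ) : ℝ)

theorem Hs_zero {s : Multiset ℕ} (h : 0 ∈ s) : Hs C s = 0 := if_pos h

theorem Hs_coe (hC : IsNormalizedWitten C) (l : List ℕ) : Hs C ((l : Multiset ℕ).map (· + 1)) = Fl C l := by
  rw [Hs, if_neg (by simp)]
  congr 1
  apply Fl_perm hC
  rw [← Multiset.coe_eq_coe, Multiset.coe_toList, Multiset.map_map]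
  simp

def inim (a : ℕ) (s : Multiset ℕ) : ℝ := if a = 1 ∧ s = 0 then 1/8 else if a = 0 ∧ s = {1, 1} then 1 else 0
def Kb (b : ℕ) : ℝ := if b = 0 then 0 else 2 * b - 1

theorem sum_select (r : List ℕ) (f : Multiset ℕ → Multiset ℕ → ℝ) :
    ∑ I : Finset (Fin r.length), f (select r I : List ℕ) (select r Iᶜ : List ℕ) =
      ((Multiset.antidiagonal (r : Multiset ℕ)).map (fun p => f p.1 p.2)).sum := by
  let R := AddMonoidAlgebra ℝ (Multiset ℕ × Multiset ℕ)
  let φ : ℕ → R := fun b => AddMonoidAlgebra.single ({b}, 0) 1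
  let ψ : ℕ → R := fun b => AddMonoidAlgebra.single (0, {b}) 1
  have hφ : ∀ s : Multiset ℕ, (s.map φ).prod = AddMonoidAlgebra.single (s, 0) 1 := by
    intro s
    induction s using Multiset.induction with
    | empty => rfl
    | cons a s ih =>
      rw [Multiset.map_cons, Multiset.prod_cons, ih, AddMonoidAlgebra.single_mul_single]
      simp [Multiset.singleton_add]
  have hψ : ∀ s : Multiset ℕ, (s.map ψ).prod = AddMonoidAlgebra.single (0, s) 1 := by
    intro s
    induction s using Multiset.induction with
    | empty => rfl
    | cons a s ih =>
      rw [Multiset.map_cons, Multiset.prod_cons, ih, AddMonoidAlgebra.single_mul_single]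
      simp [Multiset.singleton_add]
  have h1 : ((r : Multiset ℕ).map (fun b => φ b + ψ b)).prod =
     ((Multiset.antidiagonal (r : Multiset ℕ)).map (fun p => (AddMonoidAlgebra.single p 1 : R))).sum := by
    rw [Multiset.prod_map_add]
    congr 1
    refine Multiset.map_congr rfl fun p _ => ?_
    rw [hφ, hψ, AddMonoidAlgebra.single_mul_single]; simp
  have h2 : ((r : Multiset ℕ).map (fun b => φ b + ψ b)).prod =
     ∑ I : Finset (Fin r.length), (AddMonoidAlgebra.single (((select r I : List ℕ) : Multiset ℕ), ((select r Iᶜ : List ℕ) : Multiset ℕ)) 1 : R) := by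
    have e : ((r : Multiset ℕ).map (fun b => φ b + ψ b)).prod = ∏ i : Fin r.length, (φ (r.get i) + ψ (r.get i)) := by
      rw [Multiset.map_coe, Multiset.prod_coe]
      exact (Fin.prod_univ_fun_getElem r (fun b => φ b + ψ b)).symm
    rw [e, Finset.prod_add, Finset.powerset_univ]
    refine Finset.sum_congr rfl fun I _ => ?_
    have e1 : ∏ i ∈ I, φ (r.get i) = ((I.val.map r.get).map φ).prod := by rw [Multiset.map_map]; rfl
    have e2 : ∏ i ∈ Finset.univ \ I, ψ (r.get i) = ((Iᶜ.val.map r.get).map ψ).prod := by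
      rw [Multiset.map_map, Finset.compl_eq_univ_sdiff]; rfl
    rw [e1, e2, hφ, hψ, select_len, select_len, AddMonoidAlgebra.single_mul_single]; simp
  let Λ : R →+ ℝ := (Finsupp.liftAddHom (fun p : Multiset ℕ × Multiset ℕ => AddMonoidHom.mulRight (f p.1 p.2))).comp
    (AddMonoidAlgebra.coeffAddEquiv (R := ℝ) (M := Multiset ℕ × Multiset ℕ)).toAddMonoidHom
  have hΛ : ∀ p, Λ (AddMonoidAlgebra.single p 1) = f p.1 p.2 := by
    intro p
    have : AddMonoidAlgebra.coeffAddEquiv (AddMonoidAlgebra.single p (1:ℝ)) = Finsupp.single p 1 := rfl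
    simp [Λ, this]
  have := congrArg Λ (h1.symm.trans h2)
  rw [map_sum, map_multiset_sum, Multiset.map_map] at this
  simp only [hΛ, Function.comp_def] at this
  exact this.symm

theorem sum_set (r : List ℕ) (f : ℕ → Multiset ℕ → ℝ) :
   ∑ j : Fin r.length, f (r.get j) ((r.eraseIdx j : List ℕ)) = ((r : Multiset ℕ).map (fun b => f b ((r : Multiset ℕ).erase b))).sum := by
  rw [Multiset.map_coe, Multiset.sum_coe, ← Fin.sum_univ_fun_getElem]
  refine Finset.sum_congr rfl fun j _ => ?_
  congr 1
  have h2 := Multiset.coe_eq_coe.mpr (List.getElem_cons_eraseIdx_perm j.2)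
  conv_rhs => rw [← h2]
  rw [← Multiset.cons_coe]; simp

theorem erase_map_succ (r : List ℕ) (b : ℕ) :
    ((r : Multiset ℕ).map (· + 1)).erase (b + 1) = ((r : Multiset ℕ).erase b).map (· + 1) :=
  (Multiset.map_erase _ (add_left_injective 1) b _).symm

theorem sum_antidiag_range (d : ℕ) (f : ℕ → ℕ → ℝ) (h0 : ∀ c, f 0 c = 0) (h1 : ∀ b, f b 0 = 0) :
    ∑ p ∈ Finset.HasAntidiagonal.antidiagonal d, f p.1 p.2 = ∑ a ∈ Finset.range (d - 1), f (a + 1) (d - 2 - a + 1) := by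
  rcases d with _ | _ | d
  · simp [h0]
  · simp [Finset.Nat.antidiagonal_succ, h0, h1]
  · rw [Finset.Nat.antidiagonal_succ, Finset.sum_cons, h0, zero_add, Finset.sum_map, Finset.Nat.antidiagonal_succ', Finset.sum_cons,
      Finset.sum_map]
    simp only [Function.Embedding.prodMap, Function.Embedding.coeFn_mk, Prod.map, Function.Embedding.refl_apply]
    rw [h1, zero_add, Finset.Nat.sum_antidiagonal_eq_sum_range_succ_mk]
    refine Finset.sum_congr (by simp) fun a ha => ?_
    have := Finset.mem_range.mp ha
    simp

theorem mantidiag_map (s : Multiset ℕ) (f : ℕ → ℕ) :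
    Multiset.antidiagonal (s.map f) = (Multiset.antidiagonal s).map (fun p => (p.1.map f, p.2.map f)) := by
  induction s using Multiset.induction with
  | empty => simp
  | cons a s ih => simp [ih, Multiset.map_map, Function.comp_def]

theorem Hs_dvv (hC : IsNormalizedWitten C) (a : ℕ) (s : Multiset ℕ) :
    Hs C ((a + 1) ::ₘ s) = inim a s + (s.map (fun b => Kb b * Hs C ((a + b - 1) ::ₘ s.erase b))).sum +
      1/2 * ∑ p ∈ Finset.HasAntidiagonal.antidiagonal a, (Hs C (p.1 ::ₘ p.2 ::ₘ s) +
        ((Multiset.antidiagonal s).map (fun q => Hs C (p.1 ::ₘ q.1) * Hs C (p.2 ::ₘ q.2))).sum) := by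
  by_cases h0 : 0 ∈ s
  · rw [Hs_zero (by simp [h0]), inim, if_neg, if_neg, Finset.sum_eq_zero, Multiset.sum_eq_zero]
    · simp
    · intro y hy
      obtain ⟨b, hb, rfl⟩ := Multiset.mem_map.mp hy
      by_cases hb0 : b = 0
      · simp [Kb, hb0]
      · rw [Hs_zero, mul_zero]
        rw [Multiset.mem_cons]; right
        exact (Multiset.mem_erase_of_ne (Ne.symm hb0)).mpr h0
    · intro p _
      rw [Hs_zero (by simp [h0]), zero_add]
      apply Multiset.sum_eq_zero
      intro y hy
      obtain ⟨q, hq, rfl⟩ := Multiset.mem_map.mp hy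
      rw [← Multiset.mem_antidiagonal.mp hq, Multiset.mem_add] at h0
      rcases h0 with h | h
      · rw [Hs_zero (by simp [h]), zero_mul]
      · rw [Hs_zero (s := p.2 ::ₘ q.2) (by simp [h]), mul_zero]
    · rintro ⟨_, rfl⟩; simp at h0
    · rintro ⟨_, rfl⟩; simp at h0
  · obtain ⟨r, rfl⟩ : ∃ r : List ℕ, s = (r : Multiset ℕ).map (· + 1) := by
      refine ⟨(s.map (· - 1)).toList, ?_⟩
      rw [Multiset.coe_toList, Multiset.map_map]
      symm
      conv_rhs => rw [← Multiset.map_id s]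
      refine Multiset.map_congr rfl fun b hb => ?_
      have : b ≠ 0 := fun h => h0 (h ▸ hb)
      simp; omega
    have hc : ∀ (b : ℕ) (l : List ℕ), (b + 1) ::ₘ (l : Multiset ℕ).map (· + 1) = ((b :: l : List ℕ) : Multiset ℕ).map (· + 1) := by
      intro b l; simp
    rw [hc, Hs_coe hC, Fl_dvv hC]
    push_cast
    congr 1
    · congr 1
      · have e1 : (a :: r = [1]) ↔ (a = 1 ∧ (r : Multiset ℕ).map (· + 1) = 0) := by simp
        have e2 : (a :: r = [0, 0, 0]) ↔ (a = 0 ∧ (r : Multiset ℕ).map (· + 1) = {1, 1}) := by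
          constructor
          · intro h; injection h with h1 h2; subst h1; subst h2; exact ⟨rfl, rfl⟩
          · rintro ⟨rfl, h⟩
            have h' := congrArg (Multiset.map (· - 1)) h
            rw [Multiset.map_map] at h'
            simp only [Function.comp_def, Nat.add_sub_cancel, Multiset.map_id'] at h'
            have h2 : (r : Multiset ℕ) = (([0, 0] : List ℕ) : Multiset ℕ) := by rw [h']; rfl
            have h3 := List.perm_replicate.mp (show r.Perm (List.replicate 2 0) from Multiset.coe_eq_coe.mp h2)
            rw [h3]; rfl
        simp only [ini0, inim, e1, e2]
        split_ifs <;> simp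
      · rw [Multiset.map_map]
        simp only [Function.comp_def, erase_map_succ]
        rw [← sum_set r (fun b t => Kb (b + 1) * Hs C ((a + (b + 1) - 1) ::ₘ t.map (· + 1)))]
        refine Finset.sum_congr rfl fun j _ => ?_
        split_ifs with h1
        · obtain ⟨e, he⟩ : ∃ e, a + r.get j = e + 1 := ⟨a + r.get j - 1, by omega⟩
          have e1 : a + (r.get j + 1) - 1 = e + 1 := by omega
          have e2 : a + r.get j - 1 = e := by omega
          rw [e1, e2, hc, Hs_coe hC, Fl_perm hC (List.set_perm_cons_eraseIdx j.2 _), Kb, if_neg (by omega)]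
          push_cast; ring
        · have : a + (r.get j + 1) - 1 = 0 := by omega
          rw [this, Hs_zero (by simp)]; simp
    · congr 1
      rw [sum_antidiag_range a (fun b c => Hs C (b ::ₘ c ::ₘ (r : Multiset ℕ).map (· + 1)) +
        ((Multiset.antidiagonal ((r : Multiset ℕ).map (· + 1))).map (fun q => Hs C (b ::ₘ q.1) * Hs C (c ::ₘ q.2))).sum)]
      · refine Finset.sum_congr rfl fun b _ => ?_
        congr 1
        · rw [hc, hc, Hs_coe hC]
        · rw [mantidiag_map, Multiset.map_map]
          simp only [Function.comp_def]
          rw [← sum_select r (fun p q => Hs C ((b + 1) ::ₘ p.map (· + 1)) * Hs C ((a - 2 - b + 1) ::ₘ q.map (· + 1)))]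
          refine Finset.sum_congr rfl fun I _ => ?_
          rw [hc, hc, Hs_coe hC, Hs_coe hC]
      · intro c; simp [Hs_zero]
      · intro c; simp [Hs_zero]

end

section
open Filter Topology

/-- formal sum `Σ_a v^a H a` -/
def Sm (H : ℕ → PS) : PS :=
  PowerSeries.mk fun w : ℕ => ∑ p ∈ Finset.HasAntidiagonal.antidiagonal w, PowerSeries.coeff p.2 (H p.1)

theorem coeff_Sm (H : ℕ → PS) (w : ℕ) : PowerSeries.coeff w (Sm H) =
    ∑ p ∈ Finset.HasAntidiagonal.antidiagonal w, PowerSeries.coeff p.2 (H p.1) := PowerSeries.coeff_mk _ _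

theorem Sm_add (H K : ℕ → PS) : Sm (fun a => H a + K a) = Sm H + Sm K := by
  ext w; simp only [coeff_Sm, map_add, Finset.sum_add_distrib]
theorem Sm_sub (H K : ℕ → PS) : Sm (fun a => H a - K a) = Sm H - Sm K := by
  ext w; simp only [coeff_Sm, map_sub, Finset.sum_sub_distrib]
theorem Sm_smul (c : ℝ) (H : ℕ → PS) : Sm (fun a => c • H a) = c • Sm H := by
  ext w; simp only [coeff_Sm, coeff_smul', Finset.mul_sum]
theorem Sm_zero : Sm (fun _ => 0) = 0 := by
  ext w; simp only [coeff_Sm, map_zero, Finset.sum_const_zero]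
theorem Sm_sum {ι : Type*} (s : Finset ι) (H : ι → ℕ → PS) : Sm (fun a => ∑ i ∈ s, H i a) = ∑ i ∈ s, Sm (H i) := by
  ext w; simp only [coeff_Sm, map_sum]; rw [Finset.sum_comm]
theorem Sm_shift (H : ℕ → PS) : Sm H = H 0 + v * Sm (fun a => H (a + 1)) := by
  ext w
  rw [map_add, coeff_Sm]
  rcases w with _ | w
  · rw [coeff_v_mul_zero]; simp
  · rw [coeff_v_mul_succ, Finset.Nat.antidiagonal_succ, Finset.sum_cons, Finset.sum_map, coeff_Sm]
    rfl
theorem Sm_Sm (H : ℕ → ℕ → PS) : Sm (fun a => Sm (H a)) =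
    Sm (fun e => ∑ p ∈ Finset.HasAntidiagonal.antidiagonal e, H p.1 p.2) := by
  ext w
  simp only [coeff_Sm, map_sum]
  rw [Finset.sum_sigma', Finset.sum_sigma']
  refine Finset.sum_nbij' (fun q => ⟨(q.1.1 + q.2.1, q.2.2), (q.1.1, q.2.1)⟩) (fun q => ⟨(q.2.1, q.2.2 + q.1.2), (q.2.2, q.1.2)⟩) ?_ ?_ ?_ ?_ ?_
  · rintro ⟨⟨a, b⟩, ⟨c, d⟩⟩ h; simp only [Finset.mem_sigma, Finset.HasAntidiagonal.mem_antidiagonal] at h ⊢; obtain ⟨h1, h2⟩ := h; refine ⟨?_, ?_⟩ <;> first | omega | trivial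
  · rintro ⟨⟨a, b⟩, ⟨c, d⟩⟩ h; simp only [Finset.mem_sigma, Finset.HasAntidiagonal.mem_antidiagonal] at h ⊢; obtain ⟨h1, h2⟩ := h; refine ⟨?_, ?_⟩ <;> first | omega | trivial
  · rintro ⟨⟨a, b⟩, ⟨c, d⟩⟩ h; simp only [Finset.mem_sigma, Finset.HasAntidiagonal.mem_antidiagonal] at h
    obtain ⟨h1, rfl⟩ := h; rfl
  · rintro ⟨⟨a, b⟩, ⟨c, d⟩⟩ h; simp only [Finset.mem_sigma, Finset.HasAntidiagonal.mem_antidiagonal] at h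
    obtain ⟨h1, rfl⟩ := h; rfl
  · rintro ⟨⟨a, b⟩, ⟨c, d⟩⟩ h; rfl
theorem Sm_comm (H : ℕ → ℕ → PS) : Sm (fun a => Sm (H a)) = Sm (fun b => Sm (fun a => H a b)) := by
  rw [Sm_Sm, Sm_Sm]
  congr 1; funext e
  exact (Finset.Nat.sum_antidiagonal_swap (f := fun p : ℕ × ℕ => H p.1 p.2)).symm
theorem Sm_mul (H : ℕ → PS) (g : PS) : Sm (fun a => H a * g) = Sm H * g := by
  ext w
  rw [coeff_Sm, PowerSeries.coeff_mul]
  simp only [coeff_Sm, PowerSeries.coeff_mul, Finset.sum_mul]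
  rw [Finset.sum_sigma', Finset.sum_sigma']
  refine Finset.sum_nbij' (fun q => ⟨(q.1.1 + q.2.1, q.2.2), (q.1.1, q.2.1)⟩) (fun q => ⟨(q.2.1, q.2.2 + q.1.2), (q.2.2, q.1.2)⟩) ?_ ?_ ?_ ?_ ?_
  · rintro ⟨⟨a, b⟩, ⟨c, d⟩⟩ h; simp only [Finset.mem_sigma, Finset.HasAntidiagonal.mem_antidiagonal] at h ⊢; obtain ⟨h1, h2⟩ := h; refine ⟨?_, ?_⟩ <;> first | omega | trivial
  · rintro ⟨⟨a, b⟩, ⟨c, d⟩⟩ h; simp only [Finset.mem_sigma, Finset.HasAntidiagonal.mem_antidiagonal] at h ⊢; obtain ⟨h1, h2⟩ := h; refine ⟨?_, ?_⟩ <;> first | omega | trivial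
  · rintro ⟨⟨a, b⟩, ⟨c, d⟩⟩ h; simp only [Finset.mem_sigma, Finset.HasAntidiagonal.mem_antidiagonal] at h
    obtain ⟨h1, rfl⟩ := h; rfl
  · rintro ⟨⟨a, b⟩, ⟨c, d⟩⟩ h; simp only [Finset.mem_sigma, Finset.HasAntidiagonal.mem_antidiagonal] at h
    obtain ⟨h1, rfl⟩ := h; rfl
  · rintro ⟨⟨a, b⟩, ⟨c, d⟩⟩ h; rfl
theorem Sm_mul_Sm (H K : ℕ → PS) : Sm H * Sm K = Sm (fun e => ∑ p ∈ Finset.HasAntidiagonal.antidiagonal e, H p.1 * K p.2) := by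
  rw [← Sm_mul, ← Sm_Sm (fun a b => H a * K b)]
  congr 1; funext a
  rw [mul_comm, ← Sm_mul]
  congr 1; funext b; rw [mul_comm]

/-- `Σ_a (v/x)^a H a` -/
def Sx (x : ℝ) (H : ℕ → PS) : PS := Sm (fun a => (x⁻¹)^a • H a)
def dSx (x : ℝ) (H : ℕ → PS) : PS := Sm (fun a => (-(a * (x⁻¹)^(a+1))) • H a)

theorem HD_Sx {x : ℝ} (hx : x ≠ 0) (H : ℕ → PS) : HD (fun y => Sx y H) (dSx x H) x := fun n => by
  simp only [Sx, dSx, coeff_Sm, coeff_smul']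
  refine HasDerivAt.fun_sum fun p _ => HasDerivAt.mul_const ?_ _
  have := (hasDerivAt_inv hx).pow p.1
  refine this.congr_deriv ?_
  rcases p.1 with _ | k
  · simp
  · simp; ring

theorem Sx_add (x : ℝ) (H K : ℕ → PS) : Sx x (fun a => H a + K a) = Sx x H + Sx x K := by
  simp only [Sx, smul_add, Sm_add]
theorem Sx_smul (x c : ℝ) (H : ℕ → PS) : Sx x (fun a => c • H a) = c • Sx x H := by
  rw [Sx, Sx, ← Sm_smul]; congr 1; funext a; rw [smul_comm]
theorem Sx_zero (x : ℝ) : Sx x (fun _ => 0) = 0 := by simp only [Sx, smul_zero, Sm_zero]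
theorem Sx_sum {ι : Type*} (x : ℝ) (s : Finset ι) (H : ι → ℕ → PS) : Sx x (fun a => ∑ i ∈ s, H i a) = ∑ i ∈ s, Sx x (H i) := by
  simp only [Sx, Finset.smul_sum]; rw [Sm_sum]
theorem Sx_comm (x y : ℝ) (H : ℕ → ℕ → PS) : Sx x (fun a => Sx y (H a)) = Sx y (fun b => Sx x (fun a => H a b)) := by
  simp only [Sx, ← Sm_smul]
  rw [Sm_comm]
  congr 1; funext a; congr 1; funext b; rw [smul_comm]
theorem Sx_mul (x : ℝ) (H : ℕ → PS) (g : PS) : Sx x (fun a => H a * g) = Sx x H * g := by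
  simp only [Sx, ← smul_mul_assoc]; rw [Sm_mul]
theorem Sx_mul_left (x : ℝ) (H : ℕ → PS) (g : PS) : Sx x (fun a => g * H a) = g * Sx x H := by
  simp only [mul_comm g]; exact Sx_mul x H g
theorem Sx_Sx (x : ℝ) (H : ℕ → ℕ → PS) : Sx x (fun a => Sx x (H a)) =
    Sx x (fun e => ∑ p ∈ Finset.HasAntidiagonal.antidiagonal e, H p.1 p.2) := by
  simp only [Sx, ← Sm_smul]
  rw [Sm_Sm]
  congr 1; funext e
  rw [Finset.smul_sum]
  refine Finset.sum_congr rfl fun p hp => ?_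
  rw [← Finset.HasAntidiagonal.mem_antidiagonal.mp hp, smul_smul, pow_add]
theorem Sx_mul_Sx (x : ℝ) (H K : ℕ → PS) : Sx x H * Sx x K =
    Sx x (fun e => ∑ p ∈ Finset.HasAntidiagonal.antidiagonal e, H p.1 * K p.2) := by
  rw [← Sx_mul, ← Sx_Sx x (fun a b => H a * K b)]
  congr 1; funext a
  rw [Sx_mul_left]
theorem Sx_shift {x : ℝ} (hx : x ≠ 0) {H : ℕ → PS} (h0 : H 0 = 0) : x • Sx x H = v * Sx x (fun a => H (a + 1)) := by
  rw [Sx, Sm_shift, h0, smul_zero, zero_add, ← mul_smul_comm, ← Sm_smul, Sx]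
  congr 2; funext a
  rw [smul_smul, pow_succ]; congr 1; field_simp

/-- iterated sums -/
def genl : List ℝ → (Multiset ℕ → ℝ) → PS
  | [], φ => PowerSeries.C (φ 0)
  | u :: l, φ => Sx u (fun b => genl l (fun s => φ (b ::ₘ s)))

theorem genl_perm {l l' : List ℝ} (h : l.Perm l') : ∀ φ, genl l φ = genl l' φ := by
  induction h with
  | nil => intro φ; rfl
  | cons u _ ih => intro φ; simp only [genl, ih]
  | swap u w l =>
    intro φ
    simp only [genl]
    rw [Sx_comm]
    congr 1; funext a; congr 1; funext b; congr 1; funext s; rw [Multiset.cons_swap]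
  | trans _ _ ih1 ih2 => intro φ; rw [ih1, ih2]

def gen (L : Finset ℝ) (φ : Multiset ℕ → ℝ) : PS := genl L.toList φ
theorem gen_empty (φ : Multiset ℕ → ℝ) : gen ∅ φ = PowerSeries.C (φ 0) := by simp [gen, genl]
theorem gen_insert {L : Finset ℝ} {u : ℝ} (h : u ∉ L) (φ : Multiset ℕ → ℝ) :
    gen (insert u L) φ = Sx u (fun b => gen L (fun s => φ (b ::ₘ s))) := by
  rw [gen, genl_perm (Finset.toList_insert h)]; rfl

theorem gen_add (L : Finset ℝ) : ∀ φ ψ : Multiset ℕ → ℝ, gen L (fun s => φ s + ψ s) = gen L φ + gen L ψ := by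
  induction L using Finset.induction_on with
  | empty => intro φ ψ; simp only [gen_empty, map_add]
  | insert u L h ih => intro φ ψ; simp only [gen_insert h, ih, Sx_add]
theorem gen_smul (L : Finset ℝ) (c : ℝ) : ∀ φ : Multiset ℕ → ℝ, gen L (fun s => c * φ s) = c • gen L φ := by
  induction L using Finset.induction_on with
  | empty => intro φ; simp only [gen_empty, map_mul, PowerSeries.smul_eq_C_mul]
  | insert u L h ih => intro φ; simp only [gen_insert h, ih, Sx_smul]
theorem gen_card (L : Finset ℝ) : ∀ φ : Multiset ℕ → ℝ, (∀ s, s.card = L.card → φ s = 0) → gen L φ = 0 := by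
  induction L using Finset.induction_on with
  | empty => intro φ h; rw [gen_empty, h 0 (by simp), map_zero]
  | insert u L h ih =>
    intro φ hφ
    rw [gen_insert h]
    have : (fun b => gen L (fun s => φ (b ::ₘ s))) = fun _ => 0 := by
      funext b
      apply ih
      intro s hs
      apply hφ
      rw [Multiset.card_cons, hs, Finset.card_insert_of_notMem h]
    rw [this, Sx_zero]
theorem gen_zero (L : Finset ℝ) : gen L (fun _ => 0) = 0 := gen_card L _ fun _ _ => rfl
theorem gen_sum {ι : Type*} (L : Finset ℝ) (t : Finset ι) (φ : ι → Multiset ℕ → ℝ) :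
    gen L (fun s => ∑ i ∈ t, φ i s) = ∑ i ∈ t, gen L (φ i) := by
  classical
  induction t using Finset.induction_on with
  | empty => simp only [Finset.sum_empty, gen_zero]
  | insert i t h ih => simp only [Finset.sum_insert h, gen_add, ih]

theorem gen_prod (L : Finset ℝ) : ∀ φ ψ : Multiset ℕ → ℝ,
    gen L (fun s => ((Multiset.antidiagonal s).map (fun q => φ q.1 * ψ q.2)).sum) =
      ∑ I ∈ L.powerset, gen I φ * gen (L \ I) ψ := by
  induction L using Finset.induction_on with
  | empty => intro φ ψ; simp [gen_empty]
  | insert u L h ih =>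
    intro φ ψ
    rw [gen_insert h, Finset.sum_powerset_insert h]
    have e : ∀ b : ℕ, gen L (fun s => ((Multiset.antidiagonal (b ::ₘ s)).map (fun q => φ q.1 * ψ q.2)).sum) =
        ∑ I ∈ L.powerset, gen I φ * gen (L \ I) (fun s => ψ (b ::ₘ s)) +
        ∑ I ∈ L.powerset, gen I (fun s => φ (b ::ₘ s)) * gen (L \ I) ψ := by
      intro b
      rw [← ih, ← ih, ← gen_add]
      congr 1; funext s
      rw [Multiset.antidiagonal_cons, Multiset.map_add, Multiset.sum_add, Multiset.map_map, Multiset.map_map]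
      rfl
    simp only [e]
    rw [Sx_add, Sx_sum, Sx_sum]
    congr 1
    · refine Finset.sum_congr rfl fun I hI => ?_
      have hI := Finset.mem_powerset.mp hI
      have hu : u ∉ I := fun h' => h (hI h')
      rw [Sx_mul_left, Finset.insert_sdiff_of_notMem _ hu, gen_insert]
      intro h'; exact h (Finset.mem_sdiff.mp h').1
    · refine Finset.sum_congr rfl fun I hI => ?_
      have hI := Finset.mem_powerset.mp hI
      have hu : u ∉ I := fun h' => h (hI h')
      rw [Sx_mul, gen_insert hu]
      congr 2
      ext z; simp only [Finset.mem_sdiff, Finset.mem_insert]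
      constructor
      · rintro ⟨h1, h2⟩; exact ⟨Or.inr h1, by rintro (rfl | h3); exact h h1; exact h2 h3⟩
      · rintro ⟨h1 | h1, h2⟩
        · exact absurd (Or.inl h1) h2
        · exact ⟨h1, fun h3 => h2 (Or.inr h3)⟩

theorem gen_erase (L : Finset ℝ) : ∀ ψ : ℕ → Multiset ℕ → ℝ,
    gen L (fun s => (s.map (fun b => ψ b (s.erase b))).sum) = ∑ u ∈ L, Sx u (fun b => gen (L.erase u) (ψ b)) := by
  induction L using Finset.induction_on with
  | empty => intro ψ; simp [gen_empty]
  | insert u L h ih =>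
    intro ψ
    rw [gen_insert h, Finset.sum_insert h, Finset.erase_insert h]
    have e : ∀ b : ℕ, gen L (fun s => ((b ::ₘ s).map (fun c => ψ c ((b ::ₘ s).erase c))).sum) =
        gen L (ψ b) + ∑ w ∈ L, Sx w (fun c => gen (L.erase w) (fun s => ψ c (b ::ₘ s))) := by
      intro b
      rw [← ih (fun c s => ψ c (b ::ₘ s)), ← gen_add]
      congr 1; funext s
      rw [Multiset.map_cons, Multiset.sum_cons, Multiset.erase_cons_head]
      congr 2
      refine Multiset.map_congr rfl fun c hc => ?_
      congr 1
      by_cases hcb : c = b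
      · subst hcb; rw [Multiset.erase_cons_head, Multiset.cons_erase hc]
      · rw [Multiset.erase_cons_tail]; exact fun h => hcb h.symm
    simp only [e]
    rw [Sx_add, Sx_sum]
    congr 1
    refine Finset.sum_congr rfl fun w hw => ?_
    have hwu : w ≠ u := fun h' => h (h' ▸ hw)
    rw [Sx_comm]
    congr 1; funext c
    rw [Finset.erase_insert_of_ne hwu.symm, gen_insert]
    intro h'; exact h (Finset.mem_of_mem_erase h')

theorem gen_cont {x : ℝ} (hx : x ≠ 0) (H : ℕ → ℕ → PS) (z : ℝ) (n : ℕ) :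
    Tendsto (fun y => PowerSeries.coeff n (Sx z (fun a => Sx y (H a)))) (𝓝[≠] x) (𝓝 (PowerSeries.coeff n (Sx z (fun a => Sx x (H a))))) := by
  have := (HD_Sx hx (fun b => Sx z (fun a => H a b)) n).continuousAt.tendsto.mono_left (nhdsWithin_le_nhds (s := {x}ᶜ))
  simp only [Sx_comm z]
  exact this

/-- the kernel identity -/
theorem kern {x u : ℝ} (hx : x ≠ 0) (hu : u ≠ 0) (h : x ≠ u) (e : ℕ) :
    ∑ p ∈ Finset.HasAntidiagonal.antidiagonal e, (x⁻¹)^p.1 * ((u⁻¹)^(p.2+1) * (2 * p.2 + 1)) =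
      (x*(x-u)⁻¹) * ((2*e+1) * (u⁻¹)^(e+1)) - (2*x*((x-u)⁻¹*(x-u)⁻¹)) * (u⁻¹)^e + dl x u * (x⁻¹)^e := by
  have h1 : x - u ≠ 0 := sub_ne_zero.mpr h
  induction e with
  | zero => simp [dl]; field_simp; ring
  | succ e ih =>
    rw [Finset.Nat.antidiagonal_succ, Finset.sum_cons, Finset.sum_map]
    have e1 : ∑ p ∈ Finset.HasAntidiagonal.antidiagonal e, (x⁻¹)^(p.1+1) * ((u⁻¹)^(p.2+1) * (2 * p.2 + 1)) =
       x⁻¹ * ∑ p ∈ Finset.HasAntidiagonal.antidiagonal e, (x⁻¹)^p.1 * ((u⁻¹)^(p.2+1) * (2 * p.2 + 1)) := by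
      rw [Finset.mul_sum]; refine Finset.sum_congr rfl fun p _ => ?_
      ring
    have e2 := e1.trans (by rw [ih])
    refine (congrArg _ e2).trans ?_
    simp only [dl, pow_succ]
    push_cast
    generalize (u⁻¹)^e = U
    generalize (x⁻¹)^e = V
    field_simp
    ring

theorem kern_sum {x u : ℝ} (hx : x ≠ 0) (hu : u ≠ 0) (h : x ≠ u) (H : ℕ → PS) :
    Sx x (fun a => Sx u (fun b => Kb b • H (a + b - 1))) = v * (Tm x u (Sx u H) (dSx u H) + dl x u • Sx x H) := by
  have e1 : ∀ a : ℕ, Sx u (fun b => Kb b • H (a + b - 1)) = v * Sm (fun b => ((u⁻¹)^(b+1) * (2 * b + 1)) • H (a + b)) := by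
    intro a
    rw [Sx, Sm_shift]
    simp only [Kb, if_true, zero_smul, smul_zero, zero_add, smul_smul, if_neg (Nat.succ_ne_zero _)]
    congr 2; funext b
    congr 1
    push_cast; ring
  simp only [e1]
  rw [Sx_mul_left]
  congr 1
  simp only [Tm, Sx, dSx, ← Sm_smul, ← Sm_add, ← Sm_sub]
  rw [Sm_Sm]
  congr 1; funext e
  have e2 : ∑ p ∈ Finset.HasAntidiagonal.antidiagonal e, (x⁻¹)^p.1 • ((u⁻¹)^(p.2+1) * (2 * p.2 + 1)) • H (p.1 + p.2) =
     (∑ p ∈ Finset.HasAntidiagonal.antidiagonal e, (x⁻¹)^p.1 * ((u⁻¹)^(p.2+1) * (2 * p.2 + 1))) • H e := by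
    rw [Finset.sum_smul]
    refine Finset.sum_congr rfl fun p hp => ?_
    rw [Finset.HasAntidiagonal.mem_antidiagonal.mp hp, smul_smul]
  rw [e2, kern hx hu h]
  match_scalars
  ring

variable {C : List ℕ → ℚ}
def F1 (C : List ℕ → ℚ) (x : ℝ) (L : Finset ℝ) : PS := Sx x (fun a => gen L (fun s => Hs C (a ::ₘ s)))
def dF1 (C : List ℕ → ℚ) (x : ℝ) (L : Finset ℝ) : PS := dSx x (fun a => gen L (fun s => Hs C (a ::ₘ s)))
def F2 (C : List ℕ → ℚ) (x y : ℝ) (L : Finset ℝ) : PS := Sx x (fun a => Sx y (fun b => gen L (fun s => Hs C (a ::ₘ b ::ₘ s))))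

theorem ini_gen (x : ℝ) (L : Finset ℝ) (h0 : (0:ℝ) ∉ L) : v * Sx x (fun a => gen L (inim a)) = ini x L := by
  rcases card_cases L with rfl | ⟨u, rfl⟩ | h
  · simp only [gen_empty]
    rw [ini, if_pos rfl, Sx, Sm_shift, Sm_shift]
    have e : (fun a => (x⁻¹)^(a+1+1) • PowerSeries.C (inim (a+1+1) 0)) = fun _ => (0:PS) := by
      funext a; simp [inim]
    rw [e, Sm_zero]
    have t0 : inim 0 0 = 0 := by simp [inim]
    have t1 : inim 1 0 = 1/8 := by simp [inim]
    rw [t0, zero_add, t1]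
    simp only [PowerSeries.smul_eq_C_mul, map_zero, mul_zero, zero_add, add_zero, pow_one]
    have : PowerSeries.C (8 * x)⁻¹ = PowerSeries.C x⁻¹ * PowerSeries.C (1/8:ℝ) := by
      rw [← map_mul]; congr 1; rw [mul_inv]; ring
    rw [this]; ring
  · rw [ini, if_neg (by simp), if_neg (by simp)]
    have : (fun a => gen {u} (inim a)) = fun _ => 0 := by
      funext a
      apply gen_card
      intro s hs
      rw [inim, if_neg, if_neg]
      · rintro ⟨_, rfl⟩; simp at hs
      · rintro ⟨_, rfl⟩; simp at hs
    rw [this, Sx_zero, mul_zero]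
  · rw [ini, if_neg (by rintro rfl; simp at h)]
    split_ifs with h2
    · obtain ⟨i, j, hij, rfl⟩ := Finset.card_eq_two.mp h2
      rw [Finset.prod_pair hij]
      have e : ∀ a : ℕ, gen {i, j} (inim a) = if a = 0 then (i * j)⁻¹ • (v * v) else 0 := by
        intro a
        split_ifs with ha
        · subst ha
          rw [gen_insert (by simpa using hij)]
          have ej : ({j} : Finset ℝ) = insert j ∅ := rfl
          rw [ej]
          simp only [gen_insert (Finset.notMem_empty j), gen_empty]
          have z : ∀ b c : ℕ, inim 0 (b ::ₘ c ::ₘ 0) = if b = 1 then (if c = 1 then 1 else 0) else 0 := by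
            intro b c
            rw [inim, if_neg (by simp)]
            split_ifs with h1 h2 h3 h4
            · rfl
            · exfalso; obtain ⟨_, h1⟩ := h1
              have : c ∈ ({1, 1} : Multiset ℕ) := by rw [← h1]; simp
              simp at this; exact h3 this
            · exfalso; obtain ⟨_, h1⟩ := h1
              have : b ∈ ({1, 1} : Multiset ℕ) := by rw [← h1]; simp
              simp at this; exact h2 this
            · exfalso; rename_i hc; subst h4; subst hc; exact h1 ⟨rfl, rfl⟩
            · rfl
            · rfl
          have single : ∀ (y : ℝ) (K : PS), Sx y (fun b => if b = 1 then K else 0) = y⁻¹ • (v * K) := by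
            intro y K
            rw [Sx, Sm_shift, Sm_shift]
            have e : (fun a : ℕ => (y⁻¹)^(a+1+1) • (if a + 1 + 1 = 1 then K else 0)) = fun _ => (0:PS) := by
              funext a; simp
            rw [e, Sm_zero]; simp
          have z2 : ∀ b : ℕ, Sx j (fun c => PowerSeries.C (inim 0 (b ::ₘ c ::ₘ 0))) = if b = 1 then j⁻¹ • (v * 1) else 0 := by
            intro b
            by_cases hb : b = 1
            · rw [if_pos hb, ← single]
              congr 1; funext c; rw [z, if_pos hb]; split_ifs <;> simp
            · rw [if_neg hb, ← Sx_zero j]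
              congr 1; funext c; rw [z, if_neg hb, map_zero]
          simp only [z2]
          rw [single]
          simp only [mul_smul_comm, smul_smul, mul_one]
          congr 1
          rw [mul_inv]
        · apply gen_card
          intro s hs
          rw [inim, if_neg, if_neg]
          · rintro ⟨h, _⟩; exact ha h
          · rintro ⟨_, rfl⟩; rw [h2] at hs; simp at hs
      simp only [e]
      rw [Sx, Sm_shift]
      simp only [if_true, pow_zero, one_smul, Nat.succ_ne_zero, if_false, smul_zero, Sm_zero, mul_zero, add_zero]
      rw [mul_smul_comm, mul_assoc]
    · have : (fun a => gen L (inim a)) = fun _ => 0 := by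
        funext a
        apply gen_card
        intro s hs
        rw [inim, if_neg, if_neg]
        · rintro ⟨_, rfl⟩; rw [← hs] at h2; simp at h2
        · rintro ⟨_, rfl⟩; rw [← hs] at h; simp at h
      rw [this, Sx_zero, mul_zero]

theorem loop_F (hC : IsNormalizedWitten C) {x : ℝ} {L : Finset ℝ} (hx0 : x ≠ 0) (hx : x ∉ L) (h0 : (0:ℝ) ∉ L) :
    x • F1 C x L = loopR x L (F1 C) (dF1 C) (F2 C x x L) := by
  have hz : gen L (fun s => Hs C (0 ::ₘ s)) = 0 := by
    have : (fun s => Hs C (0 ::ₘ s)) = fun _ => 0 := by funext s; exact Hs_zero (by simp)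
    rw [this, gen_zero]
  rw [F1, Sx_shift hx0 hz]
  have e : ∀ a : ℕ, gen L (fun s => Hs C ((a + 1) ::ₘ s)) = gen L (inim a) +
      ∑ u ∈ L, Sx u (fun b => Kb b • gen (L.erase u) (fun s => Hs C ((a + b - 1) ::ₘ s))) +
      (1/2:ℝ) • ((∑ p ∈ Finset.HasAntidiagonal.antidiagonal a, gen L (fun s => Hs C (p.1 ::ₘ p.2 ::ₘ s))) +
        ∑ I ∈ L.powerset, ∑ p ∈ Finset.HasAntidiagonal.antidiagonal a, gen I (fun s => Hs C (p.1 ::ₘ s)) * gen (L \ I) (fun s => Hs C (p.2 ::ₘ s))) := by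
    intro a
    simp only [Hs_dvv hC a, gen_add, gen_smul]
    rw [gen_erase L (fun b s => Kb b * Hs C ((a + b - 1) ::ₘ s))]
    simp only [gen_smul, gen_sum, gen_add]
    rw [Finset.sum_add_distrib, Finset.sum_comm (s := L.powerset)]
    congr 3
    refine Finset.sum_congr rfl fun p _ => ?_
    exact gen_prod L (fun s => Hs C (p.1 ::ₘ s)) (fun s => Hs C (p.2 ::ₘ s))
  simp only [e]
  simp only [Sx_add, Sx_smul, Sx_sum]
  rw [mul_add, mul_add, ini_gen x L h0, loopR, F2, Sx_Sx]
  congr 1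
  · congr 1
    rw [mul_assoc]
    congr 1
    rw [Finset.mul_sum]
    refine Finset.sum_congr rfl fun u hu => ?_
    have hu0 : u ≠ 0 := fun h => h0 (h ▸ hu)
    have hxu : x ≠ u := fun h => hx (h ▸ hu)
    rw [kern_sum hx0 hu0 hxu (fun e => gen (L.erase u) (fun s => Hs C (e ::ₘ s)))]
    rfl
  · rw [mul_smul_comm]
    congr 3
    refine Finset.sum_congr rfl fun I _ => ?_
    rw [F1, F1, Sx_mul_Sx]

theorem F_eq_W (hC : IsNormalizedWitten C) : ∀ x L, x ≠ 0 → x ∉ L → (0:ℝ) ∉ L → F1 C x L = Wf x L := by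
  refine uniq (dF := dF1 C) (F2 := F2 C) ?_ ?_ ?_ ?_
  · intro x L hx; exact HD_Sx hx _
  · intro x y L hy
    rw [F2, F1]
    simp only [gen_insert hy]
  · intro x L n hx
    exact gen_cont hx _ _ _
  · intro x L hx0 hx h0
    exact loop_F hC hx0 hx h0

end

section
open MvPolynomial Classical
variable {m : ℕ}

abbrev Vv (m : ℕ) := Fin (m+2) → ℤ
abbrev Fn (m : ℕ) := Vv m → ℝ
abbrev MP (m : ℕ) := MvPolynomial (Fin (m+2)) ℝ

def shf (s : Fin (m+2) →₀ ℕ) : Module.End ℝ (Fn m) where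
  toFun h := fun u => h (fun i => u i + s i)
  map_add' _ _ := rfl
  map_smul' _ _ := rfl

def shfHom : Multiplicative (Fin (m+2) →₀ ℕ) →* Module.End ℝ (Fn m) where
  toFun s := shf s.toAdd
  map_one' := by
    ext h u; simp [shf]
  map_mul' s t := by
    refine LinearMap.ext fun h => funext fun u => ?_
    show h _ = h _
    congr 1; funext i
    show u i + (((s.toAdd + t.toAdd : Fin (m+2) →₀ ℕ) i : ℕ) : ℤ) = u i + s.toAdd i + t.toAdd i
    rw [Finsupp.add_apply]; push_cast; ring

/-- action of polynomials on functions by shifts -/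
def ac : MP m →ₐ[ℝ] Module.End ℝ (Fn m) := AddMonoidAlgebra.lift ℝ _ _ shfHom

theorem ac_monomial (s : Fin (m+2) →₀ ℕ) (c : ℝ) (h : Fn m) (u : Vv m) :
    ac (monomial s c) h u = c * h (fun i => u i + s i) := by
  have : ac (monomial s c) = c • shf s := by
    exact AddMonoidAlgebra.lift_single _ _ _
  rw [this]; rfl

theorem ac_X (i : Fin (m+2)) (h : Fn m) (u : Vv m) : ac (X i) h u = h (u + Pi.single i 1) := by
  rw [X, ac_monomial, one_mul]
  congr 1; funext j
  simp [Finsupp.single_apply, Pi.single_apply, eq_comm]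

/-- support in a half space -/
def ell (u : Vv m) : ℤ := ∑ i, (i.val : ℤ) * u i
def HSp (c : ℤ) (h : Fn m) : Prop := ∀ u, c < ell u → h u = 0

theorem HSp_ac {c : ℤ} {h : Fn m} (hh : HSp c h) (p : MP m) : HSp c (ac p h) := by
  induction p using MvPolynomial.induction_on' with
  | monomial s a =>
    intro u hu
    rw [ac_monomial, hh, mul_zero]
    refine lt_of_lt_of_le hu ?_
    unfold ell
    refine Finset.sum_le_sum fun i _ => ?_
    have : (0:ℤ) ≤ i.val * s i := by positivity
    linarith
  | add p q hp hq =>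
    intro u hu
    rw [map_add, LinearMap.add_apply, Pi.add_apply, hp u hu, hq u hu, add_zero]

theorem HSp_zero {c : ℤ} {h : Fn m} (hh : HSp c h) {i j : Fin (m+2)} (hij : i ≠ j)
    (h0 : ac (X i - X j) h = 0) : h = 0 := by
  have e : ∀ u : Vv m, h (u + Pi.single i 1) = h (u + Pi.single j 1) := by
    intro u
    have := congrFun h0 u
    rw [map_sub, LinearMap.sub_apply, Pi.sub_apply, ac_X, ac_X, Pi.zero_apply] at this
    linarith
  clear h0
  wlog hlt : i < j generalizing i j
  · exact this hij.symm (fun u => (e u).symm) (lt_of_le_of_ne (not_lt.mp hlt) hij.symm)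
  have e2 : ∀ (s : ℕ) (u : Vv m), h u = h (u + (s:ℤ) • (Pi.single j 1 - Pi.single i 1)) := by
    intro s
    induction s with
    | zero => intro u; simp
    | succ s ih =>
      intro u
      rw [ih u]
      have := e (u + (s:ℤ) • (Pi.single j 1 - Pi.single i 1) - Pi.single i 1)
      rw [sub_add_cancel] at this
      rw [this]; congr 1
      push_cast; rw [add_smul, one_smul]; abel
  funext u
  rw [e2 (c - ell u + 1).toNat u]
  apply hh
  have : ∀ s : ℤ, ell (u + s • (Pi.single j 1 - Pi.single i 1)) = ell u + s * (j.val - i.val) := by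
    intro s
    unfold ell
    have : ∀ k : Fin (m+2), (k.val : ℤ) * (u + s • (Pi.single j 1 - Pi.single i 1) : Vv m) k =
        k.val * u k + s * (k.val * (Pi.single j 1 : Vv m) k) - s * (k.val * (Pi.single i 1 : Vv m) k) := by
      intro k; simp only [Pi.add_apply, Pi.smul_apply, Pi.sub_apply, smul_eq_mul]; ring
    simp only [this]
    rw [Finset.sum_sub_distrib, Finset.sum_add_distrib, ← Finset.mul_sum, ← Finset.mul_sum]
    simp [Pi.single_apply]; ring
  rw [this]
  have h1 : (1:ℤ) ≤ (j.val : ℤ) - i.val := by have : i.val < j.val := hlt; omega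
  have h2 : c - ell u + 1 ≤ ((c - ell u + 1).toNat : ℤ) := Int.self_le_toNat _
  nlinarith

theorem HSp_prod {c : ℤ} (S : Finset (Fin (m+2) × Fin (m+2))) (hS : ∀ p ∈ S, p.1 ≠ p.2) :
    ∀ {h : Fn m}, HSp c h → ac (∏ p ∈ S, (X p.1 - X p.2)) h = 0 → h = 0 := by
  induction S using Finset.induction_on with
  | empty => intro h _ h0; simpa using h0
  | insert p S hp ih =>
    intro h hh h0
    rw [Finset.prod_insert hp, map_mul, Module.End.mul_apply] at h0
    exact ih (fun q hq => hS q (Finset.mem_insert_of_mem hq)) hh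
      (HSp_zero (HSp_ac hh _) (hS p (Finset.mem_insert_self _ _)) h0)

/-! kernels -/
def Cd (σ : Equiv.Perm (Fin (m+2))) (u p : Vv m) : Prop := ∀ r, p r - p (r - 1) = u (σ r) - 1
def Kt (σ : Equiv.Perm (Fin (m+2))) (ε : Fin (m+2) → ℤ → ℝ) (u p : Vv m) : ℝ :=
  if Cd σ u p then ∏ r, ε r (p r) else 0
def Kf (σ : Equiv.Perm (Fin (m+2))) (ε : Fin (m+2) → ℤ → ℝ) : Fn m := fun u => ∑ᶠ p : Vv m, Kt σ ε u p

def Gd (ε : Fin (m+2) → ℤ → ℝ) : Prop := (∃ r B, ∀ z : ℤ, z < B → ε r z = 0) ∧ (∃ r B, ∀ z : ℤ, B < z → ε r z = 0)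

theorem cyc_const {q : Vv m} (h : ∀ r, q r = q (r - 1)) (r : Fin (m+2)) : q r = q 0 := by
  induction r using Fin.induction with
  | zero => rfl
  | succ i ih =>
    rw [h, ← ih]; congr 1
    rw [sub_eq_iff_eq_add, Fin.coeSucc_eq_succ]

theorem Cd_diff {σ : Equiv.Perm (Fin (m+2))} {u p p' : Vv m} (h : Cd σ u p) (h' : Cd σ u p') :
    ∃ t : ℤ, ∀ r, p' r = p r + t := by
  refine ⟨p' 0 - p 0, fun r => ?_⟩
  have := cyc_const (q := fun r => p' r - p r) (fun r => by have := h r; have := h' r; linarith) r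
  linarith

theorem Cd_shift {σ : Equiv.Perm (Fin (m+2))} {u p : Vv m} (h : Cd σ u p) (t : ℤ) : Cd σ u (fun r => p r + t) := by
  intro r; have := h r; linarith

theorem Kt_fin (σ : Equiv.Perm (Fin (m+2))) {ε : Fin (m+2) → ℤ → ℝ} (hε : Gd ε) (u : Vv m) :
    (Function.support (Kt σ ε u)).Finite := by
  obtain ⟨⟨r1, B1, h1⟩, ⟨r2, B2, h2⟩⟩ := hε
  by_cases hex : ∃ p, Cd σ u p
  · obtain ⟨p, hp⟩ := hex
    refine ((Set.finite_Icc (B1 - p r1) (B2 - p r2)).image (fun t : ℤ => (fun r => p r + t : Vv m))).subset ?_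
    intro p' hp'
    rw [Function.mem_support, Kt] at hp'
    split_ifs at hp' with hc
    · obtain ⟨t, ht⟩ := Cd_diff hp hc
      have hne := Finset.prod_ne_zero_iff.mp hp'
      refine ⟨t, ⟨?_, ?_⟩, funext fun r => (ht r).symm⟩
      · have a := hne r1 (Finset.mem_univ _)
        by_contra hlt
        exact a (h1 _ (by rw [ht]; omega))
      · have a := hne r2 (Finset.mem_univ _)
        by_contra hlt
        exact a (h2 _ (by rw [ht]; omega))
    · exact absurd rfl hp'
  · convert Set.finite_empty
    rw [Function.support_eq_empty_iff]
    funext p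
    rw [Kt, if_neg (fun h => hex ⟨p, h⟩)]; rfl

/-- difference operator in slot `r` -/
def nab (r : Fin (m+2)) (ε : Fin (m+2) → ℤ → ℝ) : Fin (m+2) → ℤ → ℝ :=
  Function.update ε r (fun z => ε r z - ε r (z - 1))

theorem Gd_nab {ε : Fin (m+2) → ℤ → ℝ} (hε : Gd ε) (r : Fin (m+2)) : Gd (nab r ε) := by
  obtain ⟨⟨r1, B1, h1⟩, ⟨r2, B2, h2⟩⟩ := hε
  refine ⟨⟨r1, B1, fun z hz => ?_⟩, ⟨r2, B2 + 1, fun z hz => ?_⟩⟩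
  · unfold nab
    by_cases h : r1 = r
    · subst h; rw [Function.update_self, h1 _ hz, h1 _ (by omega), sub_zero]
    · rw [Function.update_of_ne h, h1 _ hz]
  · unfold nab
    by_cases h : r2 = r
    · subst h; rw [Function.update_self, h2 _ (by omega), h2 _ (by omega), sub_zero]
    · rw [Function.update_of_ne h, h2 _ (by omega)]

theorem fin_ne (r : Fin (m+2)) : r + 1 ≠ r := by
  intro h
  have : (1 : Fin (m+2)) = 0 := by simpa using h
  exact absurd this (by simp)

theorem Kf_step (σ : Equiv.Perm (Fin (m+2))) {ε : Fin (m+2) → ℤ → ℝ} (hε : Gd ε) (r : Fin (m+2)) :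
    ac (X (σ r) - X (σ (r+1))) (Kf σ ε) = ac (X (σ r)) (Kf σ (nab r ε)) := by
  funext u
  rw [map_sub, LinearMap.sub_apply, Pi.sub_apply, ac_X, ac_X, ac_X]
  have e2 : Kf σ ε (u + Pi.single (σ (r+1)) 1) =
      ∑ᶠ p : Vv m, Kt σ ε (u + Pi.single (σ (r+1)) 1) (p - Pi.single r 1) := by
    exact (finsum_comp_equiv (Equiv.subRight (Pi.single r 1 : Vv m))).symm
  rw [e2]
  have hf : (Function.support (fun p : Vv m => Kt σ ε (u + Pi.single (σ (r+1)) 1) (p - Pi.single r 1))).Finite := by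
    have := (Kt_fin σ hε (u + Pi.single (σ (r+1)) 1)).preimage (f := fun p : Vv m => p - Pi.single r 1)
      (fun _ _ _ _ h => sub_left_injective h)
    exact this
  unfold Kf
  rw [← finsum_sub_distrib (Kt_fin σ hε _) hf]
  refine finsum_congr fun p => ?_
  have hc : Cd σ (u + Pi.single (σ (r+1)) 1) (p - Pi.single r 1) ↔ Cd σ (u + Pi.single (σ r) 1) p := by
    refine forall_congr' fun q => ?_
    simp only [Pi.add_apply, Pi.sub_apply, Pi.single_apply, EmbeddingLike.apply_eq_iff_eq]
    have h3 : q - 1 = r ↔ q = r + 1 := sub_eq_iff_eq_add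
    by_cases hq : q = r
    · subst hq
      have h4 : ¬ (q = q + 1) := fun h => fin_ne q h.symm
      have h5 : ¬ (q - 1 = q) := fun h => h4 (h3.mp h)
      simp only [h4, h5, if_true, if_false]; omega
    · by_cases h4 : q = r + 1
      · have h5 := h3.mpr h4
        simp only [hq, h4, h5, if_true, if_false]
        simp only [h4, h5, fin_ne r, if_true, if_false] at *
        simp; omega
      · have h5 : ¬ (q - 1 = r) := fun h => h4 (h3.mp h)
        simp only [hq, h4, h5, if_false]; omega
  unfold Kt
  by_cases h : Cd σ (u + Pi.single (σ r) 1) p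
  · rw [if_pos h, if_pos (hc.mpr h), if_pos h]
    rw [← Finset.mul_prod_erase _ _ (Finset.mem_univ r), ← Finset.mul_prod_erase _ _ (Finset.mem_univ r),
      ← Finset.mul_prod_erase _ (fun x => nab r ε x (p x)) (Finset.mem_univ r)]
    have a1 : ∏ x ∈ Finset.univ.erase r, ε x ((p - Pi.single r 1 : Vv m) x) = ∏ x ∈ Finset.univ.erase r, ε x (p x) := by
      refine Finset.prod_congr rfl fun x hx => ?_
      rw [Pi.sub_apply, Pi.single_eq_of_ne (Finset.ne_of_mem_erase hx), sub_zero]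
    have a2 : ∏ x ∈ Finset.univ.erase r, nab r ε x (p x) = ∏ x ∈ Finset.univ.erase r, ε x (p x) := by
      refine Finset.prod_congr rfl fun x hx => ?_
      rw [nab, Function.update_of_ne (Finset.ne_of_mem_erase hx)]
    rw [a1, a2, nab, Function.update_self, Pi.sub_apply, Pi.single_eq_same]
    ring
  · rw [if_neg h, if_neg (fun h' => h (hc.mp h')), if_neg h, sub_zero]

theorem Kf_prod (σ : Equiv.Perm (Fin (m+2))) (R : Finset (Fin (m+2))) : ∀ {ε : Fin (m+2) → ℤ → ℝ}, Gd ε →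
    ac (∏ r ∈ R, (X (σ r) - X (σ (r+1)))) (Kf σ ε) = ac (∏ r ∈ R, X (σ r))
      (Kf σ (fun r => if r ∈ R then (fun z => ε r z - ε r (z - 1)) else ε r)) := by
  induction R using Finset.induction_on with
  | empty => intro ε _; simp
  | insert r R hr ih =>
    intro ε hε
    rw [Finset.prod_insert hr, mul_comm, map_mul, Module.End.mul_apply, Kf_step σ hε, ← Module.End.mul_apply,
      ← map_mul, mul_comm, map_mul, Module.End.mul_apply, ih (Gd_nab hε r), ← Module.End.mul_apply, ← map_mul,
      Finset.prod_insert hr]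
    congr 2
    funext q
    by_cases hq : q = r
    · subst hq
      rw [if_neg hr, if_pos (Finset.mem_insert_self _ _), nab, Function.update_self]
    · rw [nab, Function.update_of_ne hq]
      simp only [Finset.mem_insert, hq, false_or]

def eps (σ : Equiv.Perm (Fin (m+2))) (r : Fin (m+2)) (z : ℤ) : ℝ :=
  if σ r < σ (r+1) then (if 0 ≤ z then 1 else 0) else (if z < 0 then -1 else 0)

def Ks (σ : Equiv.Perm (Fin (m+2))) : Fn m := Kf σ (eps σ)

def dlt : Fn m := fun u => if u = 0 then 1 else 0
def denp (σ : Equiv.Perm (Fin (m+2))) : MP m := ∏ r, (X (σ r) - X (σ (r+1)))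

theorem last_add : Fin.last (m+1) + 1 = 0 := by simp
theorem eps_last {σ : Equiv.Perm (Fin (m+2))} (hσ : σ (Fin.last (m+1)) = Fin.last (m+1)) :
    σ (Fin.last (m+1) + 1) < σ (Fin.last (m+1)) := by
  rw [hσ]
  refine lt_of_le_of_ne (Fin.le_last _) fun h => fin_ne (Fin.last (m+1)) (σ.injective (h.trans hσ.symm))
theorem eps_prev {σ : Equiv.Perm (Fin (m+2))} (hσ : σ (Fin.last (m+1)) = Fin.last (m+1)) :
    σ (Fin.last (m+1) - 1) < σ (Fin.last (m+1) - 1 + 1) := by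
  rw [sub_add_cancel, hσ]
  refine lt_of_le_of_ne (Fin.le_last _) fun h => ?_
  have := σ.injective (h.trans hσ.symm)
  exact fin_ne (Fin.last (m+1) - 1) (by rw [sub_add_cancel, this])

theorem Gd_eps {σ : Equiv.Perm (Fin (m+2))} (hσ : σ (Fin.last (m+1)) = Fin.last (m+1)) : Gd (eps σ) := by
  refine ⟨⟨Fin.last (m+1) - 1, 0, fun z hz => ?_⟩, ⟨Fin.last (m+1), 0, fun z hz => ?_⟩⟩
  · rw [eps, if_pos (eps_prev hσ), if_neg (by omega)]
  · rw [eps, if_neg (eps_last hσ).not_gt, if_neg (by omega)]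

theorem den_Ks {σ : Equiv.Perm (Fin (m+2))} (hσ : σ (Fin.last (m+1)) = Fin.last (m+1)) :
    ac (denp σ) (Ks σ) = dlt := by
  rw [denp, Ks, Kf_prod σ _ (Gd_eps hσ)]
  have e : (fun r => if r ∈ Finset.univ then (fun z => eps σ r z - eps σ r (z - 1)) else eps σ r) =
      fun (_ : Fin (m+2)) (z : ℤ) => if z = 0 then (1:ℝ) else 0 := by
    funext r z
    rw [if_pos (Finset.mem_univ _)]
    simp only [eps]
    split_ifs <;> first | omega | norm_num
  rw [e]
  have e2 : ∏ r, (X (σ r) : MP m) = monomial (Finsupp.equivFunOnFinite.symm fun _ => 1) 1 := by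
    rw [Equiv.prod_comp σ (fun i => (X i : MP m)), monomial_eq]
    simp [Finsupp.prod_fintype]
  rw [e2]
  funext u
  rw [ac_monomial, one_mul, Kf, finsum_eq_single _ 0]
  · rw [Kt, dlt]
    simp only [Pi.zero_apply, if_true, Finset.prod_const_one]
    congr 1
    rw [Cd, eq_iff_iff]
    constructor
    · intro h; funext i
      have := h (σ.symm i); simp at this; exact this.symm
    · rintro rfl r; simp
  · intro p hp
    rw [Kt]
    split_ifs
    · obtain ⟨r, hr⟩ := Function.ne_iff.mp hp
      exact Finset.prod_eq_zero (Finset.mem_univ r) (if_neg hr)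
    · rfl

theorem Cd_ell {σ : Equiv.Perm (Fin (m+2))} {u p : Vv m} (h : Cd σ u p) (hp : ∏ r, eps σ r (p r) ≠ 0) :
    ell u ≤ ∑ i : Fin (m+2), (i.val : ℤ) := by
  have h1 : ∑ r, ((σ r).val : ℤ) * (p r - p (r - 1)) = ell u - ∑ i : Fin (m+2), (i.val : ℤ) := by
    simp only [h _]
    rw [Equiv.sum_comp σ (fun i => (i.val : ℤ) * (u i - 1)), ell, ← Finset.sum_sub_distrib]
    refine Finset.sum_congr rfl fun i _ => by ring
  have h2 : ∑ r, ((σ r).val : ℤ) * p (r - 1) = ∑ r, ((σ (r+1)).val : ℤ) * p r := by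
    rw [← Equiv.sum_comp (Equiv.subRight (1 : Fin (m+2))) (fun r => ((σ (r+1)).val : ℤ) * p r)]
    simp
  have h3 : ∑ r, ((σ r).val : ℤ) * (p r - p (r - 1)) = ∑ r, (((σ r).val : ℤ) - (σ (r+1)).val) * p r := by
    simp only [mul_sub, sub_mul, Finset.sum_sub_distrib]; rw [h2]
  have h4 : ∑ r, (((σ r).val : ℤ) - (σ (r+1)).val) * p r ≤ 0 := by
    refine Finset.sum_nonpos fun r _ => ?_
    have := Finset.prod_ne_zero_iff.mp hp r (Finset.mem_univ r)
    rw [eps] at this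
    split_ifs at this with a b b
    · have : (σ r).val < (σ (r+1)).val := a
      nlinarith
    · exact absurd rfl this
    · have : (σ (r+1)).val ≤ (σ r).val := not_lt.mp a
      nlinarith
    · exact absurd rfl this
  linarith

theorem HSp_Ks (σ : Equiv.Perm (Fin (m+2))) : HSp (∑ i : Fin (m+2), (i.val : ℤ)) (Ks σ) := by
  intro u hu
  rw [Ks, Kf]
  apply finsum_eq_zero_of_forall_eq_zero
  intro p
  rw [Kt]
  split_ifs with hc
  · by_contra hp
    exact absurd (Cd_ell hc hp) (not_le.mpr hu)
  · rfl

theorem HSp_dlt : HSp (∑ i : Fin (m+2), (i.val : ℤ)) (dlt : Fn m) := by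
  intro u hu
  rw [dlt, if_neg]
  rintro rfl
  have h0 : ell (0 : Vv m) = 0 := by simp [ell]
  rw [h0] at hu
  exact absurd hu (not_lt.mpr (by positivity))

/-- coefficient extraction -/
theorem extract (S : Finset (Equiv.Perm (Fin (m+2)))) (hS : ∀ σ ∈ S, σ (Fin.last (m+1)) = Fin.last (m+1))
    (f : MP m) (P cmp : Equiv.Perm (Fin (m+2)) → MP m) (hcmp : ∀ σ ∈ S, denp σ * cmp σ = ∏ p ∈ Finset.univ.offDiag, (X p.1 - X p.2))
    (hf : (∏ p ∈ Finset.univ.offDiag, (X p.1 - X p.2)) * f + ∑ σ ∈ S, P σ * cmp σ = 0) :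
    ac f dlt + ∑ σ ∈ S, ac (P σ) (Ks σ) = 0 := by
  refine HSp_prod (c := ∑ i : Fin (m+2), (i.val : ℤ)) Finset.univ.offDiag (fun p hp => (Finset.mem_offDiag.mp hp).2.2) ?_ ?_
  · intro u hu
    rw [Pi.add_apply, HSp_ac HSp_dlt f u hu, Finset.sum_apply, zero_add]
    exact Finset.sum_eq_zero fun σ _ => HSp_ac (HSp_Ks σ) _ u hu
  · rw [map_add, map_sum, ← Module.End.mul_apply, ← map_mul]
    have : ∀ σ ∈ S, ac (∏ p ∈ Finset.univ.offDiag, (X p.1 - X p.2)) (ac (P σ) (Ks σ)) = ac (P σ * cmp σ) dlt := by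
      intro σ hσ
      rw [← Module.End.mul_apply, ← map_mul, ← hcmp σ hσ, ← den_Ks (hS σ hσ), ← Module.End.mul_apply, ← map_mul]
      congr 2; ring
    rw [Finset.sum_congr rfl this, ← LinearMap.sum_apply, ← map_sum, ← LinearMap.add_apply, ← map_add, hf, map_zero]
    rfl
end

section
open MvPolynomial
variable {m : ℕ}

def Ssum (σ : Equiv.Perm (Fin (m+2))) (u : Vv m) : Vv m :=
  fun r => ∑ q ∈ Finset.univ.filter (fun q : Fin (m+2) => q ≤ r), (u (σ q) - 1)

theorem Cd_Ssum {σ : Equiv.Perm (Fin (m+2))} {u : Vv m} (h0 : ∑ r, (u (σ r) - 1) = 0) : Cd σ u (Ssum σ u) := by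
  intro r
  induction r using Fin.cases with
  | zero =>
    have e : (0 : Fin (m+2)) - 1 = Fin.last (m+1) := by rw [sub_eq_iff_eq_add, last_add]
    rw [e]
    have a : Ssum σ u (Fin.last (m+1)) = 0 := by
      rw [← h0, Ssum]; congr 1
      ext q; simp [Fin.le_last]
    have b : Ssum σ u 0 = u (σ 0) - 1 := by
      rw [Ssum]
      have : Finset.univ.filter (fun q : Fin (m+2) => q ≤ 0) = {0} := by
        ext q; simp
      rw [this, Finset.sum_singleton]
    rw [a, b, sub_zero]
  | succ i =>
    have e : i.succ - 1 = i.castSucc := by rw [sub_eq_iff_eq_add, Fin.coeSucc_eq_succ]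
    rw [e, Ssum]
    have : Finset.univ.filter (fun q : Fin (m+2) => q ≤ i.succ) =
        insert i.succ (Finset.univ.filter (fun q : Fin (m+2) => q ≤ i.castSucc)) := by
      ext q
      simp only [Finset.mem_filter, Finset.mem_univ, true_and, Finset.mem_insert, Fin.le_def, Fin.ext_iff,
        Fin.val_succ, Fin.val_castSucc]
      omega
    rw [this, Finset.sum_insert]
    · rw [Ssum, add_sub_cancel_right]
    · simp [Fin.le_def]

theorem eps_prod {σ : Equiv.Perm (Fin (m+2))} {p : Vv m} (ha : ∀ r, σ r < σ (r+1) → 0 ≤ p r)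
    (hd : ∀ r, σ (r+1) < σ r → p r < 0) : ∏ r, eps σ r (p r) =
      (-1 : ℝ) ^ ((Finset.univ.filter (fun r : Fin (m + 2) => σ (r + 1) < σ r)).card) := by
  have : ∀ r, eps σ r (p r) = if σ (r+1) < σ r then -1 else 1 := by
    intro r
    rw [eps]
    rcases lt_trichotomy (σ r) (σ (r+1)) with h | h | h
    · rw [if_pos h, if_pos (ha r h), if_neg h.not_gt]
    · exact absurd (σ.injective h).symm (fin_ne r)
    · rw [if_neg h.not_gt, if_pos (hd r h), if_pos h]
  simp only [this]
  rw [Finset.prod_ite, Finset.prod_const, Finset.prod_const_one, mul_one]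

theorem Ks_eq {σ : Equiv.Perm (Fin (m+2))} (hσ : σ (Fin.last (m+1)) = Fin.last (m+1)) {u : Vv m}
    (h0 : ∑ r, (u (σ r) - 1) = 0) : Ks σ u =
      (-1 : ℝ) ^ ((Finset.univ.filter (fun r : Fin (m + 2) => σ (r + 1) < σ r)).card) *
      max 0 (sInf {x : ℝ | ∃ r, σ r < σ (r+1) ∧ x = ((Ssum σ u r : ℤ) : ℝ)} +
        sInf {x : ℝ | ∃ r, σ (r+1) < σ r ∧ x = -((Ssum σ u r : ℤ) : ℝ)}) := by
  set S := Ssum σ u with hS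
  obtain ⟨r1, h1, h1'⟩ := Finset.exists_min_image (Finset.univ.filter (fun r => σ r < σ (r+1))) S
    ⟨_, Finset.mem_filter.mpr ⟨Finset.mem_univ _, eps_prev hσ⟩⟩
  obtain ⟨r2, h2, h2'⟩ := Finset.exists_max_image (Finset.univ.filter (fun r => σ (r+1) < σ r)) S
    ⟨_, Finset.mem_filter.mpr ⟨Finset.mem_univ _, eps_last hσ⟩⟩
  simp only [Finset.mem_filter, Finset.mem_univ, true_and] at h1 h1' h2 h2'
  have i1 : sInf {x : ℝ | ∃ r, σ r < σ (r+1) ∧ x = ((S r : ℤ) : ℝ)} = S r1 := by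
    apply IsLeast.csInf_eq
    refine ⟨⟨r1, h1, rfl⟩, ?_⟩
    rintro x ⟨r, hr, rfl⟩
    exact_mod_cast h1' r hr
  have i2 : sInf {x : ℝ | ∃ r, σ (r+1) < σ r ∧ x = -((S r : ℤ) : ℝ)} = -(S r2 : ℝ) := by
    apply IsLeast.csInf_eq
    refine ⟨⟨r2, h2, rfl⟩, ?_⟩
    rintro x ⟨r, hr, rfl⟩
    exact neg_le_neg (by exact_mod_cast h2' r hr)
  rw [i1, i2]
  have hc := Cd_Ssum h0
  rw [← hS] at hc
  have inj : Function.Injective (fun t : ℤ => (fun r => S r + t : Vv m)) := fun a b h => by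
    have := congrFun h 0; simpa using this
  have hsup : Function.support (Kt σ (eps σ) u) ⊆ ((Finset.Ico (-S r1) (-S r2)).map ⟨_, inj⟩ : Finset (Vv m)) := by
    intro p hp
    rw [Function.mem_support, Kt] at hp
    split_ifs at hp with hcp
    · obtain ⟨t, ht⟩ := Cd_diff hc hcp
      have hne := Finset.prod_ne_zero_iff.mp hp
      rw [Finset.mem_coe, Finset.mem_map]
      refine ⟨t, Finset.mem_Ico.mpr ⟨?_, ?_⟩, funext fun r => (ht r).symm⟩
      · have := hne r1 (Finset.mem_univ _)
        rw [eps, if_pos h1, ht] at this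
        by_contra hlt
        exact this (if_neg (by omega))
      · have := hne r2 (Finset.mem_univ _)
        rw [eps, if_neg h2.not_gt, ht] at this
        by_contra hlt
        exact this (if_neg (by omega))
    · exact absurd rfl hp
  rw [Ks, Kf, finsum_eq_sum_of_support_subset _ hsup, Finset.sum_map]
  have : ∀ t ∈ Finset.Ico (-S r1) (-S r2), Kt σ (eps σ) u (fun r => S r + t) =
      (-1 : ℝ) ^ ((Finset.univ.filter (fun r : Fin (m + 2) => σ (r + 1) < σ r)).card) := by
    intro t ht
    rw [Finset.mem_Ico] at ht
    rw [Kt, if_pos (Cd_shift hc t)]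
    apply eps_prod
    · intro r hr; have := h1' r hr; omega
    · intro r hr; have := h2' r hr; omega
  rw [show (∑ x ∈ Finset.Ico (-S r1) (-S r2), Kt σ (eps σ) u ((⟨_, inj⟩ : ℤ ↪ Vv m) x)) = _ from Finset.sum_congr rfl this,
    Finset.sum_const, Int.card_Ico, nsmul_eq_mul, mul_comm]
  congr 1
  have : (((-S r2 - -S r1).toNat : ℤ) : ℝ) = max 0 ((S r1 : ℝ) + -(S r2:ℝ)) := by
    rw [Int.toNat_eq_max, max_comm]
    push_cast
    congr 1; ring
  exact_mod_cast this
end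

section
variable {m : ℕ}

theorem sum_tuple_succ {B : Type*} [AddCommMonoid B] (k w : ℕ) (f : (Fin (k+1) → ℕ) → B) :
    ∑ e ∈ Finset.Nat.antidiagonalTuple (k+1) w, f e =
      ∑ p ∈ Finset.HasAntidiagonal.antidiagonal w, ∑ e ∈ Finset.Nat.antidiagonalTuple k p.2, f (Fin.cons p.1 e) := by
  rw [Finset.sum_sigma']
  refine (Finset.sum_bij' (i := fun q _ => (Fin.cons q.1.1 q.2 : Fin (k+1) → ℕ))
    (j := fun e _ => ⟨(e 0, ∑ i, Fin.tail e i), Fin.tail e⟩) ?_ ?_ ?_ ?_ ?_).symm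
  · rintro ⟨⟨a, b⟩, e⟩ h
    simp only [Finset.mem_sigma, Finset.HasAntidiagonal.mem_antidiagonal, Finset.Nat.mem_antidiagonalTuple] at h ⊢
    rw [Fin.sum_univ_succ]
    simp only [Fin.cons_zero, Fin.cons_succ]; rw [h.2]; exact h.1
  · intro e h
    simp only [Finset.mem_sigma, Finset.HasAntidiagonal.mem_antidiagonal, Finset.Nat.mem_antidiagonalTuple] at h ⊢
    rw [Fin.sum_univ_succ] at h
    exact ⟨h, trivial⟩
  · rintro ⟨⟨a, b⟩, e⟩ h
    simp only [Finset.mem_sigma, Finset.HasAntidiagonal.mem_antidiagonal, Finset.Nat.mem_antidiagonalTuple] at h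
    obtain ⟨h1, h2⟩ := h
    subst h2
    simp
  · intro e h; exact Fin.cons_self_tail e
  · rintro ⟨⟨a, b⟩, e⟩ h; rfl

theorem coeff_genl : ∀ (k : ℕ) (x : Fin k → ℝ) (φ : Multiset ℕ → ℝ) (w : ℕ),
    PowerSeries.coeff w (genl (List.ofFn x) φ) =
      ∑ e ∈ Finset.Nat.antidiagonalTuple k w, φ (List.ofFn e : Multiset ℕ) * ∏ i, ((x i)⁻¹)^(e i) := by
  intro k
  induction k with
  | zero =>
    intro x φ w
    rw [List.ofFn_zero, genl, PowerSeries.coeff_C]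
    rcases w with _ | w
    · simp
    · simp
  | succ k ih =>
    intro x φ w
    rw [List.ofFn_succ, genl, Sx, coeff_Sm, sum_tuple_succ]
    refine Finset.sum_congr rfl fun p _ => ?_
    rw [coeff_smul', ih, Finset.mul_sum]
    refine Finset.sum_congr rfl fun e _ => ?_
    rw [Fin.prod_univ_succ, List.ofFn_succ]
    simp only [Fin.cons_zero, Fin.cons_succ, Multiset.cons_coe]
    ring

theorem coeff_Mp : ∀ (k : ℕ) (x : Fin k → ℝ) (w : ℕ) (i j : Fin 2),
    PowerSeries.coeff w (Mp (List.ofFn x) i j) =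
      ∑ e ∈ Finset.Nat.antidiagonalTuple k w,
        (((List.ofFn (fun q => Amat (e q))).prod i j : ℚ) : ℝ) * ∏ q, (x q)^(1 - (e q : ℤ)) := by
  intro k
  induction k with
  | zero =>
    intro x w i j
    rw [List.ofFn_zero, Mp_nil]
    have h1 : ((1 : Mt) i j) = PowerSeries.C (((1 : Matrix (Fin 2) (Fin 2) ℚ) i j : ℚ) : ℝ) := by
      rw [Matrix.one_apply, Matrix.one_apply]; split_ifs <;> simp
    rw [h1, PowerSeries.coeff_C]
    rcases w with _ | w
    · simp
    · simp
  | succ k ih =>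
    intro x w i j
    rw [List.ofFn_succ, Mp_cons, sum_tuple_succ, Matrix.mul_apply, map_sum]
    simp only [PowerSeries.coeff_mul]
    rw [Finset.sum_comm]
    refine Finset.sum_congr rfl fun p _ => ?_
    simp only [ih, coeff_Mx, Finset.mul_sum]
    rw [Finset.sum_comm]
    refine Finset.sum_congr rfl fun e _ => ?_
    rw [Fin.prod_univ_succ, List.ofFn_succ]
    simp only [Fin.cons_zero, Fin.cons_succ, List.prod_cons, Matrix.mul_apply]
    push_cast
    rw [Finset.sum_mul]
    refine Finset.sum_congr rfl fun c _ => ?_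
    ring

theorem coeff_tr_Mp (k : ℕ) (x : Fin k → ℝ) (w : ℕ) :
    PowerSeries.coeff w (Mp (List.ofFn x)).trace =
      ∑ e ∈ Finset.Nat.antidiagonalTuple k w,
        ((Matrix.trace (List.ofFn (fun q => Amat (e q))).prod : ℚ) : ℝ) * ∏ q, (x q)^(1 - (e q : ℤ)) := by
  simp only [Matrix.trace, Fin.sum_univ_two, Matrix.diag_apply]
  rw [map_add, coeff_Mp, coeff_Mp, ← Finset.sum_add_distrib]
  refine Finset.sum_congr rfl fun e _ => ?_
  push_cast; ring

theorem ch_ofFn : ∀ (k : ℕ) (z : Fin (k+1) → ℝ), ch (List.ofFn z) = ∏ i : Fin k, (z i.castSucc - z i.succ) := by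
  intro k
  induction k with
  | zero => intro z; simp [ch]
  | succ k ih =>
    intro z
    rw [List.ofFn_succ, List.ofFn_succ, ch, ← List.ofFn_succ (f := fun i => z i.succ), ih, Fin.prod_univ_succ]
    rfl

theorem fs_ofFn (k : ℕ) (z : Fin (k+1) → ℝ) : fs (List.ofFn z) = z 0 := by rw [List.ofFn_succ]; rfl
theorem la_ofFn (k : ℕ) (z : Fin (k+1) → ℝ) : la (List.ofFn z) = z (Fin.last k) := by
  rw [List.ofFn_succ', la]; simp

theorem cw2_ofFn (y : Fin (m+2) → ℝ) : cw2 (y (Fin.last (m+1))) (y (Fin.last (m+1))) (List.ofFn fun i : Fin (m+1) => y i.castSucc) =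
    (∏ r, (y r - y (r+1)))⁻¹ := by
  rw [cw2, if_neg (by rw [List.ofFn_succ]; exact List.cons_ne_nil _ _), ch_ofFn, fs_ofFn, la_ofFn]
  congr 1
  rw [Fin.prod_univ_castSucc, Fin.prod_univ_castSucc, last_add]
  have h1 : ∀ i : Fin (m+1), i.castSucc + 1 = i.succ := fun i => Fin.coeSucc_eq_succ
  simp only [h1, Fin.castSucc_zero, Fin.succ_last]
  have h2 : ∀ i : Fin m, (i.castSucc).succ = (i.succ).castSucc := fun i => Fin.succ_castSucc i
  simp only [h2]
  ring

theorem Mp_ofFn_last (y : Fin (m+2) → ℝ) : Mp (List.ofFn y) = Mp (List.ofFn fun i : Fin (m+1) => y i.castSucc) * Mx (y (Fin.last (m+1))) := by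
  rw [List.ofFn_succ' y, List.concat_eq_append, Mp_append, Mp_single]

/-- reindexing orders by permutations -/
theorem sum_ords_perm {B : Type*} [AddCommMonoid B] {x : Fin (m+2) → ℝ} (hx : Function.Injective x) (f : List ℝ → B) :
    ∑ l ∈ ords (Finset.univ.image fun i : Fin (m+1) => x i.castSucc), f l =
      ∑ σ ∈ Finset.univ.filter (fun σ : Equiv.Perm (Fin (m + 2)) => σ (Fin.last (m + 1)) = Fin.last (m + 1)),
        f (List.ofFn fun i : Fin (m+1) => x (σ i.castSucc)) := by
  symm
  refine Finset.sum_nbij (fun σ => List.ofFn fun i : Fin (m+1) => x (σ i.castSucc)) ?_ ?_ ?_ ?_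
  · intro σ hσ
    have hσ' := (Finset.mem_filter.mp hσ).2
    rw [mem_ords]
    refine ⟨List.nodup_ofFn.mpr (hx.comp (σ.injective.comp (Fin.castSucc_injective _))), ?_⟩
    ext a
    simp only [List.mem_toFinset, List.mem_ofFn, Set.mem_range, Finset.mem_image, Finset.mem_univ, true_and]
    constructor
    · rintro ⟨i, rfl⟩
      have : σ i.castSucc ≠ Fin.last (m+1) := fun h =>
        (Fin.castSucc_lt_last i).ne (σ.injective (h.trans hσ'.symm))
      exact ⟨(σ i.castSucc).castPred this, by rw [Fin.castSucc_castPred]⟩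
    · rintro ⟨i, rfl⟩
      have : σ.symm i.castSucc ≠ Fin.last (m+1) := fun h => by
        have := congrArg σ h
        rw [Equiv.apply_symm_apply, hσ'] at this
        exact (Fin.castSucc_lt_last i).ne this
      exact ⟨(σ.symm i.castSucc).castPred this, by rw [Fin.castSucc_castPred, Equiv.apply_symm_apply]⟩
  · intro σ hσ τ hτ h
    have hσ' := (Finset.mem_filter.mp hσ).2
    have hτ' := (Finset.mem_filter.mp hτ).2
    have h' := List.ofFn_injective h
    ext1 i
    induction i using Fin.lastCases with
    | last => rw [hσ', hτ']
    | cast i => exact hx (congrFun h' i)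
  · intro l hl
    have hl' : l ∈ ords (Finset.univ.image fun i : Fin (m+1) => x i.castSucc) := hl
    have hlen := ords_length hl'
    have hci : Function.Injective (fun i : Fin (m+1) => x i.castSucc) := hx.comp (Fin.castSucc_injective _)
    rw [Finset.card_image_of_injective _ hci, Finset.card_univ, Fintype.card_fin] at hlen
    obtain ⟨hnd, hfs⟩ := mem_ords.mp hl'
    have hz : ∃ z : Fin (m+1) → ℝ, l = List.ofFn z := by
      refine ⟨fun i => l.get (i.cast hlen.symm), ?_⟩
      apply List.ext_get
      · rw [List.length_ofFn]; exact hlen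
      · intro n h1 h2; rw [List.get_ofFn]; rfl
    obtain ⟨z, rfl⟩ := hz
    have hzi := List.nodup_ofFn.mp hnd
    have hmem : ∀ i, ∃ j : Fin (m+1), x j.castSucc = z i := by
      intro i
      have : z i ∈ (List.ofFn z).toFinset := List.mem_toFinset.mpr (List.mem_ofFn.mpr ⟨i, rfl⟩)
      rw [hfs] at this
      simpa using this
    choose s hs using hmem
    have hsi : Function.Injective s := fun a b h => hzi (by rw [← hs, ← hs, h])
    let t : Fin (m+2) → Fin (m+2) := Fin.lastCases (Fin.last (m+1)) (fun i => (s i).castSucc)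
    have tl : t (Fin.last (m+1)) = Fin.last (m+1) := by simp [t]
    have tc : ∀ i : Fin (m+1), t i.castSucc = (s i).castSucc := fun i => by simp [t]
    have hti : Function.Injective t := by
      intro a b h
      induction a using Fin.lastCases with
      | last =>
        induction b using Fin.lastCases with
        | last => rfl
        | cast b => rw [tl, tc] at h; exact absurd h (Fin.castSucc_lt_last _).ne'
      | cast a =>
        induction b using Fin.lastCases with
        | last => rw [tl, tc] at h; exact absurd h (Fin.castSucc_lt_last _).ne
        | cast b => rw [tc, tc] at h; rw [hsi (Fin.castSucc_injective _ h)]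
    refine ⟨Equiv.ofBijective t (Finite.injective_iff_bijective.mp hti), ?_, ?_⟩
    · simp [tl]
    · simp only [Equiv.ofBijective_apply, tc, hs]
  · intro σ _; rfl

theorem pointwise (C : List ℕ → ℚ) (hC : IsNormalizedWitten C) {x : Fin (m+2) → ℝ} (hx : Function.Injective x) (h0 : ∀ i, x i ≠ 0)
    (w : ℕ) (hw : 2 ≤ w) :
    ∑ e ∈ Finset.Nat.antidiagonalTuple (m+2) w, Hs C (List.ofFn e : Multiset ℕ) * ∏ i, ((x i)⁻¹)^(e i) =
    - ∑ σ ∈ Finset.univ.filter (fun σ : Equiv.Perm (Fin (m + 2)) => σ (Fin.last (m + 1)) = Fin.last (m + 1)),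
        (∏ r, (x (σ r) - x (σ (r+1))))⁻¹ * ∑ kk ∈ Finset.Nat.antidiagonalTuple (m+2) w,
        ((Matrix.trace (List.ofFn (fun q => Amat (kk q))).prod : ℚ) : ℝ) * ∏ q, (x (σ q))^(1 - (kk q : ℤ)) := by
  set L : Finset ℝ := Finset.univ.image fun i : Fin (m+1) => x i.castSucc with hL
  set y := x (Fin.last (m+1)) with hy
  have hyL : y ∉ L := by
    rw [hL, Finset.mem_image]; rintro ⟨i, _, hi⟩
    exact (Fin.castSucc_lt_last i).ne (hx hi)
  have h0L : (0:ℝ) ∉ L := by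
    rw [hL, Finset.mem_image]; rintro ⟨i, _, hi⟩; exact h0 _ hi
  have key := congrArg (PowerSeries.coeff w) (F_eq_W hC y L (h0 _) hyL h0L)
  have hperm : (y :: L.toList).Perm (List.ofFn x) := by
    refine (List.perm_ext_iff_of_nodup ?_ (List.nodup_ofFn.mpr hx)).mpr ?_
    · rw [List.nodup_cons]; exact ⟨by simpa using hyL, L.nodup_toList⟩
    · intro a
      simp only [List.mem_cons, Finset.mem_toList, List.mem_ofFn, hL, Finset.mem_image, Finset.mem_univ, true_and, Set.mem_range]
      constructor
      · rintro (h | ⟨i, h⟩)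
        · exact ⟨_, h.symm⟩
        · exact ⟨_, h⟩
      · rintro ⟨i, h⟩
        induction i using Fin.lastCases with
        | last => left; exact h.symm
        | cast i => right; exact ⟨i, h⟩
  have eF : F1 C y L = genl (List.ofFn x) (Hs C) := by
    rw [← genl_perm hperm]; rfl
  rw [eF, coeff_genl] at key
  rw [key, Wf, map_add]
  have eE : PowerSeries.coeff w (Ec y L) = 0 := by
    rw [Ec]
    split_ifs with h1 h2
    · exfalso
      have : x (Fin.castSucc 0) ∈ L := by rw [hL]; exact Finset.mem_image_of_mem _ (Finset.mem_univ _)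
      rw [h1] at this; simp at this
    · rw [map_neg, coeff_smul', v, PowerSeries.coeff_X, if_neg (by omega), mul_zero, neg_zero]
    · exact map_zero _
  rw [eE, add_zero, W, map_neg, G, trace_mul_G2, hL, sum_ords_perm hx, map_sum]
  congr 1
  refine Finset.sum_congr rfl fun σ hσ => ?_
  have hσ' := (Finset.mem_filter.mp hσ).2
  have e1 := cw2_ofFn (fun r => x (σ r))
  have e2 := Mp_ofFn_last (fun r => x (σ r))
  simp only [hσ'] at e1 e2
  rw [← hy] at e1 e2
  rw [coeff_smul', e1, Matrix.trace_mul_comm, ← e2, coeff_tr_Mp]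
end

section
open MvPolynomial
variable {m : ℕ}

def fpol (C : List ℕ → ℚ) (m w : ℕ) : MP m := ∑ e ∈ Finset.Nat.antidiagonalTuple (m+2) w,
  monomial (Finsupp.equivFunOnFinite.symm fun i => w - e i) (Hs C (List.ofFn e : Multiset ℕ))
def Ppol (w : ℕ) (σ : Equiv.Perm (Fin (m+2))) : MP m := ∑ kk ∈ Finset.Nat.antidiagonalTuple (m+2) w,
  monomial (Finsupp.equivFunOnFinite.symm fun i => w + 1 - kk (σ.symm i))
    ((Matrix.trace (List.ofFn (fun q => Amat (kk q))).prod : ℚ) : ℝ)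
def Dall (m : ℕ) : MP m := ∏ p ∈ Finset.univ.offDiag, (X p.1 - X p.2)
def prs (σ : Equiv.Perm (Fin (m+2))) : Finset (Fin (m+2) × Fin (m+2)) := Finset.univ.image fun r => (σ r, σ (r+1))
def cpol (σ : Equiv.Perm (Fin (m+2))) : MP m := ∏ p ∈ Finset.univ.offDiag \ prs σ, (X p.1 - X p.2)

theorem denp_cpol (σ : Equiv.Perm (Fin (m+2))) : denp σ * cpol σ = Dall m := by
  have h : prs σ ⊆ Finset.univ.offDiag := by
    intro p hp
    obtain ⟨r, _, rfl⟩ := Finset.mem_image.mp hp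
    rw [Finset.mem_offDiag]
    exact ⟨Finset.mem_univ _, Finset.mem_univ _, fun h => fin_ne r (σ.injective h).symm⟩
  rw [Dall, ← Finset.prod_sdiff h, mul_comm, cpol]
  congr 1
  rw [prs, Finset.prod_image]
  · rfl
  · intro a _ b _ h
    exact σ.injective (Prod.ext_iff.mp h).1

theorem tuple_le {w : ℕ} {k : ℕ} {e : Fin k → ℕ} (he : e ∈ Finset.Nat.antidiagonalTuple k w) (i : Fin k) : e i ≤ w := by
  rw [← Finset.Nat.mem_antidiagonalTuple.mp he]
  exact Finset.single_le_sum (f := e) (fun _ _ => Nat.zero_le _) (Finset.mem_univ i)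

theorem eval_fpol (C : List ℕ → ℚ) (w : ℕ) {x : Fin (m+2) → ℝ} (h0 : ∀ i, x i ≠ 0) : eval x (fpol C m w) =
    (∏ i, x i ^ w) * ∑ e ∈ Finset.Nat.antidiagonalTuple (m+2) w, Hs C (List.ofFn e : Multiset ℕ) * ∏ i, ((x i)⁻¹)^(e i) := by
  rw [fpol, map_sum, Finset.mul_sum]
  refine Finset.sum_congr rfl fun e he => ?_
  rw [eval_monomial, Finsupp.prod_fintype _ _ (fun i => pow_zero _), mul_left_comm, ← Finset.prod_mul_distrib]
  congr 1
  refine Finset.prod_congr rfl fun i _ => ?_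
  have := tuple_le he i
  rw [Finsupp.equivFunOnFinite_symm_apply_apply, inv_pow, ← div_eq_mul_inv, pow_sub₀ _ (h0 i) this, div_eq_mul_inv]

theorem eval_Ppol (w : ℕ) (σ : Equiv.Perm (Fin (m+2))) {x : Fin (m+2) → ℝ} (h0 : ∀ i, x i ≠ 0) : eval x (Ppol w σ) =
    (∏ i, x i ^ w) * ∑ kk ∈ Finset.Nat.antidiagonalTuple (m+2) w,
        ((Matrix.trace (List.ofFn (fun q => Amat (kk q))).prod : ℚ) : ℝ) * ∏ q, (x (σ q))^(1 - (kk q : ℤ)) := by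
  rw [Ppol, map_sum, Finset.mul_sum]
  refine Finset.sum_congr rfl fun e he => ?_
  rw [eval_monomial, Finsupp.prod_fintype _ _ (fun i => pow_zero _), mul_left_comm,
    ← Equiv.prod_comp σ (fun i => x i ^ w), ← Finset.prod_mul_distrib]
  congr 1
  rw [← Equiv.prod_comp σ]
  refine Finset.prod_congr rfl fun i _ => ?_
  have := tuple_le he i
  rw [Finsupp.equivFunOnFinite_symm_apply_apply, Equiv.symm_apply_apply, ← zpow_natCast, ← zpow_natCast, ← zpow_add₀ (h0 _)]
  congr 1
  omega

theorem X_sub_ne {i j : Fin (m+2)} (h : i ≠ j) : (X i - X j : MP m) ≠ 0 :=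
  sub_ne_zero.mpr fun h' => h (X_injective h')

theorem poly_id (C : List ℕ → ℚ) (hC : IsNormalizedWitten C) (w : ℕ) (hw : 2 ≤ w) :
    Dall m * fpol C m w + ∑ σ ∈ Finset.univ.filter (fun σ : Equiv.Perm (Fin (m + 2)) => σ (Fin.last (m + 1)) = Fin.last (m + 1)),
      Ppol w σ * cpol σ = 0 := by
  have hD : Dall m * ∏ i, X i ≠ 0 := by
    refine mul_ne_zero ?_ (Finset.prod_ne_zero_iff.mpr fun i _ => X_ne_zero i)
    exact Finset.prod_ne_zero_iff.mpr fun p hp => X_sub_ne (Finset.mem_offDiag.mp hp).2.2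
  refine (mul_eq_zero.mp ?_).resolve_left hD
  apply MvPolynomial.funext
  intro x
  rw [map_mul, map_zero]
  by_cases hx : Function.Injective x ∧ ∀ i, x i ≠ 0
  · obtain ⟨hx, h0⟩ := hx
    apply mul_eq_zero_of_right
    rw [map_add, map_mul, map_sum, eval_fpol C w h0, pointwise C hC hx h0 w hw]
    have : ∀ σ : Equiv.Perm (Fin (m+2)), eval x (Ppol w σ * cpol σ) = eval x (Dall m) * ((∏ i, x i ^ w) *
        ((∏ r, (x (σ r) - x (σ (r+1))))⁻¹ * ∑ kk ∈ Finset.Nat.antidiagonalTuple (m+2) w,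
        ((Matrix.trace (List.ofFn (fun q => Amat (kk q))).prod : ℚ) : ℝ) * ∏ q, (x (σ q))^(1 - (kk q : ℤ)))) := by
      intro σ
      rw [map_mul, eval_Ppol w σ h0, ← denp_cpol σ, map_mul, denp, map_prod]
      simp only [map_sub, eval_X]
      have hne : ∏ r, (x (σ r) - x (σ (r+1))) ≠ 0 :=
        Finset.prod_ne_zero_iff.mpr fun r _ => sub_ne_zero.mpr fun h => fin_ne r (σ.injective (hx h)).symm
      field_simp
    simp only [this]
    rw [← Finset.mul_sum, ← Finset.mul_sum]
    ring
  · apply mul_eq_zero_of_left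
    rw [map_mul, map_prod]
    rw [not_and_or] at hx
    rcases hx with hx | hx
    · apply mul_eq_zero_of_left
      rw [Dall, map_prod]
      obtain ⟨i, j, hij, hne⟩ : ∃ i j, x i = x j ∧ i ≠ j := by
        simpa [Function.Injective] using hx
      refine Finset.prod_eq_zero (i := (i, j)) (Finset.mem_offDiag.mpr ⟨Finset.mem_univ _, Finset.mem_univ _, hne⟩) ?_
      simp [hij]
    · apply mul_eq_zero_of_right
      push Not at hx
      obtain ⟨i, hi⟩ := hx
      exact Finset.prod_eq_zero (Finset.mem_univ i) (by simp [hi])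

theorem formula_H (C : List ℕ → ℚ) (hC : IsNormalizedWitten C) (d : Fin (m+2) → ℕ) :
    Hs C (List.ofFn (fun i => d i + 1) : Multiset ℕ) =
    - ∑ σ ∈ Finset.univ.filter (fun σ : Equiv.Perm (Fin (m + 2)) => σ (Fin.last (m + 1)) = Fin.last (m + 1)),
      ∑ kk ∈ Finset.Nat.antidiagonalTuple (m + 2) ((∑ j, d j) + (m + 2)),
        ((Matrix.trace (List.ofFn (fun q => Amat (kk q))).prod : ℚ) : ℝ) *
          Ks σ (fun i => (d i : ℤ) + 2 - kk (σ.symm i)) := by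
  set w := (∑ j, d j) + (m+2) with hw
  set S := Finset.univ.filter (fun σ : Equiv.Perm (Fin (m + 2)) => σ (Fin.last (m + 1)) = Fin.last (m + 1)) with hS
  have hdw : (fun i => d i + 1) ∈ Finset.Nat.antidiagonalTuple (m+2) w := by
    rw [Finset.Nat.mem_antidiagonalTuple, Finset.sum_add_distrib, hw]; simp
  have key := extract S (fun σ hσ => (Finset.mem_filter.mp hσ).2) (fpol C m w) (Ppol w) cpol
    (fun σ _ => denp_cpol σ) (poly_id C hC w (by omega))
  have k2 := congrFun key (fun i => (d i : ℤ) + 1 - w)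
  rw [Pi.add_apply, Finset.sum_apply, Pi.zero_apply] at k2
  have e1 : ac (fpol C m w) dlt (fun i => (d i : ℤ) + 1 - w) = Hs C (List.ofFn (fun i => d i + 1) : Multiset ℕ) := by
    rw [fpol, map_sum, LinearMap.sum_apply, Finset.sum_apply, Finset.sum_eq_single_of_mem _ hdw]
    · rw [ac_monomial, dlt, if_pos, mul_one]
      funext i
      have := tuple_le hdw i
      rw [Finsupp.equivFunOnFinite_symm_apply_apply, Pi.zero_apply]
      beta_reduce at this ⊢
      omega
    · intro e he hne
      rw [ac_monomial, dlt, if_neg, mul_zero]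
      intro h
      apply hne
      funext i
      have h1 := congrFun h i
      have := tuple_le he i
      rw [Finsupp.equivFunOnFinite_symm_apply_apply, Pi.zero_apply] at h1
      omega
  have e2 : ∀ σ ∈ S, ac (Ppol w σ) (Ks σ) (fun i => (d i : ℤ) + 1 - w) = ∑ kk ∈ Finset.Nat.antidiagonalTuple (m + 2) w,
        ((Matrix.trace (List.ofFn (fun q => Amat (kk q))).prod : ℚ) : ℝ) *
          Ks σ (fun i => (d i : ℤ) + 2 - kk (σ.symm i)) := by
    intro σ _
    rw [Ppol, map_sum, LinearMap.sum_apply, Finset.sum_apply]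
    refine Finset.sum_congr rfl fun kk hk => ?_
    rw [ac_monomial]
    congr 2
    funext i
    have := tuple_le hk (σ.symm i)
    rw [Finsupp.equivFunOnFinite_symm_apply_apply]
    omega
  rw [e1, Finset.sum_congr rfl e2] at k2
  linarith

theorem norm_Fl (C : List ℕ → ℚ) (d : Fin (m+2) → ℕ) (g : ℕ)
    (hg : (g : ℚ) = gQ (List.ofFn d)) (hpos : 2 < 2 * g + (m + 2)) :
    C (List.ofFn d) = 2^(2*g) / (3 ^ (2 * g + m) * ((2 * g + m - 1).factorial : ℚ)) * Fl C (List.ofFn d) := by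
  have hX : XN (List.ofFn d) = 2 * g + m := by
    unfold XN
    unfold gQ at hg
    have hl : (List.ofFn d).length = m + 2 := List.length_ofFn
    generalize List.ofFn d = l at *
    rw [hl] at hg ⊢
    have : (3 * g + (m + 2) : ℚ) = 3 + (l.sum : ℕ) := by
      rw [hg, Nat.cast_add, Nat.cast_ofNat]; ring
    have h2 : 3 * g + (m + 2) = 3 + l.sum := by exact_mod_cast this
    omega
  rw [Fl, hX, List.length_ofFn, div_pow, pow_add 2 (2*g) m, pow_add 2 m 2]
  have h1 : ((2 * g + m - 1).factorial : ℚ) ≠ 0 := by positivity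
  field_simp
  norm_num
end

/-- Explicit formula for normalized Witten intersection numbers (Proposition 2):
for `n = m + 2 ≥ 2` and `d ∈ (ℤ_{≥0})^n` with `g(d) = g ∈ ℤ_{≥0}` and
`2g − 2 + n > 0`,
`C(d) = Σ_{σ(n)=n} (−1)^{|S_σ⁻|+1} Σ_{k_j ≥ −1, Σk = Σd} a_{k₁,…,kₙ} ω_{d,σ,k}`,
where `a_k = 2^{2g} tr(A_{k₁}⋯A_{kₙ})/(3^{2g+n−2}(2g+n−3)!)` and
`ω_{d,σ,k} = max{0, min_{r∈S_σ⁺} Σ_{q≤r}(d_{σ(q)}−k_q) + min_{r∈S_σ⁻} Σ_{q≤r}(k_q−d_{σ(q)})}`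
(the sum over `k` is encoded via `kk j = k_j + 1 ∈ ℕ`, indices are cyclic so that
`σ(n+1) = σ(1)`, and the minima are encoded as `sInf` of the corresponding finite
nonempty sets of reals). -/
theorem explicit_formula (C : List ℕ → ℚ) (hC : IsNormalizedWitten C)
    (m : ℕ) (d : Fin (m + 2) → ℕ) (g : ℕ)
    (hg : (g : ℚ) = gQ (List.ofFn d)) (hpos : 2 < 2 * g + (m + 2)) :
    (C (List.ofFn d) : ℝ) =
      ∑ σ ∈ Finset.univ.filter
          (fun σ : Equiv.Perm (Fin (m + 2)) => σ (Fin.last (m + 1)) = Fin.last (m + 1)),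
        (-1 : ℝ) ^ ((Finset.univ.filter (fun r : Fin (m + 2) => σ (r + 1) < σ r)).card + 1) *
          ∑ kk ∈ Finset.Nat.antidiagonalTuple (m + 2) ((∑ j, d j) + (m + 2)),
            ((2 ^ (2 * g) *
                (Matrix.trace ((List.ofFn (fun j => Amat (kk j))).prod)) /
                (3 ^ (2 * g + m) * ((2 * g + m - 1).factorial : ℚ)) : ℚ) : ℝ) *
              max 0
                (sInf {x : ℝ | ∃ r : Fin (m + 2), σ r < σ (r + 1) ∧
                    x = ∑ q ∈ Finset.univ.filter (fun q : Fin (m + 2) => q ≤ r),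
                          ((d (σ q) : ℝ) - ((kk q : ℝ) - 1))} +
                 sInf {x : ℝ | ∃ r : Fin (m + 2), σ (r + 1) < σ r ∧
                    x = ∑ q ∈ Finset.univ.filter (fun q : Fin (m + 2) => q ≤ r),
                          (((kk q : ℝ) - 1) - (d (σ q) : ℝ))}) := by
  have hH := formula_H C hC d
  have h1 : Hs C (List.ofFn (fun i => d i + 1) : Multiset ℕ) = ((Fl C (List.ofFn d) : ℚ) : ℝ) := by
    rw [← Hs_coe hC, Multiset.map_coe, List.map_ofFn]; rfl
  rw [h1] at hH
  have hN := norm_Fl C d g hg hpos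
  have hN' : (C (List.ofFn d) : ℝ) = ((2^(2*g) / (3 ^ (2 * g + m) * ((2 * g + m - 1).factorial : ℚ)) : ℚ) : ℝ) *
      ((Fl C (List.ofFn d) : ℚ) : ℝ) := by
    rw [← Rat.cast_mul, ← hN]
  rw [hN', hH, mul_neg, Finset.mul_sum, ← Finset.sum_neg_distrib]
  refine Finset.sum_congr rfl fun σ hσ => ?_
  have hσ' := (Finset.mem_filter.mp hσ).2
  rw [Finset.mul_sum, Finset.mul_sum, ← Finset.sum_neg_distrib]
  refine Finset.sum_congr rfl fun kk hk => ?_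
  have hk' := Finset.Nat.mem_antidiagonalTuple.mp hk
  have hk2 : (∑ j, (kk j : ℤ)) = (∑ j, (d j : ℤ)) + (m + 2) := by exact_mod_cast hk'
  have h0 : ∑ r, ((fun i => (d i : ℤ) + 2 - kk (σ.symm i)) (σ r) - 1) = 0 := by
    simp only [Equiv.symm_apply_apply]
    rw [Finset.sum_sub_distrib, Finset.sum_sub_distrib, Finset.sum_add_distrib, hk2,
      Equiv.sum_comp σ (fun i => (d i : ℤ))]
    simp
    ring
  rw [Ks_eq hσ' h0]
  have s1 : ∀ r, ((Ssum σ (fun i => (d i : ℤ) + 2 - kk (σ.symm i)) r : ℤ) : ℝ) =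
      ∑ q ∈ Finset.univ.filter (fun q : Fin (m + 2) => q ≤ r), ((d (σ q) : ℝ) - ((kk q : ℝ) - 1)) := by
    intro r
    rw [Ssum]
    push_cast
    refine Finset.sum_congr rfl fun q _ => ?_
    rw [Equiv.symm_apply_apply]; ring
  have s2 : ∀ r, -((Ssum σ (fun i => (d i : ℤ) + 2 - kk (σ.symm i)) r : ℤ) : ℝ) =
      ∑ q ∈ Finset.univ.filter (fun q : Fin (m + 2) => q ≤ r), (((kk q : ℝ) - 1) - (d (σ q) : ℝ)) := by
    intro r
    rw [s1, ← Finset.sum_neg_distrib]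
    refine Finset.sum_congr rfl fun q _ => by ring
  simp only [s2]
  simp only [s1]
  push_cast
  ring


end WittenAsym
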